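/- Let GUEₙ be the probability measure on the real vector space of n×n complex Hermitian matrices whose density with respect to an additive Haar (Lebesgue) measure on that space is proportional to exp(−tr(M²)). For an interval I ⊆ ℝ, γ > 0 and a Hermitian matrix M with eigenvalues λ₁(M) ≤ … ≤ λₙ(M) (with multiplicity), let G_{γ,I}(M) be the number of unordered pairs {j,k}, j ≠ k, with |λⱼ(M) − λₖ(M)| ≤ γ and (λⱼ(M) + λₖ(M))/2 ∈ I. Let μ = (π²·γ³/9) · ∫_I Kₙ(x,x)⁴ dx, where Kₙ(x,x) = e^{−x²}/(2ⁿ·(n−1)!·√π)·( Hₙ'(x)·H_{n−1}(x) − H_{n−1}'(x)·Hₙ(x) ), and let Mₖ(μ) be the k-th moment of a Poisson random variable with mean μ. Then for every ε > 0 and every integer k ≥ 1 there is a constant C (depending only on k and ε) such that for all n ≥ 1, all γ > 0 and all intervals I ⊆ ( −(√2−ε)√n, (√2−ε)√n ): | ∫ G_{γ,I}(M)^k dGUEₙ(M) − Mₖ(μ) | ≤ C · Mₖ(μ) · ( n⁻¹ + n·γ² + (√n·|I|)^{−2/3} ). -/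

import Mathlib

open MeasureTheory Real
open scoped ENNReal

noncomputable instance matrixMeasurableSpace {m n α : Type*} [MeasurableSpace α] :
    MeasurableSpace (Matrix m n α) :=
  inferInstanceAs (MeasurableSpace (m → n → α))

namespace GM

/-- Normalised Hermite functions. -/
noncomputable def psi (j : ℕ) (x : ℝ) : ℝ :=
  Polynomial.aeval (x * √2) (Polynomial.hermite j) * Real.exp (-x ^ 2 / 2) / √((j.factorial : ℝ) * √π)

lemma derivative_hermite (n : ℕ) :
    Polynomial.derivative (Polynomial.hermite (n + 1)) = ((n : Polynomial ℤ) + 1) * Polynomial.hermite n := by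
  induction n with
  | zero => simp
  | succ n ih =>
    rw [Polynomial.hermite_succ (n + 1), Polynomial.derivative_sub, Polynomial.derivative_mul, ih]
    simp only [Polynomial.derivative_X, Polynomial.derivative_mul, Polynomial.derivative_add,
      Polynomial.derivative_natCast, Polynomial.derivative_one]
    rw [Polynomial.hermite_succ n]
    push_cast
    ring

lemma derivative_hermite' (n : ℕ) :
    Polynomial.derivative (Polynomial.hermite n) = (n : Polynomial ℤ) * Polynomial.hermite (n - 1) := by
  cases n with
  | zero => simp
  | succ n => rw [derivative_hermite]; simp

lemma hermite_rec (n : ℕ) : Polynomial.hermite (n + 1) =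
    Polynomial.X * Polynomial.hermite n - (n : Polynomial ℤ) * Polynomial.hermite (n - 1) := by
  rw [Polynomial.hermite_succ, derivative_hermite']

noncomputable def hz (j : ℕ) : ℝ := √((j.factorial : ℝ) * √π)

lemma hz_pos (j : ℕ) : 0 < hz j := by unfold hz; positivity

lemma hz_succ (j : ℕ) : hz (j + 1) = √((j : ℝ) + 1) * hz j := by
  unfold hz
  rw [← Real.sqrt_mul (by positivity), Nat.factorial_succ]; push_cast; ring_nf

lemma psi_rec (j : ℕ) (x : ℝ) :
    x * psi j x = √((j : ℝ) / 2) * psi (j - 1) x + √(((j : ℝ) + 1) / 2) * psi (j + 1) x := by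
  have h2 : √2 * √2 = (2:ℝ) := Real.mul_self_sqrt (by norm_num)
  have h2' : √(2:ℝ) ≠ 0 := by positivity
  have hA : √(((j : ℝ) + 1) / 2) = √((j:ℝ)+1) / √2 := Real.sqrt_div (by positivity) _
  have hB : √((j : ℝ) / 2) = √(j:ℝ) / √2 := Real.sqrt_div (by positivity) _
  have hs : √((j:ℝ)+1) * √((j:ℝ)+1) = (j:ℝ)+1 := Real.mul_self_sqrt (by positivity)
  have hs' : √((j:ℝ)+1) ≠ 0 := by positivity
  change x * (_ / hz j) = _ * (_ / hz (j-1)) + _ * (_ / hz (j+1))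
  rw [hermite_rec, hz_succ, hA, hB]
  simp only [map_sub, map_mul, Polynomial.aeval_X, map_natCast]
  have hj := (hz_pos j).ne'
  cases j with
  | zero => simp; field_simp;
  | succ i =>
    have hi := (hz_pos i).ne'
    have ht : √((i:ℝ)+1) * √((i:ℝ)+1) = (i:ℝ)+1 := Real.mul_self_sqrt (by positivity)
    have ht' : √((i:ℝ)+1) ≠ 0 := by positivity
    rw [hz_succ]
    simp only [Nat.add_sub_cancel]
    push_cast at *
    have ht2 : √((i:ℝ)+1) ^ 2 = (i:ℝ)+1 := by rw [sq]; exact ht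
    have h22 : √2 ^ 2 = (2:ℝ) := by rw [sq]; exact h2
    field_simp
    rw [ht2]
    ring

lemma hasDerivAt_psi (j : ℕ) (x : ℝ) :
    HasDerivAt (psi j) (√((j : ℝ) / 2) * psi (j - 1) x - √(((j : ℝ) + 1) / 2) * psi (j + 1) x) x := by
  have h1 : HasDerivAt (fun x : ℝ => Polynomial.aeval (x * √2) (Polynomial.hermite j))
      (Polynomial.aeval (x * √2) (Polynomial.derivative (Polynomial.hermite j)) * √2) x := by
    have := (Polynomial.hasDerivAt_aeval (Polynomial.hermite j) (x * √2))
    exact this.comp x (by simpa using (hasDerivAt_id x).mul_const (√2))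
  have h2 : HasDerivAt (fun x : ℝ => Real.exp (-x ^ 2 / 2)) (Real.exp (-x^2/2) * (-x)) x := by
    have : HasDerivAt (fun x : ℝ => -x ^ 2 / 2) (-x) x := by
      have := ((hasDerivAt_pow 2 x).neg).div_const 2
      exact this.congr_deriv (by simp; ring)
    exact this.exp
  have h3 := (h1.mul h2).div_const (√((j.factorial : ℝ) * √π))
  have h4 : √((j : ℝ) / 2) * psi (j - 1) x - √(((j : ℝ) + 1) / 2) * psi (j + 1) x =
    2 * (√((j : ℝ) / 2) * psi (j - 1) x) - x * psi j x := by rw [psi_rec]; ring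
  rw [h4]
  refine HasDerivAt.congr_deriv h3 ?_
  symm
  rw [derivative_hermite']
  simp only [map_mul, map_natCast]
  change 2 * (_ * (_ / hz (j-1))) - x * (_ / hz j) = _ / hz j
  have hB : √((j : ℝ) / 2) = √(j:ℝ) / √2 := Real.sqrt_div (by positivity) _
  have h22 : √2 ^ 2 = (2:ℝ) := Real.sq_sqrt (by norm_num)
  rw [hB]
  have hj := (hz_pos j).ne'
  cases j with
  | zero => simp; ring
  | succ i =>
    have hi := (hz_pos i).ne'
    have ht2 : √((i:ℝ)+1) ^ 2 = (i:ℝ)+1 := Real.sq_sqrt (by positivity)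
    have ht' : √((i:ℝ)+1) ≠ 0 := by positivity
    rw [hz_succ]
    simp only [Nat.add_sub_cancel]
    push_cast at *
    field_simp
    rw [ht2]
    linear_combination (-((i:ℝ) + 1) * (Polynomial.aeval (√2 * x)) (Polynomial.hermite i)) * h22

/-- r-th derivative of psi j, via the ladder relation. -/
noncomputable def dpsi : ℕ → ℕ → ℝ → ℝ
  | 0, j, x => psi j x
  | r + 1, j, x => √((j : ℝ) / 2) * dpsi r (j - 1) x - √(((j : ℝ) + 1) / 2) * dpsi r (j + 1) x

lemma hasDerivAt_dpsi (r j : ℕ) (x : ℝ) : HasDerivAt (dpsi r j) (dpsi (r + 1) j x) x := by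
  induction r generalizing j x with
  | zero => exact hasDerivAt_psi j x
  | succ r ih =>
    exact ((ih (j-1) x).const_mul _).sub ((ih (j+1) x).const_mul _)

lemma continuous_dpsi (r j : ℕ) : Continuous (dpsi r j) :=
  continuous_iff_continuousAt.2 fun x => (hasDerivAt_dpsi r j x).continuousAt

lemma continuous_psi (j : ℕ) : Continuous (psi j) := continuous_dpsi 0 j

/-- lowering relation -/
lemma psi_deriv_low (j : ℕ) (x : ℝ) : dpsi 1 j x = 2 * (√((j:ℝ)/2) * psi (j-1) x) - x * psi j x := by
  rw [psi_rec]; simp only [dpsi]; ring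

lemma psi_deriv_raise (j : ℕ) (x : ℝ) :
    dpsi 1 j x = x * psi j x - 2 * (√(((j:ℝ)+1)/2) * psi (j+1) x) := by
  rw [psi_rec]; simp only [dpsi]; ring

lemma integrable_poly_gauss (p : Polynomial ℝ) :
    Integrable (fun x : ℝ => p.eval x * Real.exp (-x ^ 2)) := by
  induction p using Polynomial.induction_on' with
  | add p q hp hq =>
    simp only [Polynomial.eval_add, add_mul]; exact hp.add hq
  | monomial m c =>
    have h := integrable_rpow_mul_exp_neg_mul_sq (b := 1) one_pos (s := m) (by
      have : (0:ℝ) ≤ m := by positivity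
      linarith)
    have := h.const_mul c
    refine this.congr (Filter.Eventually.of_forall fun x => ?_)
    simp [Polynomial.eval_monomial, mul_assoc]

lemma psi_mul_psi (i j : ℕ) : ∃ p : Polynomial ℝ, ∀ x, psi i x * psi j x = p.eval x * Real.exp (-x^2) := by
  let q : ℕ → Polynomial ℝ := fun i =>
    ((Polynomial.hermite i).map (Int.castRingHom ℝ)).comp (Polynomial.X * Polynomial.C (√2)) *
      Polynomial.C (hz i)⁻¹
  refine ⟨q i * q j, fun x => ?_⟩
  have he : Real.exp (-x^2) = Real.exp (-x^2/2) * Real.exp (-x^2/2) := by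
    rw [← Real.exp_add]; ring_nf
  have key : ∀ i, psi i x = (q i).eval x * Real.exp (-x^2/2) := by
    intro i
    simp only [q, Polynomial.eval_mul, Polynomial.eval_comp, Polynomial.eval_X, Polynomial.eval_C,
      Polynomial.eval_map]
    simp only [psi, hz, Polynomial.aeval_def, div_eq_mul_inv]
    rw [show algebraMap ℤ ℝ = Int.castRingHom ℝ from rfl]
    ring
  rw [key i, key j, he, Polynomial.eval_mul (p := q i)]; ring

lemma integrable_psi_mul (i j : ℕ) : Integrable (fun x => psi i x * psi j x) := by
  obtain ⟨p, hp⟩ := psi_mul_psi i j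
  simp only [hp]; exact integrable_poly_gauss p

lemma integrable_dpsi_mul (r s i j : ℕ) : Integrable (fun x => dpsi r i x * dpsi s j x) := by
  induction r generalizing i with
  | zero =>
    induction s generalizing j with
    | zero => exact integrable_psi_mul i j
    | succ s ih =>
      have := ((ih (j-1)).const_mul (√((j : ℝ) / 2))).sub ((ih (j+1)).const_mul (√(((j : ℝ) + 1) / 2)))
      refine this.congr (Filter.Eventually.of_forall fun x => ?_)
      simp only [dpsi, Pi.sub_apply]; ring
  | succ r ih =>
      have := ((ih (i-1)).const_mul (√((i : ℝ) / 2))).sub ((ih (i+1)).const_mul (√(((i : ℝ) + 1) / 2)))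
      refine this.congr (Filter.Eventually.of_forall fun x => ?_)
      simp only [dpsi, Pi.sub_apply]; ring

lemma integral_by_parts_psi (i j : ℕ) :
    ∫ x, psi i x * dpsi 1 j x = - ∫ x, dpsi 1 i x * psi j x := by
  exact integral_mul_deriv_eq_deriv_mul_of_integrable (u := psi i) (v := psi j)
    (u' := dpsi 1 i) (v' := dpsi 1 j)
    (fun x _ => hasDerivAt_dpsi 0 i x) (fun x _ => hasDerivAt_dpsi 0 j x)
    (integrable_dpsi_mul 0 1 i j) (integrable_dpsi_mul 1 0 i j) (integrable_dpsi_mul 0 0 i j)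

lemma inner_psi_step (i j : ℕ) :
    √(((j:ℝ)+1)/2) * ∫ x, psi i x * psi (j+1) x = √((i:ℝ)/2) * ∫ x, psi (i-1) x * psi j x := by
  have h := integral_by_parts_psi i j
  -- psi_i * dpsi_j = x psi_i psi_j - 2 √ psi_i psi_{j+1}
  have hs : ∫ x, (psi i x * dpsi 1 j x + dpsi 1 i x * psi j x) = 0 := by
    have := integral_add (integrable_dpsi_mul 0 1 i j) (integrable_dpsi_mul 1 0 i j)
    simp only [dpsi.eq_1] at this
    rw [this, h]; ring
  have he : ∀ x, psi i x * dpsi 1 j x + dpsi 1 i x * psi j x =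
      (2 * √((i:ℝ)/2)) * (psi (i-1) x * psi j x) - (2 * √(((j:ℝ)+1)/2)) * (psi i x * psi (j+1) x) := by
    intro x; rw [psi_deriv_raise j, psi_deriv_low i]; ring
  simp only [he] at hs
  rw [integral_sub ((integrable_psi_mul _ _).const_mul _) ((integrable_psi_mul _ _).const_mul _),
    integral_const_mul, integral_const_mul] at hs
  linarith

lemma psi_zero_eq (x : ℝ) : psi 0 x = Real.exp (-x^2/2) / √(√π) := by simp [psi]

lemma inner_psi (i j : ℕ) : ∫ x, psi i x * psi j x = if i = j then 1 else 0 := by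
  have h0 : ∀ j, ∫ x, psi 0 x * psi (j+1) x = 0 := by
    intro j
    have h := inner_psi_step 0 j
    have hp : √(((j:ℝ)+1)/2) ≠ 0 := by positivity
    simp only [Nat.cast_zero, zero_div, Real.sqrt_zero, zero_mul, mul_eq_zero] at h
    exact h.resolve_left hp
  induction j generalizing i with
  | zero =>
    cases i with
    | zero =>
      have he : ∀ x : ℝ, psi 0 x * psi 0 x = (√π)⁻¹ * Real.exp (-1 * x^2) := by
        intro x
        rw [psi_zero_eq, div_mul_div_comm, ← Real.exp_add, Real.mul_self_sqrt (by positivity)]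
        ring_nf
      simp only [he, integral_const_mul, integral_gaussian]
      have : √π ≠ 0 := by positivity
      simp [this]
    | succ i =>
      have : ∫ x, psi (i+1) x * psi 0 x = ∫ x, psi 0 x * psi (i+1) x := by
        congr 1; ext x; ring
      rw [this, h0]; simp
  | succ j ih =>
    cases i with
    | zero => rw [h0]; simp
    | succ i =>
      have h := inner_psi_step (i+1) j
      have hp : √(((j:ℝ)+1)/2) ≠ 0 := by positivity
      simp only [Nat.add_sub_cancel] at h
      rw [ih] at h
      by_cases hij : i = j
      · subst hij
        simp only [if_true, mul_one] at h ⊢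
        push_cast at h
        exact mul_left_cancel₀ hp (by rw [h, mul_one])
      · have : ¬ (i + 1 = j + 1) := by omega
        simp only [hij, this, if_false, mul_zero] at h ⊢
        exact (mul_eq_zero.1 h).resolve_left hp

end GM

namespace GM

noncomputable def dK (r s n : ℕ) (x y : ℝ) : ℝ := ∑ j ∈ Finset.range n, dpsi r j x * dpsi s j y

lemma dK_succ (r s n : ℕ) (x y : ℝ) : dK r s (n+1) x y = dK r s n x y + dpsi r n x * dpsi s n y := by
  simp [dK, Finset.sum_range_succ]

lemma dK_comm (r s n : ℕ) (x y : ℝ) : dK r s n x y = dK s r n y x := by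
  simp only [dK]; exact Finset.sum_congr rfl fun j _ => mul_comm _ _

/-- the coefficient `√(n/2)` -/
noncomputable def sn (n : ℕ) : ℝ := √((n:ℝ)/2)

lemma sn_sq (n : ℕ) : sn n ^ 2 = n / 2 := Real.sq_sqrt (by positivity)
lemma sn_nonneg (n : ℕ) : 0 ≤ sn n := Real.sqrt_nonneg _

lemma psi_rec' (n : ℕ) (x : ℝ) : sn (n+1) * psi (n+1) x = x * psi n x - sn n * psi (n-1) x := by
  have := psi_rec n x
  simp only [sn]; push_cast; linarith

lemma dpsi_one (n : ℕ) (x : ℝ) : dpsi 1 n x = sn n * psi (n-1) x - sn (n+1) * psi (n+1) x := by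
  simp only [dpsi, sn]; push_cast; ring

lemma dpsi_one_a (n : ℕ) (x : ℝ) : dpsi 1 n x = x * psi n x - 2 * (sn (n+1) * psi (n+1) x) := by
  rw [dpsi_one, psi_rec']; ring

lemma dpsi_one_b (n : ℕ) (x : ℝ) : dpsi 1 n x = 2 * (sn n * psi (n-1) x) - x * psi n x := by
  rw [dpsi_one, psi_rec']; ring

lemma dpsi_zero (n : ℕ) (x : ℝ) : dpsi 0 n x = psi n x := rfl

lemma christoffel (n : ℕ) (x y : ℝ) :
    (x - y) * dK 0 0 n x y = sn n * (psi n x * psi (n-1) y - psi (n-1) x * psi n y) := by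
  induction n with
  | zero => simp [dK, sn]
  | succ n ih =>
    rw [dK_succ, mul_add, ih, Nat.add_sub_cancel]
    have h1 := psi_rec' n x
    have h2 := psi_rec' n y
    simp only [dpsi_zero]
    linear_combination -(psi n y) * h1 + (psi n x) * h2

lemma Q_eq (n : ℕ) (x : ℝ) : dK 0 0 n x x =
    n * (psi (n-1) x ^2 + psi n x ^ 2) - 2 * sn n * x * psi (n-1) x * psi n x := by
  induction n with
  | zero => simp [dK, sn]
  | succ n ih =>
    rw [dK_succ, ih, Nat.add_sub_cancel]
    have h1 := psi_rec' n x
    have h2 := sn_sq n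
    have h3 := sn_sq (n+1)
    simp only [dpsi_zero]
    push_cast at *
    have h4 : ((n:ℝ)+1) * psi (n+1) x ^ 2 = 2 * (x * psi n x - sn n * psi (n-1) x)^2 := by
      rw [← h1]; linear_combination (-2 * psi (n+1) x ^ 2) * h3
    have h5 : 2 * sn (n+1) * x * psi n x * psi (n+1) x = 2 * x * psi n x * (x * psi n x - sn n * psi (n-1) x) := by
      rw [← h1]; ring
    linear_combination (-2 * psi (n-1) x ^2) * h2 - h4 + h5

lemma Q_deriv (n : ℕ) (x : ℝ) : dK 1 0 n x x = - sn n * psi (n-1) x * psi n x := by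
  induction n with
  | zero => simp [dK, sn]
  | succ n ih =>
    rw [dK_succ, ih, Nat.add_sub_cancel, dpsi_one]
    simp only [dpsi_zero]; ring

lemma S_eq (n : ℕ) (x : ℝ) : 3 * dK 1 1 n x x =
    (2 * n - x^2) * dK 0 0 n x x - 2 * n * (psi (n-1) x ^2 - psi n x ^ 2) := by
  induction n with
  | zero => simp [dK]
  | succ n ih =>
    have hQ := Q_eq n x
    rw [dK_succ, mul_add, ih, dK_succ, Nat.add_sub_cancel, dpsi_one_b]
    have h1 := psi_rec' n x
    have h2 := sn_sq n
    have h3 := sn_sq (n+1)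
    simp only [dpsi_zero]
    push_cast at *
    have h4 : ((n:ℝ)+1) * psi (n+1) x ^ 2 = 2 * (x * psi n x - sn n * psi (n-1) x)^2 := by
      rw [← h1]; linear_combination (-2 * psi (n+1) x ^ 2) * h3
    rw [hQ]
    linear_combination (-2) * h4 + (8 * psi (n-1) x ^2) * h2

lemma hasDerivAt_dK_left (r s n : ℕ) (x y : ℝ) :
    HasDerivAt (fun x => dK r s n x y) (dK (r+1) s n x y) x := by
  have := HasDerivAt.fun_sum (u := Finset.range n) (A := fun j x => dpsi r j x * dpsi s j y)
    (A' := fun j => dpsi (r+1) j x * dpsi s j y) (x := x)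
    (fun j _ => (hasDerivAt_dpsi r j x).mul_const _)
  exact this

lemma hasDerivAt_dK_right (r s n : ℕ) (x y : ℝ) :
    HasDerivAt (fun y => dK r s n x y) (dK r (s+1) n x y) y := by
  simp only [dK_comm r]
  exact hasDerivAt_dK_left s r n y x

lemma hasDerivAt_Q (n : ℕ) (x : ℝ) :
    HasDerivAt (fun x => dK 0 0 n x x) (-2 * sn n * psi (n-1) x * psi n x) x := by
  have := HasDerivAt.fun_sum (u := Finset.range n) (A := fun j x => dpsi 0 j x * dpsi 0 j x)
    (A' := fun j => dpsi 1 j x * dpsi 0 j x + dpsi 0 j x * dpsi 1 j x) (x := x)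
    (fun j _ => (hasDerivAt_dpsi 0 j x).mul (hasDerivAt_dpsi 0 j x))
  refine HasDerivAt.congr_deriv this ?_
  rw [Finset.sum_add_distrib]
  change dK 1 0 n x x + dK 0 1 n x x = _
  rw [dK_comm 0 1, Q_deriv]; ring

lemma dK_self_nonneg (r n : ℕ) (x : ℝ) : 0 ≤ dK r r n x x :=
  Finset.sum_nonneg fun j _ => mul_self_nonneg _

lemma integrable_Q (n : ℕ) : Integrable (fun x => dK 0 0 n x x) :=
  integrable_finsetSum _ fun j _ => integrable_dpsi_mul 0 0 j j

lemma Q_le (n : ℕ) (x : ℝ) : dK 0 0 n x x ≤ 2 * sn n := by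
  have hintg : Integrable (fun x => -2 * sn n * psi (n-1) x * psi n x) := by
    refine ((integrable_psi_mul (n-1) n).const_mul (-2 * sn n)).congr ?_
    exact Filter.Eventually.of_forall fun x => by ring
  have ht := tendsto_zero_of_hasDerivAt_of_integrableOn_Ioi (a := x)
    (fun y _ => hasDerivAt_Q n y) hintg.integrableOn (integrable_Q n).integrableOn
  have h := integral_Ioi_of_hasDerivAt_of_tendsto' (a := x)
    (fun y _ => hasDerivAt_Q n y) hintg.integrableOn ht
  have hb : |∫ y in Set.Ioi x, -2 * sn n * psi (n-1) y * psi n y| ≤ 2 * sn n := by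
    calc _ ≤ ∫ y in Set.Ioi x, |(-2 * sn n * psi (n-1) y * psi n y)| := abs_integral_le_integral_abs
      _ ≤ ∫ y, |(-2 * sn n * psi (n-1) y * psi n y)| :=
        setIntegral_le_integral hintg.abs (Filter.Eventually.of_forall fun y => abs_nonneg _)
      _ ≤ ∫ y, sn n * (psi (n-1) y * psi (n-1) y + psi n y * psi n y) := by
        refine integral_mono hintg.abs (((integrable_psi_mul _ _).add (integrable_psi_mul _ _)).const_mul _) ?_
        intro y
        have h1 : |(-2 * sn n * psi (n-1) y * psi n y)| = sn n * (2 * (|psi (n-1) y| * |psi n y|)) := by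
          rw [abs_mul, abs_mul, abs_mul, abs_of_nonneg (sn_nonneg n)]; norm_num; ring
        simp only [h1]
        refine mul_le_mul_of_nonneg_left ?_ (sn_nonneg n)
        rw [← abs_mul_abs_self (psi (n-1) y), ← abs_mul_abs_self (psi n y)]
        nlinarith [sq_nonneg (|psi (n-1) y| - |psi n y|)]
      _ = 2 * sn n := by
        rw [integral_const_mul, integral_add (integrable_psi_mul _ _) (integrable_psi_mul _ _),
          inner_psi, inner_psi]; simp; ring
  rw [h] at hb
  have := (abs_le.1 hb).1
  linarith

lemma two_sn (n : ℕ) : 2 * sn n = √2 * √n := by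
  rw [sn, Real.sqrt_div (by positivity)]
  have h22 : √2 ^ 2 = (2:ℝ) := Real.sq_sqrt (by norm_num)
  have : √(2:ℝ) ≠ 0 := by positivity
  field_simp; rw [h22]; ring

lemma Q_le' (n : ℕ) (x : ℝ) : dK 0 0 n x x ≤ 2 * √n := by
  have h := Q_le n x
  rw [two_sn] at h
  have : √2 ≤ (2:ℝ) := by rw [Real.sqrt_le_left (by norm_num)]; norm_num
  nlinarith [Real.sqrt_nonneg (n:ℝ)]

lemma dK_step (r n : ℕ) (x : ℝ) : dK (r+1) (r+1) n x x ≤ 2 * n * dK r r (n+1) x x := by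
  have h1 : ∀ j ∈ Finset.range n, dpsi (r+1) j x * dpsi (r+1) j x ≤
      (n:ℝ) * (if j = 0 then 0 else dpsi r (j-1) x ^2) + n * dpsi r (j+1) x ^ 2 := by
    intro j hj
    have hj' : (j:ℝ) + 1 ≤ n := by exact_mod_cast Finset.mem_range.1 hj
    have e1 : √((j:ℝ)/2) ^ 2 = j / 2 := Real.sq_sqrt (by positivity)
    have e2 : √(((j:ℝ)+1)/2) ^ 2 = (j+1) / 2 := Real.sq_sqrt (by positivity)
    simp only [dpsi]
    set u := dpsi r (j-1) x
    set v := dpsi r (j+1) x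
    have : (√((j:ℝ)/2) * u - √(((j:ℝ)+1)/2) * v) * (√((j:ℝ)/2) * u - √(((j:ℝ)+1)/2) * v) ≤ j * u^2 + (j+1) * v^2 := by
      have := sq_nonneg (√((j:ℝ)/2) * u + √(((j:ℝ)+1)/2) * v)
      nlinarith
    refine this.trans (add_le_add ?_ ?_)
    · by_cases h0 : j = 0
      · simp [h0]
      · simp only [h0, if_false]; exact mul_le_mul_of_nonneg_right (by linarith) (sq_nonneg _)
    · exact mul_le_mul_of_nonneg_right hj' (sq_nonneg _)
  refine (Finset.sum_le_sum h1).trans ?_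
  rw [Finset.sum_add_distrib, ← Finset.mul_sum, ← Finset.mul_sum]
  have h2 : ∑ j ∈ Finset.range n, (if j = 0 then 0 else dpsi r (j-1) x ^2) ≤ dK r r (n+1) x x := by
    cases n with
    | zero => simpa using dK_self_nonneg r 1 x
    | succ n =>
      rw [Finset.sum_range_succ']
      simp only [dK, ← sq, if_true, add_zero, Nat.add_sub_cancel, Nat.succ_ne_zero, if_false]
      exact Finset.sum_le_sum_of_subset_of_nonneg (Finset.range_mono (by omega)) (fun _ _ _ => sq_nonneg _)
  have h3 : ∑ j ∈ Finset.range n, dpsi r (j+1) x ^ 2 ≤ dK r r (n+1) x x := by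
    simp only [dK, ← sq]
    rw [Finset.sum_range_succ']
    nlinarith [sq_nonneg (dpsi r 0 x)]
  have hn : (0:ℝ) ≤ n := by positivity
  nlinarith

lemma dK_self_le (r : ℕ) : ∃ C : ℝ, 0 < C ∧ ∀ n : ℕ, 1 ≤ n → ∀ x, dK r r n x x ≤ C * n ^ r * √n := by
  induction r with
  | zero => exact ⟨2, by norm_num, fun n _ x => by simpa using Q_le' n x⟩
  | succ r ih =>
    obtain ⟨C, hC, h⟩ := ih
    refine ⟨2 * (C * 2 ^ r * √2), by positivity, fun n hn x => (dK_step r n x).trans ?_⟩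
    have hn' : (1:ℝ) ≤ n := by exact_mod_cast hn
    have h1 := h (n+1) (by omega) x
    push_cast at h1
    have h2 : C * ((n:ℝ)+1)^r * √((n:ℝ)+1) ≤ C * (2 * n)^r * √(2 * n) := by
      gcongr <;> linarith
    rw [Real.sqrt_mul (by norm_num), mul_pow] at h2
    calc 2 * (n:ℝ) * dK r r (n+1) x x ≤ 2 * n * (C * (2 ^ r * n^r) * (√2 * √n)) := by
          gcongr; linarith
      _ = _ := by ring

lemma dK_sq_le (r s n : ℕ) (x y : ℝ) : dK r s n x y ^ 2 ≤ dK r r n x x * dK s s n y y := by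
  simp only [dK, ← sq]
  exact Finset.sum_mul_sq_le_sq_mul_sq _ _ _

/-- bulk bound -/
lemma ab_le {δ : ℝ} (hδ : 0 < δ) (hδ2 : δ ≤ 2) {n : ℕ} (hn : 1 ≤ n) {x : ℝ} (hx : x^2 ≤ (2 - δ) * n) :
    psi (n-1) x ^2 + psi n x ^2 ≤ 8 / (δ * √n) := by
  have hn' : (1:ℝ) ≤ n := by exact_mod_cast hn
  set a := psi (n-1) x
  set b := psi n x
  have hQ := Q_eq n x
  have hQ2 := Q_le' n x
  have hs := sn_sq n
  have hs0 := sn_nonneg n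
  have key : (δ * n / 4) * (a^2+b^2) ≤ dK 0 0 n x x := by
    rw [hQ]
    have hd : (2 * sn n * x)^2 ≤ (2 * (n * (1 - δ/4)))^2 := by
      have : (2 * sn n * x)^2 = 2 * n * x^2 := by rw [mul_pow, mul_pow, hs]; ring
      rw [this]
      have : 2 * (n:ℝ) * x^2 ≤ 2 * n * ((2 - δ) * n) := by gcongr
      nlinarith [mul_nonneg (sq_nonneg (n:ℝ)) (sq_nonneg δ)]
    have hp : (0:ℝ) ≤ 2 * (n * (1 - δ/4)) := by
      have : 0 ≤ 1 - δ/4 := by linarith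
      positivity
    have h1 := abs_le_of_sq_le_sq' hd hp
    have h2 : 2 * sn n * x * (a * b) ≤ (n * (1 - δ/4)) * (a^2+b^2) := by
      rcases le_total 0 (a*b) with h | h
      · nlinarith [sq_nonneg (a-b), mul_le_mul_of_nonneg_right h1.2 h, mul_nonneg hp (sq_nonneg (a-b))]
      · nlinarith [sq_nonneg (a+b), mul_le_mul_of_nonpos_right h1.1 h, mul_nonneg hp (sq_nonneg (a+b))]
    have : 2 * sn n * x * a * b = 2 * sn n * x * (a * b) := by ring
    rw [this]
    linarith
  have h3 : √(n:ℝ) * √n = n := Real.mul_self_sqrt (by positivity)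
  have hsp : 0 < √(n:ℝ) := by positivity
  rw [le_div_iff₀ (by positivity)]
  have h4 : √(n:ℝ) * ((a^2+b^2) * (δ * √n)) ≤ √n * 8 := by
    have : √(n:ℝ) * ((a^2+b^2) * (δ * √n)) = 4 * ((δ * n / 4) * (a^2+b^2)) := by
      linear_combination (a^2+b^2) * δ * h3
    rw [this]; linarith
  exact le_of_mul_le_mul_left h4 hsp

end GM

namespace GM

lemma psi_zero_step (n : ℕ) : ((n:ℝ)+1) * psi (n+1) 0 ^ 2 = n * psi (n-1) 0 ^ 2 := by
  have h := psi_rec' n 0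
  have h2 := sn_sq n
  have h3 := sn_sq (n+1)
  push_cast at *
  have : (sn (n+1) * psi (n+1) 0)^2 = (sn n * psi (n-1) 0)^2 := by rw [h]; ring
  rw [mul_pow, mul_pow, h2, h3] at this
  linarith

lemma psi_odd_zero (m : ℕ) : psi (2*m+1) 0 = 0 := by
  induction m with
  | zero =>
    have := psi_zero_step 0
    simpa using this
  | succ m ih =>
    have := psi_zero_step (2*m+2)
    rw [show 2*m+2-1 = 2*m+1 by omega, ih] at this
    have h : ((2*m+2 : ℕ):ℝ) + 1 ≠ 0 := by positivity
    simp only [ne_eq, OfNat.ofNat_ne_zero, not_false_eq_true, zero_pow, mul_zero, mul_eq_zero, h,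
      false_or, pow_eq_zero_iff] at this
    exact this

lemma psi_even_zero (m : ℕ) : (psi (2*m) 0 ^ 2)^2 * (π * (2*m+1) * Real.Wallis.W m) = 1 := by
  induction m with
  | zero =>
    have h : √π ^ 2 = π := Real.sq_sqrt Real.pi_pos.le
    simp [psi_zero_eq, Real.Wallis.W, h, Real.pi_ne_zero]
  | succ m ih =>
    have h := psi_zero_step (2*m+1)
    rw [Nat.add_sub_cancel] at h
    rw [Real.Wallis.W_succ, show 2*(m+1) = 2*m+1+1 by ring]
    push_cast at *
    set u := psi (2*m+1+1) 0 ^2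
    set v := psi (2*m) 0 ^ 2
    have hu : u = (2*m+1)/(2*m+2) * v := by field_simp; linarith
    refine Eq.trans ?_ ih
    rw [hu]
    field_simp
    ring

lemma Q_zero_bound (n : ℕ) (hn : 1 ≤ n) :
    |dK 0 0 n 0 0 ^2 / (2 * (n:ℝ)) - 1 / π^2| ≤ 1 / (n:ℝ) := by
  have hn' : (1:ℝ) ≤ n := by exact_mod_cast hn
  have hπ := Real.pi_pos
  obtain ⟨m, hm⟩ : ∃ m, n = 2*m ∨ n = 2*m+1 := ⟨n/2, by omega⟩
  have hQ : dK 0 0 n 0 0 = n * psi (2*m) 0 ^2 := by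
    rw [Q_eq]
    rcases hm with h | h
    · obtain ⟨l, rfl⟩ : ∃ l, m = l+1 := ⟨m-1, by omega⟩
      rw [h, show 2*(l+1)-1 = 2*l+1 by omega, psi_odd_zero]; ring
    · rw [h, Nat.add_sub_cancel, psi_odd_zero]; ring
  have hW := psi_even_zero m
  have hW1 := Real.Wallis.W_le m
  have hW2 := Real.Wallis.le_W m
  have hWp := Real.Wallis.W_pos m
  set w := Real.Wallis.W m
  have hm1 : (n:ℝ) ≤ 2*m+1 := by
    have : n ≤ 2*m+1 := by omega
    exact_mod_cast this
  have hm2 : (2*m:ℝ) ≤ n := by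
    have : 2*m ≤ n := by omega
    exact_mod_cast this
  have e : dK 0 0 n 0 0 ^2 / (2 * n) = n / (2 * π * (2*m+1) * w) := by
    rw [hQ, div_eq_div_iff (by positivity) (by positivity), mul_pow]
    linear_combination (2 * (n:ℝ)^2) * hW
  have hup : (n:ℝ) / (2 * π * (2*m+1) * w) ≤ 1/π^2 + 1 / n * (1/π^2) := by
    rw [div_le_iff₀ (by positivity)]
    have : 2 * π * (2*m+1) * ((2 * m + 1) / (2 * m + 2) * (π / 2)) ≤ 2 * π * (2*m+1) * w := by gcongr
    calc (n:ℝ) ≤ (1/π^2 + 1 / n * (1/π^2)) * (2 * π * (2*m+1) * ((2 * m + 1) / (2 * m + 2) * (π / 2))) := by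
          field_simp
          have hM : (n:ℝ)*n ≤ n*(2*m+1) := by gcongr
          have hM2 : (n:ℝ)*(2*m+1) ≤ (2*m+1)*(2*m+1) := by gcongr
          have hM3 : (n:ℝ)*n*(2*m+1) ≤ n*(2*m+1)*(2*m+1) := by gcongr
          nlinarith
      _ ≤ _ := by gcongr
  have hlo : 1/π^2 - 1 / n * (1/π^2) ≤ (n:ℝ) / (2 * π * (2*m+1) * w) := by
    rw [le_div_iff₀ (by positivity)]
    have h1 : 0 ≤ 1/π^2 - 1 / n * (1/π^2) := by
      have : 1 / (n:ℝ) ≤ 1 := by rw [div_le_one (by positivity)]; exact hn'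
      have : 1 / (n:ℝ) * (1/π^2) ≤ 1 * (1/π^2) := by gcongr
      linarith
    calc _ ≤ (1/π^2 - 1 / n * (1/π^2)) * (2 * π * (2*m+1) * (π/2)) := by gcongr
      _ ≤ _ := by
        field_simp
        nlinarith
  have h9 : 1 / (n:ℝ) * (1/π^2) ≤ 1 / n := by
    have : 1/π^2 ≤ 1 := by rw [div_le_one (by positivity)]; nlinarith [Real.pi_gt_three]
    have h : (0:ℝ) ≤ 1/n := by positivity
    nlinarith
  rw [e, abs_le]
  constructor <;> linarith

lemma hasDerivAt_E (N : ℕ) (x : ℝ) (hx : 0 < 2 * ((N:ℝ)+1) - x^2) :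
    HasDerivAt (fun x => dK 0 0 (N+1) x x / √(2 * ((N:ℝ)+1) - x^2)
      - ((N:ℝ)+1) * (psi N x ^2 - psi (N+1) x ^2) / (2 * √(2 * ((N:ℝ)+1) - x^2) ^ 3))
      (-(3/2) * ((N:ℝ)+1) * (psi N x ^2 - psi (N+1) x ^2) * x / √(2 * ((N:ℝ)+1) - x^2) ^ 5) x := by
  have hw : HasDerivAt (fun x : ℝ => √(2 * ((N:ℝ)+1) - x^2)) (-x / √(2 * ((N:ℝ)+1) - x^2)) x := by
    have h1 : HasDerivAt (fun x : ℝ => 2 * ((N:ℝ)+1) - x^2) (-(2*x)) x := by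
      have := (hasDerivAt_pow 2 x).const_sub (2 * ((N:ℝ)+1))
      exact this.congr_deriv (by simp)
    refine (h1.sqrt hx.ne').congr_deriv ?_
    ring
  have hwp : √(2 * ((N:ℝ)+1) - x^2) ≠ 0 := (Real.sqrt_pos.2 hx).ne'
  have hQ := hasDerivAt_Q (N+1) x
  have ha : HasDerivAt (psi N) (dpsi 1 N x) x := hasDerivAt_dpsi 0 N x
  have hb : HasDerivAt (psi (N+1)) (dpsi 1 (N+1) x) x := hasDerivAt_dpsi 0 (N+1) x
  have h1 := (hQ.div hw hwp).sub (((((ha.pow 2).sub (hb.pow 2)).const_mul ((N:ℝ)+1))).div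
    ((hw.pow 3).const_mul 2) (by simpa using hwp))
  refine HasDerivAt.congr_deriv h1 ?_
  have hw2 : √(2 * ((N:ℝ)+1) - x^2)^2 = 2 * ((N:ℝ)+1) - x^2 := Real.sq_sqrt hx.le
  have hs := sn_sq (N+1)
  have hQe := Q_eq (N+1) x
  simp only [Pi.sub_apply, Pi.pow_apply, Nat.add_sub_cancel] at *
  rw [dpsi_one_a, dpsi_one_b, Nat.add_sub_cancel, hQe]
  push_cast at *
  set w := √(2 * ((N:ℝ)+1) - x^2)
  set a := psi N x
  set b := psi (N+1) x
  set s := sn (N+1)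
  have hx2 : x^2 = 2 * ((N:ℝ)+1) - w^2 := by rw [hw2]; ring
  have hN : (N:ℝ) + 1 = 2 * s^2 := by rw [hs]; ring
  rw [hN] at hx2
  rw [hN]
  clear_value w a b s
  field_simp
  ring_nf
  linear_combination (-2*s*w^2*a*b)*hx2

end GM

namespace GM

lemma ratio_bound {δ : ℝ} (hδ : 0 < δ) (hδ2 : δ ≤ 2) : ∃ C : ℝ, 0 < C ∧ ∀ n : ℕ, 1 ≤ n → ∀ x : ℝ,
    x^2 ≤ (2 - δ) * n → |dK 0 0 n x x / √(2 * (n:ℝ) - x^2) - dK 0 0 n 0 0 / √(2 * (n:ℝ))| ≤ C / n := by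
  set d := √δ with hd
  have hdp : 0 < d := Real.sqrt_pos.2 hδ
  have hd2 : d^2 = δ := Real.sq_sqrt hδ.le
  refine ⟨48 / d^7 + 8 / d^5, by positivity, ?_⟩
  intro n hn x hx
  obtain ⟨N, rfl⟩ : ∃ N, n = N + 1 := ⟨n-1, by omega⟩
  set r := √((N+1 : ℕ):ℝ) with hr
  have hrp : 0 < r := by rw [hr]; positivity
  have hr2 : r^2 = (N:ℝ)+1 := by rw [hr, Real.sq_sqrt (by positivity)]; push_cast; ring
  have hcast : (((N+1:ℕ):ℝ)) = (N:ℝ)+1 := by push_cast; ring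
  have hab : ∀ y : ℝ, y^2 ≤ x^2 → psi N y ^2 + psi (N+1) y ^2 ≤ 8 / (d^2 * r) := by
    intro y hy
    have := ab_le hδ hδ2 hn (hy.trans hx)
    rwa [Nat.add_sub_cancel, ← hr, ← hd2] at this
  have hw : ∀ y : ℝ, y^2 ≤ x^2 → d * r ≤ √(2 * ((N:ℝ)+1) - y^2) := by
    intro y hy
    apply Real.le_sqrt_of_sq_le
    rw [mul_pow, hd2, hr2]
    rw [hcast] at hx
    nlinarith
  have hpos : ∀ y : ℝ, y^2 ≤ x^2 → 0 < 2 * ((N:ℝ)+1) - y^2 := by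
    intro y hy
    have := hw y hy
    exact Real.sqrt_pos.1 (lt_of_lt_of_le (by positivity) this)
  have hdiff : ∀ y : ℝ, y^2 ≤ x^2 → |psi N y ^2 - psi (N+1) y ^2| ≤ 8 / (d^2 * r) := by
    intro y hy
    have := hab y hy
    rw [abs_le]
    constructor <;> nlinarith [sq_nonneg (psi N y), sq_nonneg (psi (N+1) y)]
  have hxr : |x| ≤ 2 * r := by
    apply abs_le_of_sq_le_sq _ (by positivity)
    rw [mul_pow, hr2]
    rw [hcast] at hx
    nlinarith
  have hyx : ∀ y : ℝ, y^2 ≤ x^2 → |y| ≤ 2 * r := fun y hy => (sq_le_sq.1 hy).trans hxr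
  set F := (fun x => dK 0 0 (N+1) x x / √(2 * ((N:ℝ)+1) - x^2)
      - ((N:ℝ)+1) * (psi N x ^2 - psi (N+1) x ^2) / (2 * √(2 * ((N:ℝ)+1) - x^2) ^ 3)) with hF
  have hmv : |F x - F 0| ≤ (24 / (d^7 * r^3)) * |x - 0| := by
    have hconv : Convex ℝ {y : ℝ | y^2 ≤ x^2} := by
      have : {y : ℝ | y^2 ≤ x^2} = Set.Icc (-|x|) |x| := by
        ext y; simp [sq_le_sq, abs_le]
      rw [this]; exact convex_Icc _ _
    refine hconv.norm_image_sub_le_of_norm_hasDerivWithin_le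
      (fun y hy => (hasDerivAt_E N y (hpos y hy)).hasDerivWithinAt) ?_ (show (0:ℝ)^2 ≤ x^2 by simp [sq_nonneg]) (show x^2 ≤ x^2 from le_rfl)
    intro y hy
    have h1 := hdiff y hy
    have h2 := hw y hy
    have h3 := hyx y hy
    rw [Real.norm_eq_abs, abs_div, abs_mul, abs_mul, abs_mul, ← hr2, abs_of_nonneg (by positivity : 0 ≤ r^2),
      abs_of_nonneg (by positivity : 0 ≤ √(2 * r^2 - y^2)^5)]
    rw [← hr2] at h2
    rw [show |(-(3/2):ℝ)| = 3/2 by norm_num]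
    calc _ ≤ 3/2 * r^2 * (8 / (d^2*r)) * (2 * r) / (d*r)^5 := by gcongr
      _ = _ := by field_simp; ring
  have hsec : ∀ y : ℝ, y^2 ≤ x^2 → |((N:ℝ)+1) * (psi N y ^2 - psi (N+1) y ^2) / (2 * √(2 * ((N:ℝ)+1) - y^2) ^ 3)| ≤ 4 / (d^5 * r^2) := by
    intro y hy
    have h1 := hdiff y hy
    have h2 := hw y hy
    rw [← hr2] at h2
    rw [abs_div, abs_mul, ← hr2, abs_of_nonneg (by positivity : 0 ≤ r^2), abs_of_nonneg (by positivity : 0 ≤ 2 * √(2 * r^2 - y^2)^3)]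
    calc _ ≤ r^2 * (8 / (d^2*r)) / (2 * (d*r)^3) := by gcongr
      _ = _ := by field_simp; ring
  have e1 := hsec x le_rfl
  have e2 := hsec 0 (by simp [sq_nonneg])
  have e3 : |F x - F 0| ≤ 48 / (d^7 * r^2) := by
    refine hmv.trans ?_
    rw [sub_zero]
    calc _ ≤ (24 / (d^7 * r^3)) * (2 * r) := by gcongr
      _ = _ := by field_simp; ring
  rw [hcast, ← hr2]
  have e4 : (48 / d^7 + 8 / d^5) / r^2 = 48 / (d^7 * r^2) + 2 * (4 / (d^5 * r^2)) := by field_simp; ring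
  rw [e4]
  simp only [hF] at e3
  rw [← hr2] at e1 e2 e3
  rw [abs_le] at *
  simp only [ne_eq, OfNat.ofNat_ne_zero, not_false_eq_true, zero_pow, sub_zero] at *
  constructor <;> linarith

lemma semicircle {δ : ℝ} (hδ : 0 < δ) (hδ2 : δ ≤ 2) : ∃ C : ℝ, 0 < C ∧ ∀ n : ℕ, 1 ≤ n → ∀ x : ℝ,
    x^2 ≤ (2 - δ) * n → |π^2 * dK 0 0 n x x ^2 - (2 * n - x^2)| ≤ C := by
  obtain ⟨C, hC, h⟩ := ratio_bound hδ hδ2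
  refine ⟨2 * π^2 * (1 + C * (2 * (1 + 1/π^2) + C)), by positivity, fun n hn x hx => ?_⟩
  have h1 := h n hn x hx
  have h0 := Q_zero_bound n hn
  have hn' : (1:ℝ) ≤ n := by exact_mod_cast hn
  have hpos : 0 < 2 * (n:ℝ) - x^2 := by nlinarith
  have hs : √(2 * (n:ℝ) - x^2)^2 = 2 * (n:ℝ) - x^2 := Real.sq_sqrt hpos.le
  have hs2 : √(2 * (n:ℝ))^2 = 2 * (n:ℝ) := Real.sq_sqrt (by positivity)
  have hsp : 0 < √(2 * (n:ℝ) - x^2) := Real.sqrt_pos.2 hpos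
  set Q := dK 0 0 n x x
  set p := Q / √(2 * (n:ℝ) - x^2) with hp
  set q := dK 0 0 n 0 0 / √(2 * (n:ℝ)) with hq
  have hq2 : dK 0 0 n 0 0 ^2 / (2 * (n:ℝ)) = q^2 := by rw [hq, div_pow, hs2]
  rw [hq2] at h0
  have hn1 : 1 / (n:ℝ) ≤ 1 := by rw [div_le_one (by positivity)]; exact hn'
  have hqb : |q| ≤ 1 + 1/π^2 := by
    have h3 : q^2 ≤ 1 + 1/π^2 := by have := (abs_le.1 h0).2; linarith
    apply abs_le_of_sq_le_sq _ (by positivity)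
    have : 0 < 1/π^2 := by positivity
    nlinarith
  have hpq : |p^2 - q^2| ≤ C / n * (2 * (1 + 1/π^2) + C) := by
    have e : p^2 - q^2 = (p - q) * (2 * q + (p - q)) := by ring
    have hCn : C / n ≤ C := div_le_self hC.le hn'
    rw [e, abs_mul]
    gcongr
    calc |2 * q + (p-q)| ≤ |2 * q| + |p - q| := abs_add_le _ _
      _ ≤ 2 * (1 + 1/π^2) + C := by rw [abs_mul, abs_two]; gcongr; linarith
  have hfin : |p^2 - 1/π^2| ≤ (1 + C * (2 * (1 + 1/π^2) + C)) / n := by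
    calc |p^2 - 1/π^2| ≤ |p^2 - q^2| + |q^2 - 1/π^2| := abs_sub_le _ _ _
      _ ≤ C / n * (2 * (1 + 1/π^2) + C) + 1 / n := by gcongr
      _ = _ := by ring
  have e : π^2 * Q^2 - (2 * n - x^2) = π^2 * (2 * n - x^2) * (p^2 - 1/π^2) := by
    rw [hp, div_pow, hs]; field_simp
  rw [e, abs_mul, abs_of_nonneg (by positivity)]
  calc _ ≤ π^2 * (2 * n) * ((1 + C * (2 * (1 + 1/π^2) + C)) / n) := by
        gcongr; linarith [sq_nonneg x]
    _ = _ := by field_simp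

lemma W_bound {δ : ℝ} (hδ : 0 < δ) (hδ2 : δ ≤ 2) : ∃ C : ℝ, 0 < C ∧ ∀ n : ℕ, 1 ≤ n → ∀ x : ℝ,
    x^2 ≤ (2 - δ) * n → |dK 0 0 n x x * dK 1 1 n x x - dK 1 0 n x x ^2 - π^2/3 * dK 0 0 n x x ^4| ≤ C * n := by
  obtain ⟨C, hC, h⟩ := semicircle hδ hδ2
  refine ⟨4/3 * C + 2/3 * 2 * (8/δ) + (8/δ)^2, by positivity, fun n hn x hx => ?_⟩
  have hn' : (1:ℝ) ≤ n := by exact_mod_cast hn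
  have hS := S_eq n x
  have hQ' := Q_deriv n x
  have hab := ab_le hδ hδ2 hn hx
  have hQ := Q_le' n x
  have hQ0 := dK_self_nonneg 0 n x
  have h1 := h n hn x hx
  have hs := sn_sq n
  set Q := dK 0 0 n x x
  set a := psi (n-1) x
  set b := psi n x
  set r := √(n:ℝ) with hr
  have hrp : 0 < r := by rw [hr]; positivity
  have hr2 : r^2 = n := Real.sq_sqrt (by positivity)
  have hdK : dK 1 1 n x x = ((2 * n - x^2) * Q - 2 * n * (a^2 - b^2)) / 3 := by rw [← hS]; ring
  have e : Q * dK 1 1 n x x - dK 1 0 n x x^2 - π^2/3*Q^4 =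
      -(Q^2/3 * (π^2*Q^2 - (2*n-x^2))) - 2/3 * n * Q * (a^2-b^2) - n/2 * (a^2*b^2) := by
    rw [hdK, hQ']
    linear_combination (-(a^2*b^2)) * hs
  have hd : |a^2-b^2| ≤ 8/(δ*r) := by
    rw [abs_le]; constructor <;> nlinarith [sq_nonneg a, sq_nonneg b]
  have hab2 : a^2*b^2 ≤ (8/(δ*r))^2 := by nlinarith [sq_nonneg a, sq_nonneg b]
  have hQ2 : Q^2 ≤ 4 * n := by rw [← hr2]; nlinarith
  rw [e]
  calc _ ≤ |Q^2/3 * (π^2*Q^2 - (2*n-x^2))| + |2/3 * n * Q * (a^2-b^2)| + |n/2 * (a^2*b^2)| := by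
        refine (abs_sub _ _).trans ?_
        gcongr
        refine (abs_sub _ _).trans ?_
        rw [abs_neg]
    _ ≤ 4*n/3 * C + 2/3*n*(2*r)*(8/(δ*r)) + n * (8/(δ*r))^2 := by
        rw [abs_mul, abs_mul, abs_of_nonneg (by positivity : 0 ≤ Q^2/3), abs_of_nonneg (by positivity : 0 ≤ 2/3*n*Q),
          abs_of_nonneg (by positivity : 0 ≤ (n:ℝ)/2*(a^2*b^2))]
        gcongr
        linarith
    _ = 4/3 * C * n + 2/3 * 2 * (8/δ) * n + (8/δ)^2 * (n/r^2) := by field_simp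
    _ ≤ _ := by
        have : (n:ℝ)/r^2 ≤ n := by rw [hr2, div_self (by positivity)]; exact hn'
        have : (8/δ)^2 * (n/r^2) ≤ (8/δ)^2 * n := by gcongr
        linarith

lemma Q_lower {δ : ℝ} (hδ : 0 < δ) (hδ2 : δ ≤ 2) : ∃ c : ℝ, 0 < c ∧ ∀ n : ℕ, 1 ≤ n → ∀ x : ℝ,
    x^2 ≤ (2 - δ) * n → c * √n ≤ dK 0 0 n x x := by
  obtain ⟨C, hC, h⟩ := semicircle hδ hδ2
  set n0 := 2 * C / δ with hn0
  have hn0p : 0 < n0 := by positivity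
  set c1 := √(δ/2) / π with hc1
  set c2 := Real.exp (-(2*n0)) / (√π * (n0+1)) with hc2
  refine ⟨min c1 c2, lt_min (by positivity) (by positivity), fun n hn x hx => ?_⟩
  have hn' : (1:ℝ) ≤ n := by exact_mod_cast hn
  have hQ0 := dK_self_nonneg 0 n x
  by_cases hnn : n0 ≤ n
  · refine le_trans (mul_le_mul_of_nonneg_right (min_le_left _ _) (by positivity)) ?_
    have h1 := (abs_le.1 (h n hn x hx)).1
    apply le_of_sq_le_sq _ hQ0
    rw [hc1, mul_pow, div_pow, Real.sq_sqrt (by positivity), Real.sq_sqrt (by positivity), div_mul_eq_mul_div,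
      div_le_iff₀ (by positivity)]
    have : C ≤ δ/2*n := by
      rw [hn0, div_le_iff₀ hδ] at hnn; linarith
    nlinarith
  · push Not at hnn
    refine le_trans (mul_le_mul_of_nonneg_right (min_le_right _ _) (by positivity)) ?_
    have h2 : psi 0 x ^2 ≤ dK 0 0 n x x := by
      have := Finset.single_le_sum (f := fun j => dpsi 0 j x * dpsi 0 j x) (s := Finset.range n)
        (fun j _ => mul_self_nonneg _) (a := 0) (by simp; omega)
      rw [sq]; exact this
    refine le_trans ?_ h2
    have h3 : psi 0 x ^2 = Real.exp (-x^2) / √π := by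
      rw [psi_zero_eq, div_pow, Real.sq_sqrt (by positivity), ← Real.exp_nat_mul]; congr 2; push_cast; ring
    rw [h3, hc2]
    have h4 : √(n:ℝ) ≤ n0 + 1 := by
      rw [Real.sqrt_le_left (by positivity)]; nlinarith
    calc _ ≤ Real.exp (-(2*n0)) / (√π * (n0+1)) * (n0+1) := by gcongr
      _ = Real.exp (-(2*n0)) / √π := by field_simp
      _ ≤ _ := by gcongr; nlinarith

end GM

namespace GM

/-- the vector of (derivatives of) Hermite functions -/
noncomputable def phi (r n : ℕ) (x : ℝ) : EuclideanSpace ℝ (Fin n) := WithLp.toLp 2 (fun j => dpsi r j x)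

lemma inner_phi (r s n : ℕ) (x y : ℝ) : inner ℝ (phi r n x) (phi s n y) = dK r s n x y := by
  rw [PiLp.inner_apply, dK, Finset.sum_range]
  refine Finset.sum_congr rfl fun j _ => ?_
  simp [phi, mul_comm]

lemma norm_phi_sq (r n : ℕ) (x : ℝ) : ‖phi r n x‖^2 = dK r r n x x := by
  rw [← inner_phi, real_inner_self_eq_norm_sq]

lemma hasDerivAt_phi (r n : ℕ) (x : ℝ) : HasDerivAt (phi r n) (phi (r+1) n x) x := by
  have h : HasDerivAt (fun x => (fun j : Fin n => dpsi r j x)) (fun j : Fin n => dpsi (r+1) j x) x :=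
    hasDerivAt_pi.2 fun j => hasDerivAt_dpsi r j x
  exact (PiLp.continuousLinearEquiv 2 ℝ (fun _ : Fin n => ℝ)).symm.toContinuousLinearMap.hasFDerivAt.comp_hasDerivAt x h

lemma sqrt_nat_pow (n : ℕ) : √(n:ℝ)^2 = n := Real.sq_sqrt (by positivity)

lemma sqsq_pow (n : ℕ) : √(√(n:ℝ))^2 = √n := Real.sq_sqrt (by positivity)

lemma norm_phi_le (r : ℕ) : ∃ C : ℝ, 0 < C ∧ ∀ n : ℕ, 1 ≤ n → ∀ x, ‖phi r n x‖ ≤ C * √n ^ r * √√n := by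
  obtain ⟨C, hC, h⟩ := dK_self_le r
  refine ⟨√C, Real.sqrt_pos.2 hC, fun n hn x => ?_⟩
  apply le_of_sq_le_sq _ (by positivity)
  rw [norm_phi_sq]
  refine (h n hn x).trans (le_of_eq ?_)
  rw [mul_pow, mul_pow, Real.sq_sqrt hC.le, sqsq_pow, ← pow_mul, mul_comm r 2, pow_mul, sqrt_nat_pow]

lemma dK_abs_le (r s : ℕ) : ∃ C : ℝ, 0 < C ∧ ∀ n : ℕ, 1 ≤ n → ∀ x y, |dK r s n x y| ≤ C * √n ^ (r + s) * √n := by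
  obtain ⟨C, hC, h⟩ := norm_phi_le r
  obtain ⟨D, hD, h'⟩ := norm_phi_le s
  refine ⟨C * D, by positivity, fun n hn x y => ?_⟩
  rw [← inner_phi]
  refine (abs_real_inner_le_norm _ _).trans ?_
  calc _ ≤ (C * √n ^ r * √√n) * (D * √n ^ s * √√n) := by gcongr; exacts [h n hn x, h' n hn y]
    _ = C * D * √n ^ (r+s) * (√√n)^2 := by ring
    _ = _ := by rw [sqsq_pow]

/-- MVT for vector functions -/
lemma mvt {E : Type*} [NormedAddCommGroup E] [NormedSpace ℝ E] {f f' : ℝ → E} {C : ℝ}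
    (hf : ∀ x, HasDerivAt f (f' x) x) {a b : ℝ} (hb : ∀ x, x ∈ Set.uIcc a b → ‖f' x‖ ≤ C) : ‖f b - f a‖ ≤ C * |b - a| :=
  (convex_uIcc a b).norm_image_sub_le_of_norm_hasDerivWithin_le
    (fun y _ => (hf y).hasDerivWithinAt) hb Set.left_mem_uIcc Set.right_mem_uIcc

lemma taylor_even {E : Type*} [NormedAddCommGroup E] [NormedSpace ℝ E] {f f1 f2 : ℝ → E} {C : ℝ}
    (hf : ∀ x, HasDerivAt f (f1 x) x) (hf1 : ∀ x, HasDerivAt f1 (f2 x) x)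
    (hb : ∀ x, ‖f2 x‖ ≤ C) (m u : ℝ) : ‖f (m+u/2) + f (m-u/2) - (2:ℝ) • f m‖ ≤ C * u^2 := by
  have hC : 0 ≤ C := (norm_nonneg _).trans (hb 0)
  have hd : ∀ v, HasDerivAt (fun v => f (m+v/2) + f (m-v/2)) ((1/2:ℝ) • (f1 (m+v/2) - f1 (m-v/2))) v := by
    intro v
    have h1 : HasDerivAt (fun v : ℝ => m + v/2) (1/2) v := ((hasDerivAt_id v).div_const 2).const_add m
    have h2 : HasDerivAt (fun v : ℝ => m - v/2) (-(1/2)) v := ((hasDerivAt_id v).div_const 2).const_sub m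
    refine (((hf (m+v/2)).scomp v h1).add ((hf (m-v/2)).scomp v h2)).congr_deriv ?_
    rw [smul_sub, neg_smul, ← sub_eq_add_neg]
  have := mvt (C := C * |u|) hd (a := 0) (b := u) (fun v hv => by
    have hvu : |v| ≤ |u| := by
      have := Set.abs_sub_left_of_mem_uIcc hv
      simpa using this
    have h := mvt (C := C) hf1 (a := m - v/2) (b := m+v/2) (fun y _ => hb y)
    rw [norm_smul]
    rw [show m + v/2 - (m - v/2) = v by ring] at h
    calc _ ≤ ‖(1/2:ℝ)‖ * (C * |v|) := by gcongr
      _ ≤ 1 * (C * |u|) := by gcongr; norm_num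
      _ = _ := by ring)
  simp only [zero_div, add_zero, sub_zero, ← two_smul ℝ (f m)] at this
  refine this.trans (le_of_eq ?_)
  rw [mul_assoc, ← sq, sq_abs]

lemma taylor_odd {E : Type*} [NormedAddCommGroup E] [NormedSpace ℝ E] {f f1 f2 f3 : ℝ → E} {C : ℝ}
    (hf : ∀ x, HasDerivAt f (f1 x) x) (hf1 : ∀ x, HasDerivAt f1 (f2 x) x) (hf2 : ∀ x, HasDerivAt f2 (f3 x) x)
    (hb : ∀ x, ‖f3 x‖ ≤ C) (m u : ℝ) : ‖f (m+u/2) - f (m-u/2) - u • f1 m‖ ≤ C * u^2 * |u| := by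
  have hC : 0 ≤ C := (norm_nonneg _).trans (hb 0)
  have hd : ∀ v, HasDerivAt (fun v => f (m+v/2) - f (m-v/2) - v • f1 m)
      ((1/2:ℝ) • (f1 (m+v/2) + f1 (m-v/2) - (2:ℝ) • f1 m)) v := by
    intro v
    have h1 : HasDerivAt (fun v : ℝ => m + v/2) (1/2) v := ((hasDerivAt_id v).div_const 2).const_add m
    have h2 : HasDerivAt (fun v : ℝ => m - v/2) (-(1/2)) v := ((hasDerivAt_id v).div_const 2).const_sub m
    refine ((((hf (m+v/2)).scomp v h1).sub ((hf (m-v/2)).scomp v h2)).sub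
      ((hasDerivAt_id v).smul_const (f1 m))).congr_deriv ?_
    rw [smul_sub, smul_add, neg_smul, smul_smul]; norm_num
  have := mvt (C := C * u^2) hd (a := 0) (b := u) (fun v hv => by
    have hvu : v^2 ≤ u^2 := by
      have := Set.abs_sub_left_of_mem_uIcc hv
      rw [sq_le_sq]
      simpa using this
    have h := taylor_even hf1 hf2 hb m v
    rw [norm_smul]
    calc _ ≤ ‖(1/2:ℝ)‖ * (C * v^2) := by gcongr
      _ ≤ 1 * (C * u^2) := by gcongr; norm_num
      _ = _ := by ring)
  simpa using this

/-- two-point correlation -/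
noncomputable def rho2 (n : ℕ) (x y : ℝ) : ℝ := dK 0 0 n x x * dK 0 0 n y y - dK 0 0 n x y ^ 2

noncomputable def gr2 {E : Type*} [NormedAddCommGroup E] [InnerProductSpace ℝ E] (p q : E) : ℝ :=
  inner ℝ p p * inner ℝ q q - inner ℝ p q ^ 2

lemma inner_diff {E : Type*} [NormedAddCommGroup E] [InnerProductSpace ℝ E] {p q p' q' : E} {P Q e f : ℝ}
    (hp : ‖p‖ ≤ P) (hq' : ‖q'‖ ≤ Q)
    (he : ‖p - p'‖ ≤ e) (hf : ‖q - q'‖ ≤ f) : |inner ℝ p q - inner ℝ p' q'| ≤ P * f + e * Q := by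
  have : inner ℝ p q - inner ℝ p' q' = inner ℝ p (q - q') + inner ℝ (p-p') q' := by
    rw [inner_sub_right, inner_sub_left]; ring
  rw [this]
  have hP := (norm_nonneg _).trans hp
  have hQ := (norm_nonneg _).trans he
  refine (abs_add_le _ _).trans ?_
  gcongr
  · exact (abs_real_inner_le_norm _ _).trans (by gcongr)
  · exact (abs_real_inner_le_norm _ _).trans (by gcongr)

lemma inner_abs_le {E : Type*} [NormedAddCommGroup E] [InnerProductSpace ℝ E] {p q : E} {P Q : ℝ}
    (hp : ‖p‖ ≤ P) (hq : ‖q‖ ≤ Q) : |inner ℝ p q| ≤ P * Q := by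
  have hP := (norm_nonneg _).trans hp
  exact (abs_real_inner_le_norm _ _).trans (by gcongr)

lemma gr2_diff {E : Type*} [NormedAddCommGroup E] [InnerProductSpace ℝ E] {p q p' q' : E} {P Q e f : ℝ}
    (hp : ‖p‖ ≤ P) (hp' : ‖p'‖ ≤ P) (hq : ‖q‖ ≤ Q) (hq' : ‖q'‖ ≤ Q)
    (he : ‖p - p'‖ ≤ e) (hf : ‖q - q'‖ ≤ f) : |gr2 p q - gr2 p' q'| ≤ 4 * P * Q^2 * e + 4 * P^2 * Q * f := by
  have h1 := inner_diff hp hp' he he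
  have h2 := inner_diff hq hq' hf hf
  have h3 := inner_diff hp hq' he hf
  have b1 := inner_abs_le hp' hp'
  have b2 := inner_abs_le hq hq
  have b3 := inner_abs_le hp hq
  have b4 := inner_abs_le hp' hq'
  have hP := (norm_nonneg _).trans hp
  have hQ := (norm_nonneg _).trans hq
  have he0 := (norm_nonneg _).trans he
  have hf0 := (norm_nonneg _).trans hf
  have e1 : gr2 p q - gr2 p' q' = (inner ℝ p p - inner ℝ p' p') * inner ℝ q q
    + inner ℝ p' p' * (inner ℝ q q - inner ℝ q' q') - (inner ℝ p q - inner ℝ p' q') * (inner ℝ p q + inner ℝ p' q') := by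
    unfold gr2; ring
  rw [e1]
  refine (abs_sub _ _).trans ?_
  refine (add_le_add (abs_add_le _ _) le_rfl).trans ?_
  rw [abs_mul, abs_mul, abs_mul]
  calc _ ≤ (P * e + e * P) * (Q * Q) + P * P * (Q * f + f * Q) + (P * f + e * Q) * (P * Q + P * Q) := by
        gcongr
        exact (abs_add_le _ _).trans (by gcongr)
    _ = _ := by ring

lemma rho2_gr2 (n : ℕ) (x y : ℝ) : rho2 n x y = gr2 (phi 0 n x) (phi 0 n y) := by
  simp only [rho2, gr2, inner_phi]

lemma gr2_pq {E : Type*} [NormedAddCommGroup E] [InnerProductSpace ℝ E] (a b : E) (u : ℝ) (hu : u ≠ 0) :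
    gr2 a b = u^2 * gr2 ((1/2:ℝ) • (a + b)) (u⁻¹ • (a - b)) := by
  unfold gr2
  simp only [inner_smul_left, inner_smul_right, inner_add_left, inner_add_right, inner_sub_left, inner_sub_right,
    real_inner_comm b a]
  simp only [conj_trivial]
  field_simp
  ring

lemma rho2_self (n : ℕ) (x : ℝ) : rho2 n x x = 0 := by unfold rho2; ring

lemma rho2_expand : ∃ C : ℝ, 0 < C ∧ ∀ n : ℕ, 1 ≤ n → ∀ m u : ℝ,
    |rho2 n (m+u/2) (m-u/2) - u^2 * (dK 0 0 n m m * dK 1 1 n m m - dK 1 0 n m m ^2)| ≤ C * n^3 * u^4 := by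
  obtain ⟨C0, hC0, h0⟩ := norm_phi_le 0
  obtain ⟨C1, hC1, h1⟩ := norm_phi_le 1
  obtain ⟨C2, hC2, h2⟩ := norm_phi_le 2
  obtain ⟨C3, hC3, h3⟩ := norm_phi_le 3
  refine ⟨4 * C0 * C1^2 * C2 + 4 * C0^2 * C1 * C3, by positivity, fun n hn m u => ?_⟩
  have hn' : (1:ℝ) ≤ n := by exact_mod_cast hn
  by_cases hu : u = 0
  · subst hu; simp [rho2_self]
  set t := √√(n:ℝ)
  have ht2 : t^2 = √n := sqsq_pow n
  have htn : t^4 = n := by rw [← sqrt_nat_pow n, ← ht2]; ring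
  have htp : 0 ≤ t := Real.sqrt_nonneg _
  have htt : √(t^2) = t := Real.sqrt_sq htp
  rw [rho2_gr2, gr2_pq _ _ u hu]
  have e : dK 0 0 n m m * dK 1 1 n m m - dK 1 0 n m m ^2 = gr2 (phi 0 n m) (phi 1 n m) := by
    simp only [gr2, inner_phi]; rw [dK_comm 1 0]
  rw [e, ← mul_sub, abs_mul, abs_of_nonneg (sq_nonneg u)]
  have hp : ‖(1/2:ℝ) • (phi 0 n (m+u/2) + phi 0 n (m-u/2))‖ ≤ C0 * t := by
    rw [norm_smul]
    have a1 := h0 n hn (m+u/2)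
    have a2 := h0 n hn (m-u/2)
    rw [pow_zero, mul_one] at a1 a2
    calc _ ≤ ‖(1/2:ℝ)‖ * (C0 * t + C0 * t) := by gcongr; exact (norm_add_le _ _).trans (by gcongr)
      _ = _ := by norm_num; ring
  have hp' : ‖phi 0 n m‖ ≤ C0 * t := by simpa using h0 n hn m
  have hq' : ‖phi 1 n m‖ ≤ C1 * t^3 := by
    refine (h1 n hn m).trans (le_of_eq ?_)
    rw [← ht2, htt]; ring
  have hq : ‖u⁻¹ • (phi 0 n (m+u/2) - phi 0 n (m-u/2))‖ ≤ C1 * t^3 := by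
    have := mvt (hasDerivAt_phi 0 n) (a := m - u/2) (b := m+u/2) (fun y _ => h1 n hn y)
    rw [show m + u/2 - (m - u/2) = u by ring] at this
    rw [norm_smul, norm_inv, Real.norm_eq_abs, inv_mul_le_iff₀ (by positivity)]
    refine this.trans (le_of_eq ?_)
    rw [← ht2, htt]; ring
  have he : ‖(1/2:ℝ) • (phi 0 n (m+u/2) + phi 0 n (m-u/2)) - phi 0 n m‖ ≤ C2 * t^5 * u^2 := by
    have := taylor_even (hasDerivAt_phi 0 n) (hasDerivAt_phi 1 n) (h2 n hn) m u
    have e : (1/2:ℝ) • (phi 0 n (m+u/2) + phi 0 n (m-u/2)) - phi 0 n m =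
        (1/2:ℝ) • (phi 0 n (m+u/2) + phi 0 n (m-u/2) - (2:ℝ) • phi 0 n m) := by
      rw [smul_sub _ (_ + _), smul_smul]; norm_num
    rw [e, norm_smul]
    calc _ ≤ 1 * (C2 * √n ^2 * t * u^2) := by gcongr; norm_num
      _ = _ := by rw [← ht2]; ring
  have hf : ‖u⁻¹ • (phi 0 n (m+u/2) - phi 0 n (m-u/2)) - phi 1 n m‖ ≤ C3 * t^7 * u^2 := by
    have := taylor_odd (hasDerivAt_phi 0 n) (hasDerivAt_phi 1 n) (hasDerivAt_phi 2 n) (h3 n hn) m u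
    have e : u⁻¹ • (phi 0 n (m+u/2) - phi 0 n (m-u/2)) - phi 1 n m =
        u⁻¹ • (phi 0 n (m+u/2) - phi 0 n (m-u/2) - u • phi 1 n m) := by
      rw [smul_sub _ (_ - _), smul_smul, inv_mul_cancel₀ hu, one_smul]
    rw [e, norm_smul, norm_inv, Real.norm_eq_abs, inv_mul_le_iff₀ (by positivity)]
    refine this.trans (le_of_eq ?_)
    rw [← ht2, htt]; ring
  have := gr2_diff hp hp' hq hq' he hf
  calc _ ≤ u^2 * (4 * (C0 * t) * (C1 * t^3)^2 * (C2 * t^5 * u^2) + 4 * (C0 * t)^2 * (C1 * t^3) * (C3 * t^7 * u^2)) := by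
        gcongr
    _ = _ := by rw [← htn]; ring

lemma mul_dK {δ : ℝ} (hδ : 0 < δ) (hδ2 : δ ≤ 2) : ∃ C : ℝ, 0 < C ∧ ∀ n : ℕ, 1 ≤ n → ∀ x y : ℝ,
    x^2 ≤ (2 - δ) * n → y^2 ≤ (2 - δ) * n → ∀ r s : ℕ, r ≤ 1 → s ≤ 1 →
    |x - y| * |dK r s n x y| ≤ C * √n ^(r+s) := by
  obtain ⟨C0, hC0, h0⟩ := dK_abs_le 0 0
  obtain ⟨C1, hC1, h1⟩ := dK_abs_le 0 1
  obtain ⟨C2, hC2, h2⟩ := dK_abs_le 1 0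
  set D := 8 / δ with hD
  have hDp : 0 < D := by positivity
  refine ⟨C0 + C1 + C2 + 2 * (4 * 4 * D), by positivity, fun n hn x y hx hy => ?_⟩
  have hn' : (1:ℝ) ≤ n := by exact_mod_cast hn
  set t := √√(n:ℝ)
  have ht2 : t^2 = √n := sqsq_pow n
  have htn : t^4 = n := by rw [← sqrt_nat_pow n, ← ht2]; ring
  have htp : 0 < t := by positivity
  have k0 := h0 n hn x y
  have k1 := h1 n hn x y
  have k2 := h2 n hn x y
  have hs0 := sn_nonneg n
  have hsn : sn n ≤ t^2 := by
    rw [ht2]; unfold sn; apply Real.sqrt_le_sqrt; linarith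
  set E := √D / t with hE
  have hE2 : E^2 = D / t^2 := by rw [hE, div_pow, Real.sq_sqrt hDp.le]
  have hEp : 0 ≤ E := by positivity
  have bulk : ∀ z : ℝ, z^2 ≤ (2 - δ) * n → |psi (n-1) z| ≤ E ∧ |psi n z| ≤ E ∧
      |dpsi 1 (n-1) z| ≤ 4 * t^2 * E ∧ |dpsi 1 n z| ≤ 4 * t^2 * E := by
    intro z hz
    have hab := ab_le hδ hδ2 hn hz
    have e : 8 / (δ * √n) = E^2 := by rw [hE2, ht2, hD]; field_simp
    rw [e] at hab
    have ha : |psi (n-1) z| ≤ E := abs_le_of_sq_le_sq (by nlinarith [sq_nonneg (psi n z)]) hEp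
    have hb : |psi n z| ≤ E := abs_le_of_sq_le_sq (by nlinarith [sq_nonneg (psi (n-1) z)]) hEp
    have hzt : |z| ≤ 2 * t^2 := by
      apply abs_le_of_sq_le_sq _ (by positivity)
      rw [mul_pow, ← pow_mul, htn]; nlinarith
    have d1 : dpsi 1 (n-1) z = z * psi (n-1) z - 2 * (sn n * psi n z) := by
      have := dpsi_one_a (n-1) z
      rwa [Nat.sub_add_cancel hn] at this
    refine ⟨ha, hb, ?_, ?_⟩
    · rw [d1]
      refine (abs_sub _ _).trans ?_
      rw [abs_mul, abs_mul, abs_mul, abs_two, abs_of_nonneg hs0]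
      calc _ ≤ 2 * t^2 * E + 2 * (t^2 * E) := by gcongr
        _ = _ := by ring
    · rw [dpsi_one_b]
      refine (abs_sub _ _).trans ?_
      rw [abs_mul, abs_mul, abs_mul, abs_two, abs_of_nonneg hs0]
      calc _ ≤ 2 * (t^2 * E) + 2 * t^2 * E := by gcongr
        _ = _ := by ring
  obtain ⟨ax, bx, dax, dbx⟩ := bulk x hx
  obtain ⟨ay, by', day, dby⟩ := bulk y hy
  have gen : ∀ p q p' q' X Y : ℝ, |p| ≤ X → |q| ≤ Y → |p'| ≤ X → |q'| ≤ Y →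
      |sn n * (p * q - p' * q')| ≤ t^2 * (2 * (X * Y)) := by
    intro p q p' q' X Y h1 h2 h3 h4
    have hX := (abs_nonneg _).trans h1
    rw [abs_mul, abs_of_nonneg hs0]
    gcongr
    refine (abs_sub _ _).trans ?_
    rw [abs_mul, abs_mul, two_mul]
    gcongr
  have hch : ∀ x y, (x - y) * dK 0 0 n x y = sn n * (dpsi 0 n x * dpsi 0 (n-1) y - dpsi 0 (n-1) x * dpsi 0 n y) :=
    fun x y => christoffel n x y
  have hch1 : ∀ x y, - dK 0 0 n x y + (x - y) * dK 0 1 n x y =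
      sn n * (dpsi 0 n x * dpsi 1 (n-1) y - dpsi 0 (n-1) x * dpsi 1 n y) := by
    intro x y
    have l : HasDerivAt (fun y => (x - y) * dK 0 0 n x y) (- dK 0 0 n x y + (x - y) * dK 0 1 n x y) y :=
      (((hasDerivAt_id y).const_sub x).mul (hasDerivAt_dK_right 0 0 n x y)).congr_deriv (by simp)
    have r : HasDerivAt (fun y => sn n * (dpsi 0 n x * dpsi 0 (n-1) y - dpsi 0 (n-1) x * dpsi 0 n y))
      (sn n * (dpsi 0 n x * dpsi 1 (n-1) y - dpsi 0 (n-1) x * dpsi 1 n y)) y :=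
      (((hasDerivAt_dpsi 0 (n-1) y).const_mul _).sub ((hasDerivAt_dpsi 0 n y).const_mul _)).const_mul _
    rw [show (fun y => (x - y) * dK 0 0 n x y) = _ from funext (hch x)] at l
    exact l.unique r
  have hch2 : - dK 1 0 n x y + dK 0 1 n x y + (x - y) * dK 1 1 n x y =
      sn n * (dpsi 1 n x * dpsi 1 (n-1) y - dpsi 1 (n-1) x * dpsi 1 n y) := by
    have l : HasDerivAt (fun x => - dK 0 0 n x y + (x - y) * dK 0 1 n x y) (- dK 1 0 n x y + dK 0 1 n x y + (x - y) * dK 1 1 n x y) x :=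
      ((hasDerivAt_dK_left 0 0 n x y).neg.add (((hasDerivAt_id x).sub_const y).mul (hasDerivAt_dK_left 0 1 n x y))).congr_deriv
        (by simp; ring)
    have r : HasDerivAt (fun x => sn n * (dpsi 0 n x * dpsi 1 (n-1) y - dpsi 0 (n-1) x * dpsi 1 n y))
      (sn n * (dpsi 1 n x * dpsi 1 (n-1) y - dpsi 1 (n-1) x * dpsi 1 n y)) x :=
      (((hasDerivAt_dpsi 0 n x).mul_const _).sub ((hasDerivAt_dpsi 0 (n-1) x).mul_const _)).const_mul _
    rw [show (fun x => - dK 0 0 n x y + (x - y) * dK 0 1 n x y) = _ from funext (fun x => hch1 x y)] at l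
    exact l.unique r
  have E2t : t^2 * E^2 = D := by rw [hE2]; field_simp
  have s1 : 1 ≤ √(n:ℝ) := by rw [Real.one_le_sqrt]; exact hn'
  have g0 : |x - y| * |dK 0 0 n x y| ≤ 2 * D := by
    rw [← abs_mul, hch]
    refine (gen _ _ _ _ _ _ bx ay ax by').trans (le_of_eq ?_)
    rw [← E2t]; ring
  have g1 : |x - y| * |dK 0 1 n x y| ≤ (C0 + 8 * D) * √n := by
    have e : (x - y) * dK 0 1 n x y = dK 0 0 n x y + sn n * (dpsi 0 n x * dpsi 1 (n-1) y - dpsi 0 (n-1) x * dpsi 1 n y) := by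
      linarith [hch1 x y]
    rw [← abs_mul, e]
    have := gen _ _ _ _ _ _ bx day ax dby
    calc _ ≤ _ := abs_add_le _ _
      _ ≤ C0 * √n ^(0+0) * √n + t^2 * (2 * (E * (4 * t^2 * E))) := by gcongr; exact this
      _ = C0 * √n + 8 * (t^2 * E^2) * t^2 := by ring
      _ = _ := by rw [E2t, ht2]; ring
  have g2 : |x - y| * |dK 1 0 n x y| ≤ (C0 + 8 * D) * √n := by
    have e : (x - y) * dK 1 0 n x y = -(dK 0 0 n x y + sn n * (dpsi 0 n y * dpsi 1 (n-1) x - dpsi 0 (n-1) y * dpsi 1 n x)) := by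
      have := hch1 y x
      rw [dK_comm 0 0 n y x, dK_comm 0 1 n y x] at this
      linarith
    rw [← abs_mul, e, abs_neg]
    have := gen _ _ _ _ _ _ by' dax ay dbx
    calc _ ≤ _ := abs_add_le _ _
      _ ≤ C0 * √n ^(0+0) * √n + t^2 * (2 * (E * (4 * t^2 * E))) := by gcongr; exact this
      _ = C0 * √n + 8 * (t^2 * E^2) * t^2 := by ring
      _ = _ := by rw [E2t, ht2]; ring
  have g3 : |x - y| * |dK 1 1 n x y| ≤ (C1 + C2 + 32 * D) * √n ^ 2 := by
    have e : (x - y) * dK 1 1 n x y = dK 1 0 n x y - dK 0 1 n x y +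
        sn n * (dpsi 1 n x * dpsi 1 (n-1) y - dpsi 1 (n-1) x * dpsi 1 n y) := by linarith
    rw [← abs_mul, e]
    have := gen _ _ _ _ _ _ dbx day dax dby
    calc _ ≤ |dK 1 0 n x y| + |dK 0 1 n x y| + |sn n * (dpsi 1 n x * dpsi 1 (n-1) y - dpsi 1 (n-1) x * dpsi 1 n y)| :=
          (abs_add_le _ _).trans (by gcongr; exact abs_sub _ _)
      _ ≤ C2 * √n ^(1+0) * √n + C1 * √n ^(0+1) * √n + t^2 * (2 * ((4 * t^2 * E) * (4 * t^2 * E))) := by gcongr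
      _ = (C1 + C2) * √n^2 + 32 * (t^2 * E^2) * (t^2)^2 := by ring
      _ = _ := by rw [E2t, ht2]; ring
  intro r s hr hs
  have hf0 : C0 ≤ C0 + C1 + C2 + 2 * (4 * 4 * D) := by linarith
  interval_cases r <;> interval_cases s
  · refine g0.trans ?_
    simp only [add_zero, pow_zero, mul_one]; linarith
  · refine g1.trans ?_
    simp only [zero_add, pow_one]; exact mul_le_mul_of_nonneg_right (by linarith) (by positivity)
  · refine g2.trans ?_
    simp only [add_zero, pow_one]; exact mul_le_mul_of_nonneg_right (by linarith) (by positivity)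
  · refine g3.trans ?_
    simp only [Nat.reduceAdd]; exact mul_le_mul_of_nonneg_right (by linarith) (by positivity)

end GM

namespace GM

lemma Kdiag_eq (H : ℕ → ℝ → ℝ)
    (hH : ∀ m x, H m x = (2 : ℝ) ^ ((m : ℝ) / 2) *
      Polynomial.aeval (x * Real.sqrt 2) (Polynomial.hermite m)) (n : ℕ) (hn : 1 ≤ n) (x : ℝ) :
    Real.exp (-x ^ 2) /
          (2 ^ n * ((n - 1).factorial : ℝ) * Real.sqrt π) *
          (deriv (H n) x * H (n - 1) x - deriv (H (n - 1)) x * H n x) = dK 0 0 n x x := by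
  set h : ℕ → ℝ := fun m => (2:ℝ)^((m:ℝ)/2) * hz m with hh
  have hHp : ∀ m, H m = fun x => h m * (Real.exp (x^2/2) * psi m x) := by
    intro m; funext x
    have := hz_pos m
    have e : Real.exp (x^2/2) * Real.exp (-x^2/2) = 1 := by rw [← Real.exp_add]; ring_nf; simp
    rw [hH]
    simp only [hh, psi]
    rw [show √((m.factorial : ℝ) * √π) = hz m from rfl]
    set A := Polynomial.aeval (x * √2) (Polynomial.hermite m)
    have h1 : (2:ℝ)^((m:ℝ)/2) * hz m * (Real.exp (x^2/2) * (A * Real.exp (-x^2/2) / hz m)) =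
      (2:ℝ)^((m:ℝ)/2) * A * (Real.exp (x^2/2) * Real.exp (-x^2/2)) * (hz m / hz m) := by ring
    rw [h1, e, div_self this.ne']; ring
  have hd : ∀ m, deriv (H m) x = h m * (Real.exp (x^2/2) * (x * psi m x + dpsi 1 m x)) := by
    intro m
    rw [hHp]
    apply HasDerivAt.deriv
    have h1 : HasDerivAt (fun x : ℝ => Real.exp (x^2/2)) (Real.exp (x^2/2) * x) x := by
      refine ((hasDerivAt_pow 2 x).div_const 2).exp.congr_deriv ?_
      simp
    refine ((h1.mul (hasDerivAt_dpsi 0 m x)).const_mul (h m)).congr_deriv ?_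
    simp only [dpsi_zero]; ring
  rw [hd, hd, hHp, hHp]
  obtain ⟨N, rfl⟩ : ∃ N, n = N+1 := ⟨n-1, by omega⟩
  rw [Q_eq]
  have hs := sn_sq (N+1)
  simp only [Nat.add_sub_cancel, dpsi_one_a N, dpsi_one_b (N+1)]
  have e : Real.exp (-x^2) * (Real.exp (x^2/2) * Real.exp (x^2/2)) = 1 := by
    rw [← Real.exp_add, ← Real.exp_add]; ring_nf; simp
  have hc : h (N+1) * h N = sn (N+1) * (2^(N+1) * (N.factorial:ℝ) * √π) := by
    have hz0 : hz N ^2 = N.factorial * √π := by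
      unfold hz; rw [Real.sq_sqrt (by positivity)]
    have h2 : (2:ℝ)^(((N+1:ℕ):ℝ)/2) = (2:ℝ)^((N:ℝ)/2) * √2 := by
      rw [Real.sqrt_eq_rpow, ← Real.rpow_add (by norm_num)]; congr 1; push_cast; ring
    have h3 : ((2:ℝ)^((N:ℝ)/2))^2 = 2^N := by
      rw [← Real.rpow_natCast, ← Real.rpow_mul (by norm_num), ← Real.rpow_natCast]; congr 1; push_cast; ring
    have h4 : sn (N+1) * 2 = √2 * √((N:ℝ)+1) := by
      have := two_sn (N+1); push_cast at this; linarith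
    simp only [hh]
    rw [hz_succ, h2]
    calc _ = ((2:ℝ)^((N:ℝ)/2))^2 * (√2 * √((N:ℝ)+1)) * hz N ^2 := by ring
      _ = _ := by rw [hz0, h3, ← h4]; ring
  have hD : (2:ℝ)^(N+1) * (N.factorial:ℝ) * √π ≠ 0 := by positivity
  set D := (2:ℝ)^(N+1) * (N.factorial:ℝ) * √π
  set a := psi N x
  set b := psi (N+1) x
  set s := sn (N+1)
  set ex := Real.exp (x^2/2)
  push_cast at hs ⊢
  rw [div_mul_eq_mul_div, div_eq_iff hD]
  calc _ = (Real.exp (-x^2) * (ex * ex)) * (h (N+1) * h N) * (2 * s * (a^2+b^2) - 2 * x * a * b) := by ring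
    _ = _ := by rw [e, hc]; linear_combination (2 * (a^2+b^2) * D) * hs

end GM

namespace GM

lemma det_bordered {R : Type*} [CommRing R] {m : ℕ} (M : Matrix (Fin (m+1)) (Fin (m+1)) R) :
    M.det = M 0 0 * (M.submatrix Fin.succ Fin.succ).det -
      ∑ i, ∑ j, M 0 (Fin.succ i) * (M.submatrix Fin.succ Fin.succ).adjugate i j * M (Fin.succ j) 0 := by
  rw [Matrix.det_succ_row_zero, Fin.sum_univ_succ]
  simp only [Fin.val_zero, pow_zero, one_mul, Fin.succAbove_zero]
  rw [sub_eq_add_neg, ← Finset.sum_neg_distrib]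
  congr 1
  refine Finset.sum_congr rfl fun i _ => ?_
  set A := M.submatrix Fin.succ Fin.succ with hA
  set c : Fin m → R := fun j => M (Fin.succ j) 0
  have h1 : ((M.submatrix Fin.succ (Fin.succ i).succAbove).submatrix id i.cycleRange) = A.updateCol i c := by
    ext a b
    simp only [Matrix.submatrix_apply, id, Fin.succAbove_cycleRange, Matrix.updateCol_apply]
    split_ifs with h
    · rw [h, Equiv.swap_apply_right]
    · rw [Equiv.swap_apply_of_ne_of_ne (Fin.succ_ne_zero _) (by simpa using h)]; rfl
  have h2 := Matrix.det_permute' i.cycleRange (M.submatrix Fin.succ (Fin.succ i).succAbove)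
  rw [h1, ← Matrix.cramer_apply, Matrix.cramer_eq_adjugate_mulVec, Fin.sign_cycleRange] at h2
  have h3 : (M.submatrix Fin.succ (Fin.succ i).succAbove).det = (-1)^(i:ℕ) * (A.adjugate.mulVec c) i := by
    rw [h2]; push_cast
    rw [← mul_assoc, ← pow_add, ← two_mul, pow_mul]; simp
  rw [h3, Fin.val_succ]
  have h4 : ∑ j, M 0 (Fin.succ i) * A.adjugate i j * M (Fin.succ j) 0 = M 0 (Fin.succ i) * (A.adjugate.mulVec c) i := by
    simp only [Matrix.mulVec, dotProduct, Finset.mul_sum, mul_assoc, c]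
  rw [h4]
  have h5 : ((-1:R))^((i:ℕ)+1) * (-1)^(i:ℕ) = -1 := by
    rw [← pow_add, show (i:ℕ)+1+i = 2*i+1 by ring, pow_succ, pow_mul]; simp
  linear_combination (M 0 (Fin.succ i) * (A.adjugate.mulVec c) i) * h5

section gram
variable {E : Type*} [NormedAddCommGroup E] [InnerProductSpace ℝ E] {ι : Type*} [Fintype ι] [DecidableEq ι]

/-- Gram matrix -/
noncomputable def gm {ι : Type*} (v : ι → E) : Matrix ι ι ℝ := Matrix.of fun i j => inner ℝ (v i) (v j)

lemma gm_apply {ι : Type*} (v : ι → E) (i j : ι) : gm v i j = inner ℝ (v i) (v j) := rfl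

lemma gm_T (T : Matrix ι ι ℝ) (v : ι → E) : gm (fun i => ∑ k, T i k • v k) = T * gm v * T.transpose := by
  ext i j
  simp only [gm_apply, Matrix.mul_apply, Matrix.transpose_apply, sum_inner, inner_sum, inner_smul_left, inner_smul_right,
    conj_trivial, Finset.sum_mul, Finset.mul_sum]
  refine Finset.sum_congr rfl fun a _ => Finset.sum_congr rfl fun b _ => ?_
  rw [real_inner_comm]
  ring

lemma det_gm_T (T : Matrix ι ι ℝ) (v : ι → E) : (gm (fun i => ∑ k, T i k • v k)).det = T.det^2 * (gm v).det := by
  rw [gm_T, Matrix.det_mul, Matrix.det_mul, Matrix.det_transpose]; ring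

lemma gm_quad (v : ι → E) (x : ι → ℝ) : x ⬝ᵥ (gm v).mulVec x = ‖∑ i, x i • v i‖^2 := by
  rw [← real_inner_self_eq_norm_sq]
  simp only [dotProduct, Matrix.mulVec, gm_apply, sum_inner, inner_sum, inner_smul_left, inner_smul_right,
    conj_trivial, Finset.mul_sum]
  refine Finset.sum_congr rfl fun a _ => Finset.sum_congr rfl fun b _ => ?_
  rw [real_inner_comm]
  ring

lemma gm_posSemidef (v : ι → E) : (gm v).PosSemidef := by
  rw [Matrix.posSemidef_iff_dotProduct_mulVec]
  refine ⟨?_, fun x => ?_⟩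
  · ext i j
    simp [gm_apply, real_inner_comm]
  · have := gm_quad v x
    simp only [star_trivial]
    rw [this]; positivity

lemma det_gm_nonneg (v : ι → E) : 0 ≤ (gm v).det := (gm_posSemidef v).det_nonneg

lemma det_gm_eq_zero (v : ι → E) (x : ι → ℝ) (hx : x ≠ 0) (h : ∑ i, x i • v i = 0) : (gm v).det = 0 := by
  rw [← Matrix.exists_mulVec_eq_zero_iff]
  refine ⟨x, hx, ?_⟩
  ext i
  have : inner ℝ (v i) (∑ j, x j • v j) = 0 := by rw [h, inner_zero_right]
  rw [inner_sum] at this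
  simp only [inner_smul_right] at this
  simp only [Matrix.mulVec, dotProduct, gm_apply, Pi.zero_apply]
  rw [← this]
  exact Finset.sum_congr rfl fun _ _ => mul_comm _ _

lemma gram_step {m : ℕ} (w : E) (v : Fin m → E) :
    (gm (Fin.cons w v : Fin (m+1) → E)).det ≤ (gm v).det * ‖w‖^2 := by
  by_cases h0 : (gm v).det = 0
  · obtain ⟨x, hx, h⟩ := (Matrix.exists_mulVec_eq_zero_iff (M := gm v)).2 h0
    have h1 := gm_quad v x
    rw [h, dotProduct_zero] at h1
    have h2 : ∑ i, x i • v i = 0 := by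
      rw [← norm_eq_zero]; exact pow_eq_zero_iff (two_ne_zero) |>.1 h1.symm
    rw [h0, zero_mul]
    refine (det_gm_eq_zero _ (Fin.cons 0 x : Fin (m+1) → ℝ) ?_ ?_).le
    · intro h; apply hx; ext i; have := congrFun h i.succ; simpa using this
    · rw [Fin.sum_univ_succ]; simpa using h2
  · have hpd : (gm v).PosDef := (gm_posSemidef v).posDef_iff_isUnit.2
      ((Matrix.isUnit_iff_isUnit_det _).2 (isUnit_iff_ne_zero.2 h0))
    rw [det_bordered]
    have hs : (gm (Fin.cons w v : Fin (m+1) → E)).submatrix Fin.succ Fin.succ = gm v := by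
      ext i j; simp [gm_apply]
    rw [hs]
    have e00 : gm (Fin.cons w v : Fin (m+1) → E) 0 0 = ‖w‖^2 := by
      simp [gm_apply]
    rw [e00]
    have hinv := hpd.inv.posSemidef
    rw [Matrix.posSemidef_iff_dotProduct_mulVec] at hinv
    have := hinv.2 (fun i => inner ℝ w (v i))
    have e1 : ∑ i, ∑ j, gm (Fin.cons w v : Fin (m+1) → E) 0 (Fin.succ i) * (gm v).adjugate i j * gm (Fin.cons w v : Fin (m+1) → E) (Fin.succ j) 0
      = (gm v).det * (star (fun i => inner ℝ w (v i)) ⬝ᵥ (gm v)⁻¹.mulVec (fun i => inner ℝ w (v i))) := by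
      rw [Matrix.inv_def]
      simp only [star_trivial, dotProduct, Matrix.mulVec, gm_apply, Fin.cons_zero, Fin.cons_succ, Finset.mul_sum,
        Matrix.smul_apply, smul_eq_mul, Ring.inverse_eq_inv']
      refine Finset.sum_congr rfl fun a _ => Finset.sum_congr rfl fun b _ => ?_
      rw [real_inner_comm w (v b)]
      field_simp
    rw [e1]
    have := mul_nonneg (det_gm_nonneg v) this
    linarith

lemma gram_step_sub {m : ℕ} (w : E) (v : Fin m → E) (l : Fin m) :
    (gm (Fin.cons w v : Fin (m+1) → E)).det ≤ (gm v).det * ‖w - v l‖^2 := by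
  refine le_trans (le_of_eq ?_) (gram_step (w - v l) v)
  set T : Matrix (Fin (m+1)) (Fin (m+1)) ℝ := Matrix.updateRow 1 0 (Pi.single 0 1 - Pi.single l.succ 1) with hT
  have hdet : T.det = 1 := by
    rw [hT, ← Matrix.cramer_transpose_apply]
    simp
  have e : (Fin.cons (w - v l) v : Fin (m+1) → E) = fun i => ∑ k, T i k • (Fin.cons w v : Fin (m+1) → E) k := by
    funext i
    refine Fin.cases ?_ (fun i => ?_) i
    · simp [hT, sub_smul, Finset.sum_sub_distrib, Pi.single_apply, ite_smul]
    · simp [hT, Matrix.updateRow_ne (Fin.succ_ne_zero i), Matrix.one_apply, ite_smul]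
  rw [e, det_gm_T, hdet]; ring

end gram

/-- Comparison with block diagonal matrices -/
lemma block_compare {κ : Type*} [Fintype κ] [DecidableEq κ] (G : Matrix (Fin 2 × κ) (Fin 2 × κ) ℝ) (M : ℝ) (hM : 0 ≤ M)
    (η : κ → κ → ℝ) (h0 : ∀ i k, 0 ≤ η i k) (h1 : ∀ i k, η i k ≤ 1)
    (hG : ∀ a b, |G a b| ≤ M) (hG' : ∀ a b, a.2 ≠ b.2 → |G a b| ≤ M * η a.2 b.2) :
    |G.det - ∏ k, (Matrix.of fun i j => G (i,k) (j,k)).det| ≤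
      (Fintype.card (Equiv.Perm (Fin 2 × κ))) * (M ^ (Fintype.card (Fin 2 × κ)) *
        ∑ i, ∑ k, if i = k then 0 else η i k ^2) := by
  rw [← Matrix.det_blockDiagonal]
  set B := Matrix.blockDiagonal (fun k => Matrix.of fun i j => G (i,k) (j,k)) with hB
  have hBa : ∀ a b, B a b = if a.2 = b.2 then G a b else 0 := by
    rintro ⟨i,k⟩ ⟨j,l⟩
    rw [hB, Matrix.blockDiagonal_apply]
    by_cases h : k = l
    · subst h; simp
    · simp [h]
  set se := ∑ i, ∑ k, (if i = k then 0 else η i k ^2) with hse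
  have hterm : ∀ i k, i ≠ k → η i k ^ 2 ≤ se := by
    intro i k hik
    have a1 : (if i = k then 0 else η i k ^2) ≤ ∑ k, (if i = k then 0 else η i k ^2) :=
      Finset.single_le_sum (f := fun k => (if i = k then 0 else η i k ^2)) (fun k _ => by positivity) (Finset.mem_univ k)
    have a2 : ∑ k, (if i = k then 0 else η i k ^2) ≤ se :=
      Finset.single_le_sum (f := fun i => ∑ k, (if i = k then 0 else η i k ^2))
        (fun k _ => Finset.sum_nonneg fun _ _ => by positivity) (Finset.mem_univ i)
    rw [if_neg hik] at a1
    exact a1.trans a2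
  have hse0 : 0 ≤ se := Finset.sum_nonneg fun _ _ => Finset.sum_nonneg fun _ _ => by positivity
  rw [Matrix.det_apply, Matrix.det_apply, ← Finset.sum_sub_distrib]
  refine (Finset.abs_sum_le_sum_abs _ _).trans ?_
  refine (Finset.sum_le_card_nsmul _ _ (M ^ (Fintype.card (Fin 2 × κ)) * se) ?_).trans (le_of_eq ?_)
  swap
  · rw [nsmul_eq_mul, Finset.card_univ]
  intro σ _
  rw [← smul_sub]
  have hsg : ∀ z : ℝ, |Equiv.Perm.sign σ • z| = |z| := by
    intro z
    rcases Int.units_eq_one_or (Equiv.Perm.sign σ) with h | h <;> simp [h]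
  rw [hsg]
  by_cases hσ : ∀ a, (σ a).2 = a.2
  · have : ∏ i, B (σ i) i = ∏ i, G (σ i) i := Finset.prod_congr rfl fun a _ => by rw [hBa, if_pos (hσ a)]
    rw [this, sub_self, abs_zero]; positivity
  · push Not at hσ
    obtain ⟨a, ha⟩ := hσ
    have hBz : ∏ i, B (σ i) i = 0 := Finset.prod_eq_zero (Finset.mem_univ a) (by rw [hBa, if_neg ha])
    rw [hBz, sub_zero, Finset.abs_prod]
    -- there is another off-block entry
    obtain ⟨b, hb1, hb2⟩ : ∃ b, b.2 ≠ a.2 ∧ (σ b).2 = a.2 := by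
      by_contra hcon
      push Not at hcon
      -- then σ⁻¹ maps block into itself, hence block = image
      set S := Finset.univ.filter (fun b : Fin 2 × κ => b.2 = a.2)
      have hsub : S.map σ.symm.toEmbedding ⊆ S := by
        intro c hc
        simp only [Finset.mem_map, S, Finset.mem_filter, Finset.mem_univ, true_and] at hc ⊢
        obtain ⟨d, hd, rfl⟩ := hc
        by_contra h
        exact hcon _ h (by simpa using hd)
      have heq := Finset.eq_of_subset_of_card_le hsub (by rw [Finset.card_map])
      have haS : a ∈ S := by simp [S]
      rw [← heq] at haS
      simp only [Finset.mem_map, S, Finset.mem_filter, Finset.mem_univ, true_and] at haS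
      obtain ⟨d, hd, hda⟩ := haS
      apply ha
      have : σ a = d := by rw [← hda]; simp
      rw [this, hd]
    have hab : a ≠ b := fun h => hb1 (by rw [h])
    rw [← Finset.mul_prod_erase _ _ (Finset.mem_univ a),
      ← Finset.mul_prod_erase _ _ (Finset.mem_erase.2 ⟨hab.symm, Finset.mem_univ b⟩)]
    have hrest : ∏ i ∈ (Finset.univ.erase a).erase b, |G (σ i) i| ≤ M ^ ((Finset.univ.erase a).erase b).card :=
      (Finset.prod_le_prod (fun i _ => abs_nonneg _) (fun i _ => hG _ _)).trans (le_of_eq (Finset.prod_const _))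
    have hcard : ((Finset.univ.erase a).erase b).card + 2 = Fintype.card (Fin 2 × κ) := by
      have := Finset.card_erase_add_one (Finset.mem_univ a)
      have h2 := Finset.card_erase_add_one (Finset.mem_erase.2 ⟨hab.symm, Finset.mem_univ b⟩)
      rw [← Finset.card_univ]; omega
    have ga := hG' (σ a) a ha
    have gb := hG' (σ b) b (by rw [hb2]; exact hb1.symm)
    have t1 := hterm _ _ ha
    have t2 := hterm (σ b).2 b.2 (by rw [hb2]; exact hb1.symm)
    set p := η (σ a).2 a.2
    set q := η (σ b).2 b.2
    have hp : 0 ≤ p := h0 _ _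
    have hq : 0 ≤ q := h0 _ _
    calc _ ≤ (M * p) * ((M * q) * M ^ ((Finset.univ.erase a).erase b).card) := by gcongr
      _ = M ^ (((Finset.univ.erase a).erase b).card + 2) * (p * q) := by ring
      _ ≤ M ^ (((Finset.univ.erase a).erase b).card + 2) * se := by gcongr; nlinarith [sq_nonneg (p-q)]
      _ = _ := by rw [hcard]

end GM

namespace GM
set_option linter.unusedSectionVars false
set_option linter.unusedVariables false
set_option linter.unusedSimpArgs false

/-- the correlation functions -/
noncomputable def rho (n : ℕ) {ι : Type*} [Fintype ι] [DecidableEq ι] (x : ι → ℝ) : ℝ := (gm (fun i => phi 0 n (x i))).det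

section
variable {ι κ : Type*} [Fintype ι] [DecidableEq ι] [Fintype κ] [DecidableEq κ]

lemma rho_nonneg (n : ℕ) (x : ι → ℝ) : 0 ≤ rho n x := det_gm_nonneg _

lemma rho_comp (n : ℕ) (e : κ ≃ ι) (x : ι → ℝ) : rho n (x ∘ e) = rho n x := by
  unfold rho
  rw [← Matrix.det_submatrix_equiv_self e]
  rfl

lemma gm_phi_apply (n : ℕ) (x : ι → ℝ) (i j : ι) : gm (fun i => phi 0 n (x i)) i j = dK 0 0 n (x i) (x j) := by
  rw [gm_apply, inner_phi]

lemma continuous_dK (r s n : ℕ) : Continuous (fun p : ℝ × ℝ => dK r s n p.1 p.2) := by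
  unfold dK
  refine continuous_finsetSum _ fun j _ => ?_
  exact ((continuous_dpsi r j).comp continuous_fst).mul ((continuous_dpsi s j).comp continuous_snd)

lemma rho_apply (n : ℕ) (x : ι → ℝ) : rho n x = ∑ σ : Equiv.Perm ι, ((Equiv.Perm.sign σ : ℤ) : ℝ) * ∏ i, dK 0 0 n (x (σ i)) (x i) := by
  simp only [rho, Matrix.det_apply', gm_phi_apply]

lemma continuous_rho (n : ℕ) : Continuous (fun x : ι → ℝ => rho n x) := by
  have h : ∀ i j : ι, Continuous (fun x : ι → ℝ => dK 0 0 n (x i) (x j)) := fun i j =>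
    (continuous_dK 0 0 n).comp (f := fun x : ι → ℝ => (x i, x j)) (by fun_prop)
  simp only [rho_apply]
  refine continuous_finsetSum _ fun σ _ => Continuous.mul continuous_const (continuous_finsetProd _ fun i _ => ?_)
  exact h (σ i) i

lemma measurable_rho (n : ℕ) : Measurable (fun x : ι → ℝ => ENNReal.ofReal (rho n x)) :=
  (continuous_rho n).measurable.ennreal_ofReal

lemma rho_eq_zero (n : ℕ) (x : ι → ℝ) (h : n < Fintype.card ι) : rho n x = 0 := by
  have hli : ¬ LinearIndependent ℝ (fun i => phi 0 n (x i)) := by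
    intro hli
    have := hli.fintype_card_le_finrank
    rw [finrank_euclideanSpace_fin] at this
    omega
  rw [Fintype.not_linearIndependent_iff] at hli
  obtain ⟨g, hg, i, hi⟩ := hli
  exact det_gm_eq_zero _ g (fun h => hi (congrFun h i)) hg

end

lemma integral_Q (n : ℕ) : ∫ t, dK 0 0 n t t = n := by
  unfold dK
  rw [integral_finsetSum _ fun j _ => integrable_dpsi_mul 0 0 j j]
  have : ∀ j, ∫ x, dpsi 0 j x * dpsi 0 j x = 1 := fun j => by
    have := inner_psi j j
    rw [if_pos rfl] at this
    exact this
  simp [this]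

lemma integrable_KK (n : ℕ) (y z : ℝ) : Integrable (fun t => dK 0 0 n t y * dK 0 0 n z t) := by
  unfold dK
  simp only [Finset.sum_mul_sum]
  refine integrable_finsetSum _ fun i _ => integrable_finsetSum _ fun j _ => ?_
  have := (integrable_dpsi_mul 0 0 i j).mul_const (dpsi 0 i y * dpsi 0 j z)
  refine this.congr (Filter.Eventually.of_forall fun t => ?_)
  simp only []; ring

lemma integral_KK (n : ℕ) (y z : ℝ) : ∫ t, dK 0 0 n t y * dK 0 0 n z t = dK 0 0 n z y := by
  have hintg : ∀ i j, Integrable (fun t => dpsi 0 i t * dpsi 0 i y * (dpsi 0 j z * dpsi 0 j t)) := fun i j => by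
    have := (integrable_dpsi_mul 0 0 i j).mul_const (dpsi 0 i y * dpsi 0 j z)
    refine this.congr (Filter.Eventually.of_forall fun t => ?_)
    simp only []; ring
  have hv : ∀ i j, ∫ t, dpsi 0 i t * dpsi 0 i y * (dpsi 0 j z * dpsi 0 j t) = if i = j then dpsi 0 i y * dpsi 0 j z else 0 := by
    intro i j
    have h := inner_psi i j
    have : ∀ t, dpsi 0 i t * dpsi 0 i y * (dpsi 0 j z * dpsi 0 j t) = (psi i t * psi j t) * (dpsi 0 i y * dpsi 0 j z) := fun t => by
      simp only [dpsi]; ring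
    simp only [this]
    rw [integral_mul_const, h]
    split_ifs <;> simp
  unfold dK
  simp only [Finset.sum_mul_sum]
  rw [integral_finsetSum _ fun i _ => integrable_finsetSum _ fun j _ => hintg i j]
  refine Finset.sum_congr rfl fun i hi => ?_
  rw [integral_finsetSum _ fun j _ => hintg i j]
  simp only [hv, Finset.sum_ite_eq, if_pos hi]
  ring

lemma rho_cons (n : ℕ) {m : ℕ} (y : Fin m → ℝ) :
    ∃ B : Fin m → Fin m → ℝ, (∀ i, ∑ j, B i j * dK 0 0 n (y j) (y i) = rho n y) ∧ ∀ t, 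
    rho n (Fin.cons t y : Fin (m+1) → ℝ) = dK 0 0 n t t * rho n y -
      ∑ i, ∑ j, B i j * (dK 0 0 n t (y i) * dK 0 0 n (y j) t) := by
  refine ⟨fun i j => (gm (fun i => phi 0 n (y i))).adjugate i j, fun i => ?_, fun t => ?_⟩
  · have := congrFun (congrFun (Matrix.adjugate_mul (gm (fun i => phi 0 n (y i)))) i) i
    rw [Matrix.mul_apply] at this
    simp only [gm_phi_apply, Matrix.smul_apply, Matrix.one_apply_eq, smul_eq_mul, mul_one] at this
    exact this
  unfold rho
  rw [det_bordered]
  have hs : (gm fun i => phi 0 n ((Fin.cons t y : Fin (m+1) → ℝ) i)).submatrix Fin.succ Fin.succ = gm (fun i => phi 0 n (y i)) := by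
    ext i j; simp [gm_apply]
  rw [hs]
  simp only [gm_phi_apply, Fin.cons_zero, Fin.cons_succ]
  congr 1
  refine Finset.sum_congr rfl fun i _ => Finset.sum_congr rfl fun j _ => ?_
  ring

lemma integrable_rho_cons (n : ℕ) {m : ℕ} (y : Fin m → ℝ) : Integrable (fun t => rho n (Fin.cons t y : Fin (m+1) → ℝ)) := by
  obtain ⟨B, hB, h⟩ := rho_cons n y
  simp only [h]
  exact ((integrable_Q n).mul_const _).sub (integrable_finsetSum _ fun i _ => integrable_finsetSum _ fun j _ =>
    (integrable_KK n (y i) (y j)).const_mul _)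

lemma integral_rho_cons (n : ℕ) {m : ℕ} (y : Fin m → ℝ) :
    ∫ t, rho n (Fin.cons t y : Fin (m+1) → ℝ) = ((n:ℝ) - m) * rho n y := by
  obtain ⟨B, hB, h⟩ := rho_cons n y
  simp only [h]
  have hi : ∀ i j, Integrable (fun t => B i j * (dK 0 0 n t (y i) * dK 0 0 n (y j) t)) := fun i j =>
    (integrable_KK n (y i) (y j)).const_mul _
  rw [integral_sub ((integrable_Q n).mul_const _) (integrable_finsetSum _ fun i _ => integrable_finsetSum _ fun j _ =>
    hi i j), integral_mul_const, integral_Q,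
    integral_finsetSum _ fun i _ => integrable_finsetSum _ fun j _ => hi i j]
  have h2 : ∀ i, ∫ t, ∑ j, B i j * (dK 0 0 n t (y i) * dK 0 0 n (y j) t) = rho n y := by
    intro i
    rw [integral_finsetSum _ fun j _ => hi i j]
    simp only [integral_const_mul, integral_KK]
    exact hB i
  simp only [h2]
  simp; ring

lemma lintegral_rho_cons (n : ℕ) {m : ℕ} (y : Fin m → ℝ) :
    ∫⁻ t, ENNReal.ofReal (rho n (Fin.cons t y : Fin (m+1) → ℝ)) = ENNReal.ofReal (((n:ℝ) - m) * rho n y) := by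
  rw [← ofReal_integral_eq_lintegral_ofReal (integrable_rho_cons n y) (Filter.Eventually.of_forall fun t => rho_nonneg _ _),
    integral_rho_cons]

/-- Fubini on the first coordinate -/
lemma lintegral_fin_cons {m : ℕ} (F : (Fin (m+1) → ℝ) → ℝ≥0∞) (hF : Measurable F) :
    ∫⁻ x, F x = ∫⁻ y : Fin m → ℝ, ∫⁻ t, F (Fin.cons t y) := by
  have h := (volume_preserving_piFinSuccAbove (fun _ : Fin (m+1) => ℝ) 0).symm
  rw [← h.lintegral_comp_emb (MeasurableEquiv.measurableEmbedding _), Measure.volume_eq_prod, lintegral_prod_symm]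
  · refine lintegral_congr fun y => lintegral_congr fun t => ?_
    simp [MeasurableEquiv.piFinSuccAbove]; rfl
  · exact (hF.comp (MeasurableEquiv.measurable _)).aemeasurable

lemma lintegral_reindex {ι κ : Type*} [Fintype ι] [Fintype κ] (e : κ ≃ ι) (F : (κ → ℝ) → ℝ≥0∞) :
    ∫⁻ x : ι → ℝ, F (x ∘ e) = ∫⁻ y, F y := by
  have h := (volume_measurePreserving_piCongrLeft (fun _ : κ => ℝ) e.symm)
  rw [← h.lintegral_comp_emb (MeasurableEquiv.measurableEmbedding _)]
  refine lintegral_congr fun x => ?_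
  congr 1
  funext i
  simp only [MeasurableEquiv.coe_piCongrLeft]
  have := Equiv.piCongrLeft_apply_apply (fun _ : κ => ℝ) e.symm x (e i)
  simpa using this.symm

/-- eigenvalue law (symmetrised) -/
noncomputable def Pn (n : ℕ) : Measure (Fin n → ℝ) := volume.withDensity (fun x => ENNReal.ofReal (rho n x / n.factorial))

/-- linear statistic over embeddings -/
noncomputable def SS {ι : Type*} [Fintype ι] [DecidableEq ι] (n : ℕ) (F : (ι → ℝ) → ℝ≥0∞) (x : Fin n → ℝ) : ℝ≥0∞ :=
  ∑ e : ι ↪ Fin n, F (x ∘ e)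

lemma measurable_SS {ι : Type*} [Fintype ι] [DecidableEq ι] (n : ℕ) (F : (ι → ℝ) → ℝ≥0∞) (hF : Measurable F) :
    Measurable (SS n F) := by
  unfold SS
  refine Finset.measurable_sum _ fun e _ => hF.comp ?_
  exact measurable_pi_lambda _ fun i => measurable_pi_apply _

lemma corr_top (n : ℕ) (F : (Fin n → ℝ) → ℝ≥0∞) (hF : Measurable F) :
    ∫⁻ x, SS n F x ∂(Pn n) = ∫⁻ y, F y * ENNReal.ofReal (rho n y) := by
  unfold SS
  have hm : ∀ e : Fin n ↪ Fin n, Measurable (fun x : Fin n → ℝ => F (x ∘ e)) := fun e =>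
    hF.comp (measurable_pi_lambda _ fun i => measurable_pi_apply _)
  have hd : Measurable (fun x : Fin n → ℝ => ENNReal.ofReal (rho n x / n.factorial)) :=
    ((continuous_rho n).measurable.div_const _).ennreal_ofReal
  rw [lintegral_finsetSum _ fun e _ => hm e]
  have h1 : ∀ e : Fin n ↪ Fin n, ∫⁻ x, F (x ∘ e) ∂(Pn n) = ∫⁻ y, F y * ENNReal.ofReal (rho n y / n.factorial) := by
    intro e
    let σ : Fin n ≃ Fin n := Equiv.ofBijective e (Finite.injective_iff_bijective.1 e.injective)
    rw [Pn, lintegral_withDensity_eq_lintegral_mul _ hd (hm e),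
      ← lintegral_reindex σ (fun y => F y * ENNReal.ofReal (rho n y / n.factorial))]
    refine lintegral_congr fun x => ?_
    simp only [rho_comp, Pi.mul_apply]
    rw [mul_comm]
    rfl
  simp only [h1, Finset.sum_const, Finset.card_univ, nsmul_eq_mul]
  rw [Fintype.card_embedding_eq, Fintype.card_fin, Nat.descFactorial_self, ← lintegral_const_mul _ (show Measurable (fun y => F y * ENNReal.ofReal (rho n y / n.factorial)) from hF.mul hd)]
  refine lintegral_congr fun y => ?_
  rw [mul_left_comm]
  congr 1
  rw [← ENNReal.ofReal_natCast, ← ENNReal.ofReal_mul (by positivity)]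
  congr 1
  field_simp

lemma corr_fin (n m : ℕ) (hm : m ≤ n) (F : (Fin m → ℝ) → ℝ≥0∞) (hF : Measurable F) :
    ∫⁻ x, SS n F x ∂(Pn n) = ∫⁻ y, F y * ENNReal.ofReal (rho n y) := by
  induction hm using Nat.decreasingInduction with
  | self => exact corr_top n F hF
  | of_succ m hmn ih =>
    have hF' : Measurable (fun y : Fin (m+1) → ℝ => F (Fin.tail y)) := hF.comp (measurable_pi_lambda _ fun i => measurable_pi_apply _)
    have h := ih _ hF'
    have hS : ∀ x, SS n (fun y : Fin (m+1) → ℝ => F (Fin.tail y)) x = ((n - m : ℕ) : ℝ≥0∞) * SS n F x := by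
      intro x
      unfold SS
      rw [← (Equiv.embeddingFinSucc m (Fin n)).symm.sum_comp, Fintype.sum_sigma, Finset.mul_sum]
      refine Finset.sum_congr rfl fun e _ => ?_
      have : ∀ j, F (Fin.tail (x ∘ ((Equiv.embeddingFinSucc m (Fin n)).symm ⟨e, j⟩))) = F (x ∘ e) := by
        intro j
        congr 1
      simp only [this, Finset.sum_const, Finset.card_univ, nsmul_eq_mul]
      congr 2
      rw [Fintype.card_subtype_compl]
      simp only [Fintype.card_fin, Set.coe_ofPred]
      congr 1
      rw [← Set.toFinset_card, Set.toFinset_range, Finset.card_image_of_injective _ e.injective]; simp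
    simp only [hS] at h
    rw [lintegral_const_mul _ (measurable_SS n F hF), lintegral_fin_cons (fun y => F (Fin.tail y) * ENNReal.ofReal (rho n y)) (hF'.mul (measurable_rho n))] at h
    have hmc : ∀ y : Fin m → ℝ, Measurable (fun t => ENNReal.ofReal (rho n (Fin.cons t y : Fin (m+1) → ℝ))) := fun y => by
      refine (measurable_rho n).comp (measurable_pi_lambda _ fun i => ?_)
      refine Fin.cases ?_ (fun i => ?_) i
      · simp only [Fin.cons_zero]; exact measurable_id
      · simp
    have h3 : ∀ y : Fin m → ℝ, ∫⁻ t, F (Fin.tail (Fin.cons t y : Fin (m+1) → ℝ)) * ENNReal.ofReal (rho n (Fin.cons t y : Fin (m+1) → ℝ))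
       = ((n - m : ℕ) : ℝ≥0∞) * (F y * ENNReal.ofReal (rho n y)) := by
      intro y
      simp only [Fin.tail_cons]
      rw [lintegral_const_mul _ (hmc y), lintegral_rho_cons, ENNReal.ofReal_mul (by rw [sub_nonneg]; exact_mod_cast hmn.le),
        ← Nat.cast_sub hmn.le, ENNReal.ofReal_natCast]
      ring
    simp only [h3] at h
    rw [lintegral_const_mul _ (show Measurable (fun y => F y * ENNReal.ofReal (rho n y)) from hF.mul (measurable_rho n))] at h
    refine (ENNReal.mul_right_inj ?_ ?_).1 h
    · exact_mod_cast (Nat.sub_pos_of_lt hmn).ne'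
    · exact ENNReal.natCast_ne_top _

/-- Gaudin: correlation functions of `Pn` -/
theorem corr {ι : Type*} [Fintype ι] [DecidableEq ι] (n : ℕ) (F : (ι → ℝ) → ℝ≥0∞) (hF : Measurable F) :
    ∫⁻ x, SS n F x ∂(Pn n) = ∫⁻ y, F y * ENNReal.ofReal (rho n y) := by
  by_cases hc : Fintype.card ι ≤ n
  · let e : Fin (Fintype.card ι) ≃ ι := (Fintype.equivFin ι).symm
    have hF' : Measurable (fun y : Fin (Fintype.card ι) → ℝ => F (y ∘ e.symm)) :=
      hF.comp (measurable_pi_lambda _ fun i => measurable_pi_apply _)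
    have h := corr_fin n _ hc (fun y => F (y ∘ e.symm)) hF'
    rw [← lintegral_reindex e] at h
    have e1 : ∀ x : ι → ℝ, (x ∘ e) ∘ e.symm = x := fun x => by ext; simp
    simp only [e1, rho_comp] at h
    rw [← h]
    refine lintegral_congr fun x => ?_
    unfold SS
    rw [← (Equiv.embeddingCongr e (Equiv.refl (Fin n))).sum_comp]
    refine Finset.sum_congr rfl fun g _ => ?_
    congr 1
  · push Not at hc
    have : IsEmpty (ι ↪ Fin n) := Function.Embedding.isEmpty_of_card_lt (by simpa using hc)
    simp [SS, rho_eq_zero n _ hc]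

instance instPn (n : ℕ) : IsProbabilityMeasure (Pn n) := ⟨by
  have h := corr (ι := Fin 0) n (fun _ => 1) measurable_const
  have : Unique (Fin 0 ↪ Fin n) := Unique.mk' _
  have hS : ∀ x, SS (ι := Fin 0) n (fun _ => 1) x = 1 := fun x => by simp [SS]
  simp only [hS] at h
  rw [lintegral_one] at h
  rw [h]
  simp only [rho, Matrix.det_isEmpty, ENNReal.ofReal_one, mul_one, lintegral_one]
  rw [volume_pi, Measure.pi_univ]; simp⟩

end GM

namespace GM

/-- squared Vandermonde up to sign -/
noncomputable def WW {n : ℕ} (x : Fin n → ℝ) : ℝ := ∏ p ∈ (Finset.univ : Finset (Fin n)).offDiag, (x p.1 - x p.2)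

lemma WW_eq (n : ℕ) (x : Fin n → ℝ) :
    WW x = (-1)^((Finset.univ.filter (fun p : Fin n × Fin n => p.1 < p.2)).card) * (∏ i, ∏ j ∈ Finset.Ioi i, (x j - x i))^2 := by
  have h1 : (Finset.univ : Finset (Fin n)).offDiag = (Finset.univ.filter (fun p : Fin n × Fin n => p.1 < p.2)).disjUnion
      (Finset.univ.filter (fun p : Fin n × Fin n => p.2 < p.1)) (by
        rw [Finset.disjoint_filter]; intro p _ h; exact h.le.not_gt) := by
    ext p
    simp only [Finset.mem_offDiag, Finset.mem_univ, true_and, Finset.mem_disjUnion, Finset.mem_filter]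
    exact ⟨fun h => lt_or_gt_of_ne h, fun h => h.elim ne_of_lt ne_of_gt⟩
  have h2 : ∏ p ∈ (Finset.univ.filter (fun p : Fin n × Fin n => p.2 < p.1)), (x p.1 - x p.2) =
      ∏ p ∈ (Finset.univ.filter (fun p : Fin n × Fin n => p.1 < p.2)), (x p.2 - x p.1) := by
    refine Finset.prod_equiv (Equiv.prodComm _ _) ?_ ?_
    · intro p; simp
    · intro p _; simp
  have h3 : (∏ i, ∏ j ∈ Finset.Ioi i, (x j - x i)) = ∏ p ∈ (Finset.univ.filter (fun p : Fin n × Fin n => p.1 < p.2)), (x p.2 - x p.1) := by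
    rw [Finset.prod_filter, Fintype.prod_prod_type]
    refine Finset.prod_congr rfl fun i _ => ?_
    rw [← Finset.prod_filter]
    refine Finset.prod_congr ?_ fun _ _ => rfl
    ext j; simp
  rw [WW, h1, Finset.prod_disjUnion, h2, h3, sq, ← mul_assoc, ← Finset.prod_const, ← Finset.prod_mul_distrib, ← Finset.prod_mul_distrib,
    ← Finset.prod_mul_distrib]
  exact Finset.prod_congr rfl fun p _ => by ring

lemma rho_top (n : ℕ) : ∃ c : ℝ, ∀ x : Fin n → ℝ, rho n x = c * WW x * Real.exp (-∑ i, x i ^ 2) := by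
  set N := (Finset.univ.filter (fun p : Fin n × Fin n => p.1 < p.2)).card
  set p : Fin n → Polynomial ℝ := fun j => (Polynomial.hermite j).map (Int.castRingHom ℝ) with hp
  have hdet : ∀ x : Fin n → ℝ, rho n x = ((∏ i, Real.exp (-x i ^ 2/2)) * (∏ j : Fin n, (hz j)⁻¹) *
      (∏ i, ∏ j ∈ Finset.Ioi i, (x j * √2 - x i * √2)))^2 := by
    intro x
    have e1 : gm (fun i => phi 0 n (x i)) = (Matrix.of fun i j : Fin n => psi j (x i)) * (Matrix.of fun i j : Fin n => psi j (x i)).transpose := by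
      ext i j
      rw [gm_phi_apply, Matrix.mul_apply, dK, Finset.sum_range]
      rfl
    have e2 : (Matrix.of fun i j : Fin n => psi j (x i)) = Matrix.diagonal (fun i => Real.exp (-x i ^ 2/2)) *
        (Matrix.of fun i j => (p j).eval (x i * √2)) * Matrix.diagonal (fun j : Fin n => (hz j)⁻¹) := by
      ext i j
      rw [Matrix.mul_diagonal, Matrix.diagonal_mul]
      simp only [Matrix.of_apply, hp, psi, hz, Polynomial.eval_map, Polynomial.aeval_def, div_eq_mul_inv, algebraMap_int_eq]
      ring
    rw [rho, e1, Matrix.det_mul, Matrix.det_transpose, e2, Matrix.det_mul, Matrix.det_mul, Matrix.det_diagonal, Matrix.det_diagonal,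
      ← Matrix.det_eval_matrixOfPolynomials_eq_det_vandermonde (fun i => x i * √2) p, Matrix.det_vandermonde]
    · ring
    · intro i; simp [hp, (Polynomial.hermite_monic i).natDegree_map]
    · intro i; exact (Polynomial.hermite_monic i).map _
  refine ⟨(∏ j : Fin n, (hz j)⁻¹)^2 * (∏ i : Fin n, ∏ j ∈ Finset.Ioi i, √2)^2 * (-1)^N, fun x => ?_⟩
  rw [hdet, WW_eq]
  have e3 : (∏ i, ∏ j ∈ Finset.Ioi i, (x j * √2 - x i * √2)) = (∏ i, ∏ j ∈ Finset.Ioi i, (x j - x i)) * (∏ i : Fin n, ∏ j ∈ Finset.Ioi i, √2) := by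
    rw [← Finset.prod_mul_distrib]
    refine Finset.prod_congr rfl fun i _ => ?_
    rw [← Finset.prod_mul_distrib]
    refine Finset.prod_congr rfl fun i _ => ?_
    ring
  have e4 : Real.exp (-∑ i, x i ^2) = (∏ i, Real.exp (-x i ^ 2/2))^2 := by
    rw [← Finset.prod_pow, ← Finset.sum_neg_distrib, Real.exp_sum]
    refine Finset.prod_congr rfl fun i _ => ?_
    rw [← Real.exp_nat_mul]; congr 1; push_cast; ring
  rw [e3, e4]
  have e5 : ((-1:ℝ))^N * (-1)^N = 1 := by rw [← mul_pow]; simp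
  linear_combination (-(∏ i, Real.exp (-x i ^ 2/2))^2 * (∏ j : Fin n, (hz j)⁻¹)^2 * (∏ i : Fin n, ∏ j ∈ Finset.Ioi i, √2)^2 * (∏ i, ∏ j ∈ Finset.Ioi i, (x j - x i))^2) * e5

end GM

namespace GM

section EB
variable {E : Type*} [NormedAddCommGroup E]

/-- exponentially bounded continuous functions -/
def EB (f : E → ℂ) : Prop := Continuous f ∧ ∃ C c : ℝ, 0 ≤ C ∧ 0 ≤ c ∧ ∀ x, ‖f x‖ ≤ C * Real.exp (c * ‖x‖)

lemma EB.add {f g : E → ℂ} (hf : EB f) (hg : EB g) : EB (fun x => f x + g x) := by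
  obtain ⟨hf0, C, c, hC, hc, h⟩ := hf
  obtain ⟨hg0, D, d, hD, hd, h'⟩ := hg
  refine ⟨hf0.add hg0, C + D, c + d, by positivity, by positivity, fun x => ?_⟩
  refine (norm_add_le _ _).trans ?_
  have hx := norm_nonneg x
  have e1 : Real.exp (c * ‖x‖) ≤ Real.exp ((c+d) * ‖x‖) := Real.exp_le_exp.2 (by nlinarith)
  have e2 : Real.exp (d * ‖x‖) ≤ Real.exp ((c+d) * ‖x‖) := Real.exp_le_exp.2 (by nlinarith)
  calc _ ≤ C * Real.exp (c * ‖x‖) + D * Real.exp (d * ‖x‖) := add_le_add (h x) (h' x)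
    _ ≤ C * Real.exp ((c+d) * ‖x‖) + D * Real.exp ((c+d) * ‖x‖) := by gcongr
    _ = _ := by ring

lemma EB.mul {f g : E → ℂ} (hf : EB f) (hg : EB g) : EB (fun x => f x * g x) := by
  obtain ⟨hf0, C, c, hC, hc, h⟩ := hf
  obtain ⟨hg0, D, d, hD, hd, h'⟩ := hg
  refine ⟨hf0.mul hg0, C * D, c + d, by positivity, by positivity, fun x => ?_⟩
  rw [norm_mul]
  calc _ ≤ (C * Real.exp (c * ‖x‖)) * (D * Real.exp (d * ‖x‖)) := by gcongr; exacts [h x, h' x]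
    _ = C * D * (Real.exp (c * ‖x‖) * Real.exp (d * ‖x‖)) := by ring
    _ = _ := by rw [← Real.exp_add]; congr 2; ring

lemma EB.const (z : ℂ) : EB (fun _ : E => z) := ⟨continuous_const, ‖z‖, 0, norm_nonneg _, le_rfl, fun x => by simp⟩

lemma EB.sum {ι : Type*} (s : Finset ι) {f : ι → E → ℂ} (hf : ∀ i ∈ s, EB (f i)) : EB (fun x => ∑ i ∈ s, f i x) := by
  classical
  induction s using Finset.induction_on with
  | empty => simpa using EB.const 0
  | insert a s ha ih =>
    simp only [Finset.sum_insert ha]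
    exact (hf a (Finset.mem_insert_self _ _)).add (ih fun i hi => hf i (Finset.mem_insert_of_mem hi))

lemma EB.prod {ι : Type*} (s : Finset ι) {f : ι → E → ℂ} (hf : ∀ i ∈ s, EB (f i)) : EB (fun x => ∏ i ∈ s, f i x) := by
  classical
  induction s using Finset.induction_on with
  | empty => simpa using EB.const 1
  | insert a s ha ih =>
    simp only [Finset.prod_insert ha]
    exact (hf a (Finset.mem_insert_self _ _)).mul (ih fun i hi => hf i (Finset.mem_insert_of_mem hi))

lemma EB.pow {f : E → ℂ} (hf : EB f) (k : ℕ) : EB (fun x => f x ^ k) := by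
  have := EB.prod (Finset.range k) (f := fun _ => f) (fun _ _ => hf)
  simpa using this

lemma EB.mprod (s : Multiset ℕ) {f : ℕ → E → ℂ} (hf : ∀ i, EB (f i)) : EB (fun x => (s.map fun q => f q x).prod) := by
  induction s using Multiset.induction_on with
  | empty => simpa using EB.const 1
  | cons a s ih =>
    simp only [Multiset.map_cons, Multiset.prod_cons]
    exact (hf a).mul ih

lemma EB.of_le {f : E → ℂ} (h0 : Continuous f) (h : ∀ x, ‖f x‖ ≤ ‖x‖) : EB f := by
  refine ⟨h0, 1, 1, by norm_num, by norm_num, fun x => (h x).trans ?_⟩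
  have := Real.add_one_le_exp ‖x‖
  simp only [one_mul]; linarith

variable [NormedSpace ℝ E] [FiniteDimensional ℝ E] [MeasurableSpace E] [BorelSpace E] {μ : Measure E} [μ.IsAddHaarMeasure]

lemma integrable_gauss {q : E → ℝ} (hq0 : Continuous q) (hq : ∀ x, ‖x‖^2 ≤ q x) (c : ℝ) :
    Integrable (fun x => Real.exp (c * ‖x‖) * Real.exp (- q x)) μ := by
  set r : ℝ := Module.finrank ℝ E + 1 with hr
  have h1 := (integrable_one_add_norm (E := E) (μ := μ) (r := r) (by rw [hr]; linarith)).const_mul (Real.exp ((r+c)^2/4))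
  refine h1.mono' (by fun_prop) (Filter.Eventually.of_forall fun x => ?_)
  rw [Real.norm_of_nonneg (by positivity), Real.rpow_neg (by positivity), ← div_eq_mul_inv, le_div_iff₀ (by positivity)]
  have h2 : (1 + ‖x‖)^r ≤ Real.exp (r * ‖x‖) := by
    rw [mul_comm r, Real.exp_mul]
    refine Real.rpow_le_rpow (by positivity) ?_ (by positivity)
    linarith [Real.add_one_le_exp ‖x‖]
  calc _ ≤ Real.exp (c * ‖x‖) * Real.exp (- q x) * Real.exp (r * ‖x‖) := by gcongr
    _ = Real.exp (c * ‖x‖ - q x + r * ‖x‖) := by rw [← Real.exp_add, ← Real.exp_add]; rfl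
    _ ≤ _ := by
      apply Real.exp_le_exp.2
      nlinarith [hq x, sq_nonneg (‖x‖ - (r+c)/2)]

lemma EB.integrable {f : E → ℂ} (hf : EB f) {q : E → ℝ} (hq0 : Continuous q) (hq : ∀ x, ‖x‖^2 ≤ q x) :
    Integrable (fun x => f x * (Real.exp (- q x) : ℂ)) μ := by
  obtain ⟨hf0, C, c, hC, hc, h⟩ := hf
  refine ((integrable_gauss (μ := μ) hq0 hq c).const_mul C).mono' ?_ (Filter.Eventually.of_forall fun x => ?_)
  · exact Continuous.aestronglyMeasurable (by fun_prop)
  · rw [norm_mul, Complex.norm_real, Real.norm_of_nonneg (Real.exp_pos _).le, ← mul_assoc]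
    gcongr
    exact h x

/-- Gaussian integration by parts -/
lemma gauss_ibp {f f' : E → ℂ} {q q' : E → ℝ} {v : E} (hf : EB f) (hf' : EB f') (hq0 : Continuous q) (hq : ∀ x, ‖x‖^2 ≤ q x)
    (hq' : EB (fun x => (q' x : ℂ))) (hd : ∀ x, HasLineDerivAt ℝ f (f' x) x v) (hdq : ∀ x, HasLineDerivAt ℝ q (q' x) x v) :
    ∫ x, f' x * (Real.exp (- q x) : ℂ) ∂μ = ∫ x, q' x * f x * (Real.exp (- q x) : ℂ) ∂μ := by
  have i1 : Integrable (fun x => f' x * (Real.exp (- q x) : ℂ)) μ := hf'.integrable hq0 hq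
  have i2 : Integrable (fun x => f x * (Real.exp (- q x) : ℂ)) μ := hf.integrable hq0 hq
  have i3 : Integrable (fun x => q' x * f x * (Real.exp (- q x) : ℂ)) μ := (hq'.mul hf).integrable hq0 hq
  have i4 : Integrable (fun x => f x * (- (q' x * Real.exp (- q x)) : ℂ)) μ := by
    refine i3.neg.congr (Filter.Eventually.of_forall fun x => ?_)
    simp; ring
  have hg : ∀ x, HasLineDerivAt ℝ (fun x => (Real.exp (- q x) : ℂ)) (- (q' x * Real.exp (- q x)) : ℂ) x v := by
    intro x
    have h := hdq x
    unfold HasLineDerivAt at h ⊢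
    have h2 := (h.neg.exp).ofReal_comp
    refine h2.congr_deriv ?_
    simp; ring
  have key := integral_bilinear_hasLineDerivAt_right_eq_neg_left_of_integrable (μ := μ) (B := ContinuousLinearMap.mul ℝ ℂ)
    (f := f) (f' := f') (g := fun x => (Real.exp (- q x) : ℂ)) (g' := fun x => (- (q' x * Real.exp (- q x)) : ℂ)) (v := v)
    (by simpa using i1) (by simpa using i4) (by simpa using i2) (fun x _ => hd x) (fun x _ => hg x)
  simp only [ContinuousLinearMap.mul_apply'] at key
  rw [← neg_eq_iff_eq_neg, ← integral_neg] at key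
  rw [← key]
  refine integral_congr_ae (Filter.Eventually.of_forall fun x => ?_)
  simp only []; ring

end EB

end GM

namespace GM

/-- loop equations -/
def Loop (n : ℕ) (E : Multiset ℕ → ℂ) : Prop :=
  (∀ s, E (0 ::ₘ s) = n * E s) ∧ ∀ k s, 2 * E ((k+1) ::ₘ s) =
    (∑ l ∈ Finset.range k, E (l ::ₘ (k - 1 - l) ::ₘ s)) + (s.map fun q : ℕ => ((q : ℕ) : ℂ) * E ((k + (q - 1)) ::ₘ s.erase q)).sum

lemma Loop.unique {n : ℕ} {E E' : Multiset ℕ → ℂ} (h : Loop n E) (h' : Loop n E') (h0 : E 0 = E' 0) : E = E' := by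
  have main : ∀ N c : ℕ, ∀ s : Multiset ℕ, s.sum = N → s.card = c → E s = E' s := by
    intro N
    induction N using Nat.strong_induction_on with
    | _ N ih =>
    intro c
    induction c using Nat.strong_induction_on with
    | _ c ihc =>
    intro s hs hc
    induction s using Multiset.induction_on with
    | empty => exact h0
    | cons a s _ =>
      rcases Nat.eq_zero_or_pos a with rfl | ha
      · rw [h.1, h'.1]
        congr 1
        refine ihc s.card ?_ s ?_ rfl
        · rw [← hc, Multiset.card_cons]; omega
        · rw [← hs]; simp
      · obtain ⟨k, rfl⟩ : ∃ k, a = k + 1 := ⟨a - 1, by omega⟩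
        have e1 := h.2 k s
        have e2 := h'.2 k s
        rw [Multiset.sum_cons] at hs
        have : (2:ℂ) * E ((k+1) ::ₘ s) = 2 * E' ((k+1) ::ₘ s) := by
          rw [e1, e2]
          congr 1
          · refine Finset.sum_congr rfl fun l hl => ?_
            rw [Finset.mem_range] at hl
            refine ih _ ?_ _ _ rfl rfl
            simp only [Multiset.sum_cons]; omega
          · congr 1
            refine Multiset.map_congr rfl fun q hq => ?_
            rcases Nat.eq_zero_or_pos q with rfl | hq0
            · simp
            congr 1
            refine ih _ ?_ _ _ rfl rfl
            have := Multiset.sum_erase hq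
            simp only [Multiset.sum_cons]; omega
        exact mul_left_cancel₀ two_ne_zero this
  funext s
  exact main _ _ s rfl rfl

lemma hasDerivAt_mprod {f : ℕ → ℝ → ℂ} {f' : ℕ → ℂ} (hf : ∀ q, HasDerivAt (f q) (f' q) 0) (s : Multiset ℕ) :
    HasDerivAt (fun t => (s.map fun q => f q t).prod) (s.map fun q => f' q * ((s.erase q).map fun q => f q 0).prod).sum 0 := by
  induction s using Multiset.induction_on with
  | empty => simpa using hasDerivAt_const (0:ℝ) (1:ℂ)
  | cons a s ih =>
    simp only [Multiset.map_cons, Multiset.prod_cons, Multiset.sum_cons, Multiset.erase_cons_head]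
    refine ((hf a).mul ih).congr_deriv ?_
    congr 1
    rw [← Multiset.sum_map_mul_left]
    congr 1
    refine Multiset.map_congr rfl fun q hq => ?_
    rw [Multiset.erase_cons_tail_of_mem hq, Multiset.map_cons, Multiset.prod_cons]
    ring

lemma integral_msum {α : Type*} [MeasurableSpace α] {μ : Measure α} (s : Multiset ℕ) {g : ℕ → α → ℂ} (hg : ∀ q, Integrable (g q) μ) :
    ∫ x, (s.map fun q => g q x).sum ∂μ = (s.map fun q => ∫ x, g q x ∂μ).sum ∧ Integrable (fun x => (s.map fun q => g q x).sum) μ := by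
  induction s using Multiset.induction_on with
  | empty => simp
  | cons a s ih =>
    simp only [Multiset.map_cons, Multiset.sum_cons]
    exact ⟨by rw [integral_add (hg a) ih.2, ih.1], (hg a).add ih.2⟩

section mat
variable {n : ℕ}
local notation "MM" => Matrix (Fin n) (Fin n) ℂ

/-- derivative of matrix powers -/
noncomputable def Dp (k : ℕ) (A Z : Matrix (Fin n) (Fin n) ℂ) : Matrix (Fin n) (Fin n) ℂ := ∑ l ∈ Finset.range k, A ^ l * Z * A ^ (k - 1 - l)

lemma Dp_succ (k : ℕ) (A Z : MM) : Dp (k+1) A Z = Dp k A Z * A + A ^ k * Z := by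
  unfold Dp
  rw [Finset.sum_range_succ, Finset.sum_mul]
  congr 1
  · refine Finset.sum_congr rfl fun l hl => ?_
    rw [Finset.mem_range] at hl
    rw [mul_assoc, mul_assoc, mul_assoc, ← pow_succ]
    congr 3; omega
  · simp

lemma hasDerivAt_mpow (k : ℕ) (A Z : MM) (a b : Fin n) : HasDerivAt (fun t : ℝ => ((A + t • Z)^k) a b) (Dp k A Z a b) 0 := by
  induction k generalizing a b with
  | zero =>
    simp only [pow_zero, Dp, Finset.range_zero, Finset.sum_empty, Matrix.zero_apply]
    exact hasDerivAt_const _ _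
  | succ k ih =>
    simp only [pow_succ, Matrix.mul_apply, Dp_succ, Matrix.add_apply, Matrix.smul_apply]
    rw [← Finset.sum_add_distrib]
    refine HasDerivAt.fun_sum fun c _ => ?_
    have h2 : HasDerivAt (fun t : ℝ => A c b + t • Z c b) (Z c b) 0 := by
      have := ((hasDerivAt_id (0:ℝ)).smul_const (Z c b)).const_add (A c b)
      simpa using this
    refine ((ih a c).mul h2).congr_deriv ?_
    simp

/-- trace of power -/
noncomputable def trp (A : Matrix (Fin n) (Fin n) ℂ) (q : ℕ) : ℂ := (A ^ q).trace

lemma hasDerivAt_trp (q : ℕ) (A Z : MM) : HasDerivAt (fun t : ℝ => trp (A + t • Z) q) (q * (A ^ (q - 1) * Z).trace) 0 := by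
  have h : HasDerivAt (fun t : ℝ => trp (A + t • Z) q) (Dp q A Z).trace 0 := by
    unfold trp Matrix.trace
    exact HasDerivAt.fun_sum fun i _ => hasDerivAt_mpow q A Z i i
  refine h.congr_deriv ?_
  unfold Dp
  rw [Matrix.trace_sum]
  rw [Finset.sum_congr rfl (g := fun _ => (A ^ (q-1) * Z).trace)]
  · simp
  · intro l hl
    rw [Finset.mem_range] at hl
    rw [Matrix.trace_mul_comm, ← mul_assoc, ← pow_add]
    congr 3; omega

/-- product of traces -/
noncomputable def Ptr (s : Multiset ℕ) (A : Matrix (Fin n) (Fin n) ℂ) : ℂ := (s.map fun q => trp A q).prod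

lemma Ptr_cons (a : ℕ) (s : Multiset ℕ) (A : MM) : Ptr (a ::ₘ s) A = trp A a * Ptr s A := by simp [Ptr]

/-- derivative of `(M^k)_{ab} Ptr s` -/
noncomputable def DF (k : ℕ) (s : Multiset ℕ) (a b : Fin n) (A Z : Matrix (Fin n) (Fin n) ℂ) : ℂ :=
  Dp k A Z a b * Ptr s A + (A ^ k) a b * (s.map fun q : ℕ => (((q : ℕ) : ℂ) * (A ^ (q-1) * Z).trace) * Ptr (s.erase q) A).sum

lemma hasDerivAt_F (k : ℕ) (s : Multiset ℕ) (a b : Fin n) (A Z : MM) :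
    HasDerivAt (fun t : ℝ => ((A + t • Z)^k) a b * Ptr s (A + t • Z)) (DF k s a b A Z) 0 := by
  have h1 := hasDerivAt_mpow k A Z a b
  have h2 := hasDerivAt_mprod (f := fun q t => trp (A + t • Z) q) (fun q => hasDerivAt_trp q A Z) s
  refine (h1.mul h2).congr_deriv ?_
  simp only [zero_smul, add_zero, DF, Ptr]

/-- IBP integrand -/
noncomputable def Ph (k : ℕ) (s : Multiset ℕ) (a b : Fin n) (Z A : Matrix (Fin n) (Fin n) ℂ) : ℂ :=
  DF k s a b A Z - 2 * (A * Z).trace * ((A^k) a b * Ptr s A)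

lemma Ph_lin (k : ℕ) (s : Multiset ℕ) (a b : Fin n) (Z Z' A : MM) (c : ℂ) :
    Ph k s a b (Z + c • Z') A = Ph k s a b Z A + c * Ph k s a b Z' A := by
  have e1 : Dp k A (Z + c • Z') = Dp k A Z + c • Dp k A Z' := by
    simp only [Dp, Finset.smul_sum, ← Finset.sum_add_distrib]
    refine Finset.sum_congr rfl fun l _ => ?_
    simp [mul_add, add_mul]
  have e2 : ∀ B : MM, (B * (Z + c • Z')).trace = (B * Z).trace + c * (B * Z').trace := by
    intro B; simp [mul_add, Matrix.trace_add]
  have e3 : (s.map fun q : ℕ => (((q : ℕ) : ℂ) * (A ^ (q-1) * (Z + c • Z')).trace) * Ptr (s.erase q) A).sum =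
     (s.map fun q : ℕ => (((q : ℕ) : ℂ) * (A ^ (q-1) * Z).trace) * Ptr (s.erase q) A).sum + c * (s.map fun q : ℕ => (((q : ℕ) : ℂ) * (A ^ (q-1) * Z').trace) * Ptr (s.erase q) A).sum := by
    rw [← Multiset.sum_map_mul_left, ← Multiset.sum_map_add]
    congr 1
    refine Multiset.map_congr rfl fun q _ => ?_
    rw [e2]; ring
  simp only [Ph, DF, e3]
  simp only [e1, e2, Matrix.add_apply, Matrix.smul_apply, smul_eq_mul]
  ring

lemma trace_pow_mul_single (B : MM) (a b : Fin n) : (B * Matrix.single a b (1:ℂ)).trace = B b a := by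
  simp [Matrix.trace_mul_single]

lemma sum_Ph (k : ℕ) (s : Multiset ℕ) (A : MM) : ∑ a, ∑ b, Ph k s a b (Matrix.single a b 1) A =
    (∑ l ∈ Finset.range k, Ptr (l ::ₘ (k - 1 - l) ::ₘ s) A) + (s.map fun q : ℕ => ((q : ℕ) : ℂ) * Ptr ((k + (q - 1)) ::ₘ s.erase q) A).sum
      - 2 * Ptr ((k+1) ::ₘ s) A := by
  have tm : ∀ B C : MM, ∑ a, ∑ b, B a b * C b a = (B * C).trace := by
    intro B C
    simp [Matrix.trace, Matrix.mul_apply]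
  have e1 : ∑ a, ∑ b, Dp k A (Matrix.single a b 1) a b = ∑ l ∈ Finset.range k, trp A l * trp A (k-1-l) := by
    have : ∀ a b, Dp k A (Matrix.single a b 1) a b = ∑ l ∈ Finset.range k, (A^l) a a * (A^(k-1-l)) b b := by
      intro a b
      rw [Dp, Matrix.sum_apply]
      refine Finset.sum_congr rfl fun l _ => ?_
      rw [Matrix.mul_apply, Finset.sum_eq_single b]
      · rw [Matrix.mul_single_apply_same]; ring
      · intro c _ hc
        rw [Matrix.mul_single_apply_of_ne _ _ _ _ _ hc]; simp
      · simp
    simp only [this]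
    simp only [trp, Matrix.trace, Matrix.diag, Finset.sum_mul_sum]
    calc _ = ∑ a, ∑ l ∈ Finset.range k, ∑ b, (A^l) a a * (A^(k-1-l)) b b :=
          Finset.sum_congr rfl fun a _ => Finset.sum_comm
      _ = _ := Finset.sum_comm
  have e2 : ∑ a, ∑ b, (A ^ k) a b * (s.map fun q : ℕ => (((q : ℕ) : ℂ) * (A ^ (q-1)) b a) * Ptr (s.erase q) A).sum
      = (s.map fun q : ℕ => ((q : ℕ) : ℂ) * Ptr ((k + (q - 1)) ::ₘ s.erase q) A).sum := by
    have hs : ∀ t : Multiset ℕ, ∀ g : ℕ → Fin n → Fin n → ℂ, ∑ a, ∑ b, (t.map fun q => g q a b).sum = (t.map fun q => ∑ a, ∑ b, g q a b).sum := by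
      intro t g
      induction t using Multiset.induction_on with
      | empty => simp
      | cons x t ih => simp only [Multiset.map_cons, Multiset.sum_cons, Finset.sum_add_distrib, ih]
    simp only [← Multiset.sum_map_mul_left]
    rw [hs]
    refine congrArg Multiset.sum (Multiset.map_congr rfl fun q _ => ?_)
    rw [Ptr_cons, trp, pow_add, ← tm, Finset.sum_mul, Finset.mul_sum]
    refine Finset.sum_congr rfl fun a _ => ?_
    rw [Finset.sum_mul, Finset.mul_sum]
    refine Finset.sum_congr rfl fun b _ => ?_
    ring
  have e3 : ∑ a, ∑ b, 2 * A b a * ((A^k) a b * Ptr s A) = 2 * (trp A (k+1) * Ptr s A) := by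
    rw [trp, pow_succ, ← tm, Finset.sum_mul, Finset.mul_sum]
    refine Finset.sum_congr rfl fun a _ => ?_
    rw [Finset.sum_mul, Finset.mul_sum]
    refine Finset.sum_congr rfl fun b _ => ?_
    ring
  simp only [Ph, DF, trace_pow_mul_single, Finset.sum_sub_distrib, Finset.sum_add_distrib, ← Finset.sum_mul, Ptr_cons] at e2 ⊢
  rw [e1, e2, e3, Finset.sum_mul]
  simp only [mul_assoc]

end mat

end GM

namespace GM

section herm
attribute [local instance] Matrix.normedAddCommGroup Matrix.normedSpace

noncomputable instance instBorelMat (n : ℕ) : BorelSpace (Matrix (Fin n) (Fin n) ℂ) := inferInstanceAs (BorelSpace (Fin n → Fin n → ℂ))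

/-- Hermitian matrices -/
abbrev HM (n : ℕ) := selfAdjoint (Matrix (Fin n) (Fin n) ℂ)

noncomputable instance instFDH (n : ℕ) : FiniteDimensional ℝ (HM n) :=
  inferInstanceAs (FiniteDimensional ℝ (selfAdjoint.submodule ℝ (Matrix (Fin n) (Fin n) ℂ)))

noncomputable instance instBorelH (n : ℕ) : BorelSpace (HM n) := Subtype.borelSpace _

noncomputable instance instBorelH2 (n : ℕ) : @BorelSpace (HM n) (@UniformSpace.toTopologicalSpace _ (@PseudoMetricSpace.toUniformSpace _
    (@SeminormedAddCommGroup.toPseudoMetricSpace _ (@NormedAddCommGroup.toSeminormedAddCommGroup (HM n) inferInstance)))) inferInstance := instBorelH n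

noncomputable instance instHaarH2 (n : ℕ) (ν : Measure (HM n)) [h : ν.IsAddHaarMeasure] : @Measure.IsAddHaarMeasure (HM n) inferInstance (@UniformSpace.toTopologicalSpace _ (@PseudoMetricSpace.toUniformSpace _
    (@SeminormedAddCommGroup.toPseudoMetricSpace _ (@NormedAddCommGroup.toSeminormedAddCommGroup (HM n) inferInstance)))) inferInstance ν := h

/-- the exponent -/
noncomputable def qM {n : ℕ} (M : HM n) : ℝ := (Matrix.trace ((M : Matrix (Fin n) (Fin n) ℂ) * (M : Matrix (Fin n) (Fin n) ℂ))).re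

variable {n : ℕ}

lemma herm_apply (M : HM n) (i j : Fin n) : (M : Matrix (Fin n) (Fin n) ℂ) i j = star ((M : Matrix (Fin n) (Fin n) ℂ) j i) := by
  have := M.prop
  rw [selfAdjoint.mem_iff, Matrix.star_eq_conjTranspose] at this
  exact (congrFun (congrFun this i) j).symm

lemma tr_mul_real (M V : HM n) : (((Matrix.trace ((M : Matrix (Fin n) (Fin n) ℂ) * (V : Matrix (Fin n) (Fin n) ℂ))).re : ℝ) : ℂ) =
    Matrix.trace ((M : Matrix (Fin n) (Fin n) ℂ) * (V : Matrix (Fin n) (Fin n) ℂ)) := by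
  rw [← Complex.conj_eq_iff_re]
  have hM := M.prop
  have hV := V.prop
  rw [selfAdjoint.mem_iff, Matrix.star_eq_conjTranspose] at hM hV
  rw [starRingEnd_apply, ← Matrix.trace_conjTranspose, Matrix.conjTranspose_mul, hM, hV, Matrix.trace_mul_comm]

lemma continuous_entry (i j : Fin n) : Continuous (fun M : HM n => (M : Matrix (Fin n) (Fin n) ℂ) i j) :=
  (continuous_apply j).comp ((continuous_apply i).comp continuous_subtype_val)

lemma qM_eq (M : HM n) : qM M = ∑ i, ∑ j, ‖(M : Matrix (Fin n) (Fin n) ℂ) i j‖^2 := by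
  unfold qM
  simp only [Matrix.trace, Matrix.diag, Matrix.mul_apply, Complex.re_sum]
  refine Finset.sum_congr rfl fun i _ => Finset.sum_congr rfl fun j _ => ?_
  rw [herm_apply M j i, Complex.star_def, Complex.mul_conj, Complex.normSq_eq_norm_sq]
  norm_cast

lemma continuous_qM : Continuous (qM (n := n)) := by
  simp only [funext qM_eq]
  exact continuous_finsetSum _ fun i _ => continuous_finsetSum _ fun j _ => (continuous_entry i j).norm.pow 2

lemma norm_sq_le_qM (M : HM n) : ‖M‖^2 ≤ qM M := by
  have h : ‖M‖ ≤ √(qM M) := by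
    change ‖(M : Matrix (Fin n) (Fin n) ℂ)‖ ≤ _
    rw [Matrix.norm_le_iff (Real.sqrt_nonneg _)]
    intro i j
    refine Real.le_sqrt_of_sq_le ?_
    rw [qM_eq]
    refine le_trans ?_ (Finset.single_le_sum (fun i _ => Finset.sum_nonneg fun j _ => sq_nonneg _) (Finset.mem_univ i))
    exact Finset.single_le_sum (f := fun j => ‖(M : Matrix (Fin n) (Fin n) ℂ) i j‖^2) (fun j _ => sq_nonneg _) (Finset.mem_univ j)
  have h0 : 0 ≤ qM M := by rw [qM_eq]; positivity
  calc _ ≤ √(qM M)^2 := by gcongr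
    _ = _ := Real.sq_sqrt h0

lemma EB_entry (i j : Fin n) : EB (fun M : HM n => (M : Matrix (Fin n) (Fin n) ℂ) i j) := by
  refine EB.of_le (continuous_entry i j) fun M => ?_
  exact Matrix.norm_entry_le_entrywise_sup_norm (M : Matrix (Fin n) (Fin n) ℂ)

/-- entrywise exponentially bounded matrix function -/
def EBM (F : HM n → Matrix (Fin n) (Fin n) ℂ) : Prop := ∀ i j, EB (fun M => F M i j)

lemma EBM_id : EBM (fun M : HM n => (M : Matrix (Fin n) (Fin n) ℂ)) := EB_entry
lemma EBM_const (Z : Matrix (Fin n) (Fin n) ℂ) : EBM (fun _ : HM n => Z) := fun _ _ => EB.const _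
lemma EBM.mul {F G : HM n → Matrix (Fin n) (Fin n) ℂ} (hF : EBM F) (hG : EBM G) : EBM (fun M => F M * G M) := by
  intro i j
  simp only [Matrix.mul_apply]
  exact EB.sum _ fun k _ => (hF i k).mul (hG k j)
lemma EBM.pow {F : HM n → Matrix (Fin n) (Fin n) ℂ} (hF : EBM F) (k : ℕ) : EBM (fun M => F M ^ k) := by
  induction k with
  | zero => simpa using EBM_const 1
  | succ k ih => simp only [pow_succ]; exact ih.mul hF
lemma EBM.trace {F : HM n → Matrix (Fin n) (Fin n) ℂ} (hF : EBM F) : EB (fun M => (F M).trace) := by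
  unfold Matrix.trace
  exact EB.sum _ fun k _ => hF k k

lemma EB_trp (q : ℕ) : EB (fun M : HM n => trp (M : Matrix (Fin n) (Fin n) ℂ) q) := (EBM_id.pow q).trace
lemma EB_Ptr (s : Multiset ℕ) : EB (fun M : HM n => Ptr s (M : Matrix (Fin n) (Fin n) ℂ)) := EB.mprod s EB_trp

lemma EB.msum {E : Type*} [NormedAddCommGroup E] (s : Multiset ℕ) {f : ℕ → E → ℂ} (hf : ∀ i, EB (f i)) : EB (fun x => (s.map fun q => f q x).sum) := by
  induction s using Multiset.induction_on with
  | empty => simpa using EB.const 0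
  | cons a s ih =>
    simp only [Multiset.map_cons, Multiset.sum_cons]
    exact (hf a).add ih

lemma EB_DF (k : ℕ) (s : Multiset ℕ) (a b : Fin n) (Z : Matrix (Fin n) (Fin n) ℂ) :
    EB (fun M : HM n => DF k s a b (M : Matrix (Fin n) (Fin n) ℂ) Z) := by
  unfold DF
  refine EB.add (EB.mul ?_ (EB_Ptr s)) (EB.mul (EBM_id.pow k a b) (EB.msum s fun q => ?_))
  · simp only [Dp, Matrix.sum_apply]
    exact EB.sum _ fun l _ => ((EBM_id.pow l).mul (EBM_const Z)).mul (EBM_id.pow _) a b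
  · exact ((EB.const _).mul ((EBM_id.pow _).mul (EBM_const Z)).trace).mul (EB_Ptr _)

lemma EB_Ph (k : ℕ) (s : Multiset ℕ) (a b : Fin n) (Z : Matrix (Fin n) (Fin n) ℂ) :
    EB (fun M : HM n => Ph k s a b Z (M : Matrix (Fin n) (Fin n) ℂ)) := by
  unfold Ph
  have h2 : EB (fun M : HM n => (-2:ℂ) * ((M : Matrix (Fin n) (Fin n) ℂ) * Z).trace * (((M : Matrix (Fin n) (Fin n) ℂ)^k) a b * Ptr s (M : Matrix (Fin n) (Fin n) ℂ))) :=
    ((EB.const (-2)).mul (EBM_id.mul (EBM_const Z)).trace).mul ((EBM_id.pow k a b).mul (EB_Ptr s))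
  have := (EB_DF k s a b Z).add h2
  convert this using 2
  ring

variable {ν : Measure (HM n)} [ν.IsAddHaarMeasure]

lemma int_Ph_herm (k : ℕ) (s : Multiset ℕ) (a b : Fin n) (V : HM n) :
    ∫ M : HM n, Ph k s a b (V : Matrix (Fin n) (Fin n) ℂ) (M : Matrix (Fin n) (Fin n) ℂ) * (Real.exp (-qM M) : ℂ) ∂ν = 0 := by
  have hF : EB (fun M : HM n => ((M : Matrix (Fin n) (Fin n) ℂ)^k) a b * Ptr s (M : Matrix (Fin n) (Fin n) ℂ)) := (EBM_id.pow k a b).mul (EB_Ptr s)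
  have hq' : EB (fun M : HM n => ((2 * (((M : Matrix (Fin n) (Fin n) ℂ) * (V : Matrix (Fin n) (Fin n) ℂ)).trace).re : ℝ) : ℂ)) := by
    have := (EB.const (E := HM n) 2).mul (EBM_id.mul (EBM_const (V : Matrix (Fin n) (Fin n) ℂ))).trace
    convert this using 2 with M
    rw [Complex.ofReal_mul, tr_mul_real]; simp
  have hib := gauss_ibp (μ := ν) (v := V) hF (EB_DF k s a b V) continuous_qM norm_sq_le_qM hq' (fun M => hasDerivAt_F k s a b _ _) (fun M => by
    have := hasDerivAt_trp 2 (M : Matrix (Fin n) (Fin n) ℂ) (V : Matrix (Fin n) (Fin n) ℂ)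
    have h2 := (Complex.reCLM.hasFDerivAt.comp_hasDerivAt (0:ℝ) this)
    simp only [trp, pow_two, Nat.cast_ofNat, Nat.add_one_sub_one, pow_one] at h2
    unfold HasLineDerivAt qM
    refine h2.congr_deriv ?_
    simp)
  rw [← sub_eq_zero, ← integral_sub] at hib
  · rw [← hib]
    refine integral_congr_ae (Filter.Eventually.of_forall fun M => ?_)
    simp only [Ph, Complex.ofReal_mul, tr_mul_real]
    push_cast; ring
  · exact (EB_DF k s a b V).integrable continuous_qM norm_sq_le_qM
  · exact (hq'.mul hF).integrable continuous_qM norm_sq_le_qM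

lemma int_Ph (k : ℕ) (s : Multiset ℕ) (a b : Fin n) (Z : Matrix (Fin n) (Fin n) ℂ) :
    ∫ M : HM n, Ph k s a b Z (M : Matrix (Fin n) (Fin n) ℂ) * (Real.exp (-qM M) : ℂ) ∂ν = 0 := by
  have hZ : Z = (realPart Z : Matrix (Fin n) (Fin n) ℂ) + Complex.I • (imaginaryPart Z : Matrix (Fin n) (Fin n) ℂ) := (realPart_add_I_smul_imaginaryPart Z).symm
  rw [hZ]
  simp only [Ph_lin, add_mul, mul_assoc]
  rw [integral_add, integral_const_mul, int_Ph_herm, int_Ph_herm]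
  · simp
  · exact (EB_Ph k s a b _).integrable continuous_qM norm_sq_le_qM
  · exact ((EB_Ph k s a b _).integrable continuous_qM norm_sq_le_qM).const_mul _

lemma int_Ptr (s : Multiset ℕ) : Integrable (fun M : HM n => Ptr s (M : Matrix (Fin n) (Fin n) ℂ) * (Real.exp (-qM M) : ℂ)) ν :=
  (EB_Ptr s).integrable continuous_qM norm_sq_le_qM

lemma loop_matrix : Loop n (fun s => ∫ M : HM n, Ptr s (M : Matrix (Fin n) (Fin n) ℂ) * (Real.exp (-qM M) : ℂ) ∂ν) := by
  constructor
  · intro s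
    simp only [Ptr_cons, trp, pow_zero, Matrix.trace_one, Fintype.card_fin, mul_assoc]
    rw [integral_const_mul]
  · intro k s
    have h : ∫ M : HM n, (∑ a, ∑ b, Ph k s a b (Matrix.single a b 1) (M : Matrix (Fin n) (Fin n) ℂ)) * (Real.exp (-qM M) : ℂ) ∂ν = 0 := by
      simp only [Finset.sum_mul]
      have hi : ∀ a b : Fin n, Integrable (fun M : HM n => Ph k s a b (Matrix.single a b 1) (M : Matrix (Fin n) (Fin n) ℂ) * (Real.exp (-qM M) : ℂ)) ν :=
        fun a b => (EB_Ph k s a b _).integrable continuous_qM norm_sq_le_qM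
      rw [integral_finsetSum _ fun a _ => integrable_finsetSum _ fun b _ => hi a b]
      refine Finset.sum_eq_zero fun a _ => ?_
      rw [integral_finsetSum _ fun b _ => hi a b]
      exact Finset.sum_eq_zero fun b _ => int_Ph _ _ _ _ _
    simp only [sum_Ph, sub_mul, add_mul, Finset.sum_mul, ← Multiset.sum_map_mul_right, mul_assoc] at h
    have hm := integral_msum (μ := ν) s (g := fun q M => (q:ℂ) * (Ptr ((k + (q - 1)) ::ₘ s.erase q) (M : Matrix (Fin n) (Fin n) ℂ) * (Real.exp (-qM M) : ℂ)))
      (fun q => (int_Ptr _).const_mul _)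
    have hs : Integrable (fun M : HM n => ∑ l ∈ Finset.range k, Ptr (l ::ₘ (k - 1 - l) ::ₘ s) (M : Matrix (Fin n) (Fin n) ℂ) * (Real.exp (-qM M) : ℂ)) ν :=
      integrable_finsetSum _ fun l _ => int_Ptr _
    have h12 : Integrable (fun M : HM n => ∑ l ∈ Finset.range k, Ptr (l ::ₘ (k - 1 - l) ::ₘ s) (M : Matrix (Fin n) (Fin n) ℂ) * (Real.exp (-qM M) : ℂ) +
      (s.map fun q : ℕ => ((q : ℕ) : ℂ) * (Ptr ((k + (q - 1)) ::ₘ s.erase q) (M : Matrix (Fin n) (Fin n) ℂ) * (Real.exp (-qM M) : ℂ))).sum) ν := hs.add hm.2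
    rw [integral_sub h12 ((int_Ptr _).const_mul _), integral_add hs hm.2, hm.1, integral_finsetSum _ fun l _ => int_Ptr _, integral_const_mul, sub_eq_zero] at h
    rw [← h]
    simp only [integral_const_mul]

end herm
end GM

namespace GM

section eig
variable {n : ℕ}

/-- power sums -/
noncomputable def pps (x : Fin n → ℝ) (q : ℕ) : ℂ := ∑ i, (x i : ℂ) ^ q
/-- product of power sums -/
noncomputable def Pps (s : Multiset ℕ) (x : Fin n → ℝ) : ℂ := (s.map fun q => pps x q).prod
/-- complex version of WW -/
noncomputable def WC (x : Fin n → ℝ) : ℂ := ∏ p ∈ (Finset.univ : Finset (Fin n)).offDiag, ((x p.1 : ℂ) - x p.2)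

lemma WC_eq (x : Fin n → ℝ) : WC x = (WW x : ℂ) := by
  simp [WC, WW]

lemma Pps_cons (a : ℕ) (s : Multiset ℕ) (x : Fin n → ℝ) : Pps (a ::ₘ s) x = pps x a * Pps s x := by simp [Pps]

/-- partial derivative of WC -/
noncomputable def DWC (i : Fin n) (x : Fin n → ℝ) : ℂ := ∑ p ∈ (Finset.univ : Finset (Fin n)).offDiag,
  (∏ p' ∈ (Finset.univ : Finset (Fin n)).offDiag.erase p, ((x p'.1 : ℂ) - x p'.2)) * ((if p.1 = i then 1 else 0) - (if p.2 = i then 1 else 0))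

lemma sum_DWC (k : ℕ) (x : Fin n → ℝ) : ∑ i, (x i : ℂ)^k * DWC i x = WC x * (∑ l ∈ Finset.range k, pps x l * pps x (k-1-l) - k * pps x (k-1)) := by
  have h1 : ∑ i, (x i : ℂ)^k * DWC i x = ∑ p ∈ (Finset.univ : Finset (Fin n)).offDiag, WC x * ∑ l ∈ Finset.range k, (x p.1 : ℂ)^l * (x p.2 : ℂ)^(k-1-l) := by
    simp only [DWC, Finset.mul_sum]
    rw [Finset.sum_comm]
    refine Finset.sum_congr rfl fun p hp => ?_
    have : WC x = (∏ p' ∈ (Finset.univ : Finset (Fin n)).offDiag.erase p, ((x p'.1 : ℂ) - x p'.2)) * ((x p.1 : ℂ) - x p.2) := 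
      (Finset.prod_erase_mul _ _ hp).symm
    rw [← Finset.mul_sum, this, mul_assoc, mul_comm ((x p.1 : ℂ) - x p.2), geom_sum₂_mul]
    simp only [mul_sub, mul_ite, mul_one, mul_zero, Finset.sum_sub_distrib, Finset.sum_ite_eq, Finset.mem_univ, if_true]
    ring
  rw [h1, ← Finset.mul_sum]
  congr 1
  have h2 : ∀ l ∈ Finset.range k, pps x l * pps x (k-1-l) = pps x (k-1) + ∑ p ∈ (Finset.univ : Finset (Fin n)).offDiag, (x p.1 : ℂ)^l * (x p.2 : ℂ)^(k-1-l) := by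
    intro l hl
    rw [Finset.mem_range] at hl
    simp only [pps]
    rw [Finset.sum_mul_sum, ← Finset.sum_product', ← Finset.diag_union_offDiag, Finset.sum_union (Finset.disjoint_diag_offDiag _), Finset.sum_diag]
    congr 1
    refine Finset.sum_congr rfl fun i _ => ?_
    rw [← pow_add]; congr 1; omega
  rw [Finset.sum_congr rfl h2, Finset.sum_add_distrib, Finset.sum_comm]
  simp

lemma hasDerivAt_coord (x : Fin n → ℝ) (i j : Fin n) : HasDerivAt (fun t : ℝ => (((x + t • (Pi.single i 1 : Fin n → ℝ)) j : ℝ) : ℂ)) (if j = i then 1 else 0) 0 := by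
  have : HasDerivAt (fun t : ℝ => (x + t • (Pi.single i 1 : Fin n → ℝ)) j) (if j = i then 1 else 0) 0 := by
    have h := ((hasDerivAt_id (0:ℝ)).mul_const ((Pi.single i 1 : Fin n → ℝ) j)).const_add (x j)
    simp only [Pi.add_apply, Pi.smul_apply, smul_eq_mul]
    refine h.congr_deriv ?_
    simp [Pi.single_apply]
  convert this.ofReal_comp using 1
  split_ifs <;> simp

lemma hasDerivAt_pps (x : Fin n → ℝ) (i : Fin n) (q : ℕ) : HasDerivAt (fun t : ℝ => pps (x + t • (Pi.single i 1 : Fin n → ℝ)) q) (q * (x i : ℂ)^(q-1)) 0 := by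
  unfold pps
  refine (HasDerivAt.fun_sum fun j _ => (hasDerivAt_coord x i j).fun_pow q).congr_deriv ?_
  simp

lemma hasDerivAt_WC (x : Fin n → ℝ) (i : Fin n) : HasDerivAt (fun t : ℝ => WC (x + t • (Pi.single i 1 : Fin n → ℝ))) (DWC i x) 0 := by
  unfold WC
  refine (HasDerivAt.fun_finsetProd fun p _ => (hasDerivAt_coord x i p.1).sub (hasDerivAt_coord x i p.2)).congr_deriv ?_
  simp [DWC]

/-- test function -/
noncomputable def Fe (k : ℕ) (s : Multiset ℕ) (i : Fin n) (x : Fin n → ℝ) : ℂ := (x i : ℂ)^k * Pps s x * WC x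
/-- its derivative -/
noncomputable def DFe (k : ℕ) (s : Multiset ℕ) (i : Fin n) (x : Fin n → ℝ) : ℂ :=
  (k * (x i : ℂ)^(k-1) * Pps s x + (x i : ℂ)^k * (s.map fun q : ℕ => (((q : ℕ) : ℂ) * (x i : ℂ)^(q-1)) * Pps (s.erase q) x).sum) * WC x
    + (x i : ℂ)^k * Pps s x * DWC i x

lemma hasDerivAt_Fe (k : ℕ) (s : Multiset ℕ) (i : Fin n) (x : Fin n → ℝ) :
    HasDerivAt (fun t : ℝ => Fe k s i (x + t • (Pi.single i 1 : Fin n → ℝ))) (DFe k s i x) 0 := by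
  have h1 := (hasDerivAt_coord x i i).fun_pow k
  have h2 := hasDerivAt_mprod (f := fun q t => pps (x + t • (Pi.single i 1 : Fin n → ℝ)) q) (fun q => hasDerivAt_pps x i q) s
  refine ((h1.mul h2).mul (hasDerivAt_WC x i)).congr_deriv ?_
  simp [DFe, Pps]

lemma EB_coord (i : Fin n) : EB (fun x : Fin n → ℝ => (x i : ℂ)) := by
  refine EB.of_le (by fun_prop) fun x => ?_
  simpa using norm_le_pi_norm x i

lemma EB_pps (q : ℕ) : EB (fun x : Fin n → ℝ => pps x q) := EB.sum _ fun i _ => (EB_coord i).pow q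
lemma EB_Pps (s : Multiset ℕ) : EB (fun x : Fin n → ℝ => Pps s x) := EB.mprod s EB_pps
lemma EB_diff (i j : Fin n) : EB (fun x : Fin n → ℝ => (x i : ℂ) - x j) := by
  have := (EB_coord i).add ((EB.const (-1)).mul (EB_coord j))
  convert this using 2; ring
lemma EB_WC : EB (fun x : Fin n → ℝ => WC x) := EB.prod _ fun p _ => EB_diff p.1 p.2
lemma EB_DWC (i : Fin n) : EB (fun x : Fin n → ℝ => DWC i x) := EB.sum _ fun _ _ => (EB.prod _ fun p' _ => EB_diff p'.1 p'.2).mul (EB.const _)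
lemma EB_Fe (k : ℕ) (s : Multiset ℕ) (i : Fin n) : EB (Fe k s i) := (((EB_coord i).pow k).mul (EB_Pps s)).mul EB_WC
lemma EB_DFe (k : ℕ) (s : Multiset ℕ) (i : Fin n) : EB (DFe k s i) :=
  EB.add (EB.mul (EB.add (((EB.const _).mul ((EB_coord i).pow _)).mul (EB_Pps s))
    (((EB_coord i).pow k).mul (EB.msum s fun _ => ((EB.const _).mul ((EB_coord i).pow _)).mul (EB_Pps _)))) EB_WC)
    ((((EB_coord i).pow k).mul (EB_Pps s)).mul (EB_DWC i))

/-- exponent -/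
noncomputable def qE (x : Fin n → ℝ) : ℝ := ∑ i, x i ^ 2

lemma continuous_qE : Continuous (qE (n := n)) := by unfold qE; fun_prop
lemma norm_sq_le_qE (x : Fin n → ℝ) : ‖x‖^2 ≤ qE x := by
  have h0 : 0 ≤ qE x := by unfold qE; positivity
  have h : ‖x‖ ≤ √(qE x) := by
    rw [pi_norm_le_iff_of_nonneg (Real.sqrt_nonneg _)]
    intro i
    refine Real.le_sqrt_of_sq_le ?_
    rw [Real.norm_eq_abs, sq_abs]
    exact Finset.single_le_sum (f := fun i => x i^2) (fun i _ => sq_nonneg _) (Finset.mem_univ i)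
  calc _ ≤ √(qE x)^2 := by gcongr
    _ = _ := Real.sq_sqrt h0

lemma int_e {f : (Fin n → ℝ) → ℂ} (hf : EB f) : Integrable (fun x => f x * (Real.exp (-qE x) : ℂ)) := hf.integrable continuous_qE norm_sq_le_qE

lemma ibp_e (k : ℕ) (s : Multiset ℕ) (i : Fin n) :
    ∫ x : Fin n → ℝ, (DFe k s i x - 2 * x i * Fe k s i x) * (Real.exp (-qE x) : ℂ) = 0 := by
  have hq' : EB (fun x : Fin n → ℝ => ((2 * x i : ℝ) : ℂ)) := by
    have := (EB.const (E := Fin n → ℝ) 2).mul (EB_coord i)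
    simpa using this
  have hib := gauss_ibp (μ := volume) (v := (Pi.single i 1 : Fin n → ℝ)) (EB_Fe k s i) (EB_DFe k s i) continuous_qE norm_sq_le_qE hq' (fun x => hasDerivAt_Fe k s i x) (fun x => by
    unfold HasLineDerivAt qE
    have h : ∀ j ∈ Finset.univ, HasDerivAt (fun t : ℝ => (x + t • (Pi.single i 1 : Fin n → ℝ)) j ^ 2) (2 * x j * (Pi.single i 1 : Fin n → ℝ) j) 0 := by
      intro j _
      have h := (((hasDerivAt_id (0:ℝ)).mul_const ((Pi.single i 1 : Fin n → ℝ) j)).const_add (x j)).fun_pow 2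
      simp only [Pi.add_apply, Pi.smul_apply, smul_eq_mul]
      refine h.congr_deriv ?_
      simp
    refine (HasDerivAt.fun_sum h).congr_deriv ?_
    simp [Pi.single_apply])
  rw [← sub_eq_zero, ← integral_sub (int_e (EB_DFe k s i)) (int_e (hq'.mul (EB_Fe k s i)))] at hib
  rw [← hib]
  refine integral_congr_ae (Filter.Eventually.of_forall fun x => ?_)
  push_cast; ring

lemma sum_DFe (k : ℕ) (s : Multiset ℕ) (x : Fin n → ℝ) : ∑ i, (DFe k s i x - 2 * x i * Fe k s i x) =
    ((∑ l ∈ Finset.range k, Pps (l ::ₘ (k - 1 - l) ::ₘ s) x) + (s.map fun q : ℕ => ((q : ℕ) : ℂ) * Pps ((k + (q - 1)) ::ₘ s.erase q) x).sum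
      - 2 * Pps ((k+1) ::ₘ s) x) * WC x := by
  have hs : ∀ t : Multiset ℕ, ∀ g : ℕ → Fin n → ℂ, ∑ a, (t.map fun q => g q a).sum = (t.map fun q => ∑ a, g q a).sum := by
    intro t g
    induction t using Multiset.induction_on with
    | empty => simp
    | cons x t ih => simp only [Multiset.map_cons, Multiset.sum_cons, Finset.sum_add_distrib, ih]
  have e2 : ∑ i, (x i : ℂ)^k * (s.map fun q : ℕ => (((q : ℕ) : ℂ) * (x i : ℂ)^(q-1)) * Pps (s.erase q) x).sum
     = (s.map fun q : ℕ => ((q : ℕ) : ℂ) * Pps ((k + (q - 1)) ::ₘ s.erase q) x).sum := by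
    simp only [← Multiset.sum_map_mul_left]
    rw [hs]
    refine congrArg Multiset.sum (Multiset.map_congr rfl fun q _ => ?_)
    rw [Pps_cons, pps, Finset.sum_mul, Finset.mul_sum]
    refine Finset.sum_congr rfl fun i _ => ?_
    ring
  have e1 : ∑ i, (x i : ℂ)^k * Pps s x * DWC i x = Pps s x * (WC x * (∑ l ∈ Finset.range k, pps x l * pps x (k-1-l) - k * pps x (k-1))) := by
    rw [← sum_DWC, Finset.mul_sum]
    exact Finset.sum_congr rfl fun i _ => by ring
  have e3 : ∑ i, (k:ℂ) * (x i : ℂ)^(k-1) * Pps s x = k * pps x (k-1) * Pps s x := by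
    rw [pps, Finset.mul_sum, Finset.sum_mul]
  have e4 : ∑ i, 2 * (x i : ℂ) * Fe k s i x = 2 * pps x (k+1) * Pps s x * WC x := by
    rw [pps, Finset.mul_sum, Finset.sum_mul, Finset.sum_mul]
    exact Finset.sum_congr rfl fun i _ => by rw [Fe]; ring
  have e5 : ∑ l ∈ Finset.range k, Pps (l ::ₘ (k - 1 - l) ::ₘ s) x = (∑ l ∈ Finset.range k, pps x l * pps x (k-1-l)) * Pps s x := by
    rw [Finset.sum_mul]
    exact Finset.sum_congr rfl fun l _ => by rw [Pps_cons, Pps_cons, mul_assoc]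
  rw [Finset.sum_sub_distrib, e4]
  simp only [DFe]
  rw [Finset.sum_add_distrib, ← Finset.sum_mul, Finset.sum_add_distrib, e1, e2, e3, e5, Pps_cons (k+1)]
  ring

lemma int_Pps (s : Multiset ℕ) : Integrable (fun x : Fin n → ℝ => Pps s x * (WC x * (Real.exp (-qE x) : ℂ))) := by
  simpa only [mul_assoc] using int_e ((EB_Pps s).mul EB_WC)

lemma loop_eig : Loop n (fun s => ∫ x : Fin n → ℝ, Pps s x * (WC x * (Real.exp (-qE x) : ℂ))) := by
  constructor
  · intro s
    simp only [Pps_cons, pps, pow_zero, Finset.sum_const, Finset.card_univ, Fintype.card_fin, mul_assoc]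
    rw [← integral_const_mul]
    simp
  · intro k s
    have h : ∫ x : Fin n → ℝ, (∑ i, (DFe k s i x - 2 * x i * Fe k s i x)) * (Real.exp (-qE x) : ℂ) = 0 := by
      simp only [Finset.sum_mul]
      rw [integral_finsetSum]
      · exact Finset.sum_eq_zero fun b _ => ibp_e _ _ _
      · intro i _
        have := int_e (((EB_DFe k s i)).add (((EB.const (-2)).mul (EB_coord i)).mul (EB_Fe k s i)))
        convert this using 3; ring
    simp only [sum_DFe] at h
    simp only [sub_mul, add_mul, Finset.sum_mul, ← Multiset.sum_map_mul_right, mul_assoc] at h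
    have hm := integral_msum (μ := volume) s (g := fun q (x : Fin n → ℝ) => (q:ℂ) * (Pps ((k + (q - 1)) ::ₘ s.erase q) x * (WC x * (Real.exp (-qE x) : ℂ))))
      (fun q => (int_Pps _).const_mul _)
    have hs : Integrable (fun x : Fin n → ℝ => ∑ l ∈ Finset.range k, Pps (l ::ₘ (k - 1 - l) ::ₘ s) x * (WC x * (Real.exp (-qE x) : ℂ))) :=
      integrable_finsetSum _ fun l _ => int_Pps _
    have h12 := hs.add hm.2
    simp only [Pi.add_def] at h12
    rw [integral_sub h12 ((int_Pps _).const_mul _), integral_add hs hm.2, hm.1, integral_finsetSum _ fun l _ => int_Pps _, integral_const_mul, sub_eq_zero] at h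
    rw [← h]
    simp only [integral_const_mul]

end eig
end GM

namespace GM

section eigv
variable {n : ℕ}

/-- eigenvalues -/
noncomputable def eig (M : HM n) : Fin n → ℝ := Matrix.IsHermitian.eigenvalues (show Matrix.IsHermitian (M : Matrix (Fin n) (Fin n) ℂ) from M.prop)

lemma trp_eq (M : HM n) (q : ℕ) : trp (M : Matrix (Fin n) (Fin n) ℂ) q = pps (eig M) q := by
  have hA : Matrix.IsHermitian (M : Matrix (Fin n) (Fin n) ℂ) := M.prop
  have h := hA.spectral_theorem
  unfold trp pps
  conv_lhs => rw [h, ← map_pow, Unitary.conjStarAlgAut_apply, Matrix.trace_mul_comm, ← mul_assoc, Unitary.coe_star_mul_self, one_mul, Matrix.diagonal_pow, Matrix.trace_diagonal]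
  rfl

lemma Ptr_eq (M : HM n) (s : Multiset ℕ) : Ptr s (M : Matrix (Fin n) (Fin n) ℂ) = Pps s (eig M) := by
  simp only [Ptr, Pps, trp_eq]

lemma continuous_trp (q : ℕ) : Continuous (fun M : HM n => trp (M : Matrix (Fin n) (Fin n) ℂ) q) := by
  unfold trp
  exact ((continuous_subtype_val).pow q).matrix_trace

lemma sum_poly (p : Polynomial ℝ) (M : HM n) : ∑ i, p.eval (eig M i) = ∑ q ∈ Finset.range (p.natDegree + 1), p.coeff q * (trp (M : Matrix (Fin n) (Fin n) ℂ) q).re := by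
  simp only [Polynomial.eval_eq_sum_range]
  rw [Finset.sum_comm]
  refine Finset.sum_congr rfl fun q _ => ?_
  rw [trp_eq, pps, Complex.re_sum, Finset.mul_sum]
  refine Finset.sum_congr rfl fun i _ => ?_
  norm_cast

lemma exists_poly_indicator (t : ℝ) : ∃ p : ℕ → Polynomial ℝ, ∀ x : ℝ, Filter.Tendsto (fun m => (p m).eval x) Filter.atTop (nhds (if t < x then 1 else 0)) := by
  have h : ∀ m : ℕ, ∃ p : Polynomial ℝ, ∀ x ∈ Set.Icc (-(m:ℝ)) m, |p.eval x - min 1 (max 0 (m * (x - t)))| < 1 / ((m:ℝ) + 1) := fun m =>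
    exists_polynomial_near_of_continuousOn _ _ _ (Continuous.continuousOn (by fun_prop)) _ (by positivity)
  choose p hp using h
  refine ⟨p, fun x => ?_⟩
  have h1 : Filter.Tendsto (fun m : ℕ => (min 1 (max 0 (m * (x - t))) : ℝ)) Filter.atTop (nhds (if t < x then 1 else 0)) := by
    split_ifs with hx
    · refine tendsto_const_nhds.congr' ?_
      obtain ⟨N, hN⟩ := exists_nat_gt (1 / (x - t))
      filter_upwards [Filter.eventually_ge_atTop N] with m hm
      have hx' : 0 < x - t := by linarith
      rw [div_lt_iff₀ hx'] at hN
      have : (N:ℝ) ≤ m := by exact_mod_cast hm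
      rw [min_eq_left]
      refine le_max_of_le_right ?_
      nlinarith
    · refine tendsto_const_nhds.congr fun m => ?_
      have : (m:ℝ) * (x - t) ≤ 0 := mul_nonpos_of_nonneg_of_nonpos (by positivity) (by linarith [not_lt.1 hx])
      rw [max_eq_left this]; simp
  have h2 : Filter.Tendsto (fun m : ℕ => (p m).eval x - min 1 (max 0 (m * (x - t)))) Filter.atTop (nhds 0) := by
    rw [tendsto_zero_iff_abs_tendsto_zero]
    refine squeeze_zero' (Filter.Eventually.of_forall fun m => abs_nonneg _) ?_ tendsto_one_div_add_atTop_nhds_zero_nat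
    obtain ⟨N, hN⟩ := exists_nat_gt |x|
    filter_upwards [Filter.eventually_ge_atTop N] with m hm
    have : (N:ℝ) ≤ m := by exact_mod_cast hm
    exact (hp m x (abs_le.1 (by linarith))).le
  simpa using h2.add h1

lemma measurable_count (t : ℝ) : Measurable (fun M : HM n => (((Finset.univ.filter (fun i => t < eig M i)).card : ℕ) : ℝ)) := by
  obtain ⟨p, hp⟩ := exists_poly_indicator t
  refine measurable_of_tendsto_metrizable (f := fun m (M : HM n) => ∑ i, (p m).eval (eig M i)) (fun m => ?_) ?_
  · simp only [sum_poly]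
    refine Continuous.measurable ?_
    refine continuous_finsetSum _ fun q _ => continuous_const.mul (Complex.continuous_re.comp (continuous_trp q))
  · rw [tendsto_pi_nhds]
    intro M
    have := tendsto_finsetSum Finset.univ fun i _ => hp (eig M i)
    convert this using 2
    simp

lemma measurable_eig : Measurable (eig (n := n)) := by
  rw [measurable_pi_iff]
  intro i
  refine measurable_of_Ioi fun t => ?_
  set e : Fin n ≃ Fin (Fintype.card (Fin n)) := (Fintype.equivOfCardEq (Fintype.card_fin _)).symm with he
  have hset : (fun M : HM n => eig M i) ⁻¹' Set.Ioi t = (fun M : HM n => (((Finset.univ.filter (fun i => t < eig M i)).card : ℕ) : ℝ)) ⁻¹' Set.Ioi ((e i : ℕ) : ℝ) := by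
    ext M
    simp only [Set.mem_preimage, Set.mem_Ioi, Nat.cast_lt]
    set g := Matrix.IsHermitian.eigenvalues₀ (show Matrix.IsHermitian (M : Matrix (Fin n) (Fin n) ℂ) from M.prop) with hg
    have ha : Antitone g := Matrix.IsHermitian.eigenvalues₀_antitone _
    have hge : ∀ j, eig M j = g (e j) := fun j => rfl
    have hc : (Finset.univ.filter (fun i => t < eig M i)).card = (Finset.univ.filter (fun k => t < g k)).card := by
      refine Finset.card_equiv e fun j => ?_
      simp [hge]
    rw [hc, hge]
    constructor
    · intro h
      have : Finset.Iic (e i) ⊆ Finset.univ.filter (fun k => t < g k) := by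
        intro k hk
        rw [Finset.mem_Iic] at hk
        simp only [Finset.mem_filter, Finset.mem_univ, true_and]
        exact h.trans_le (ha hk)
      have := Finset.card_le_card this
      rw [Fin.card_Iic] at this
      omega
    · intro h
      by_contra hn
      have : Finset.univ.filter (fun k => t < g k) ⊆ Finset.Iio (e i) := by
        intro k hk
        simp only [Finset.mem_filter, Finset.mem_univ, true_and] at hk
        rw [Finset.mem_Iio]
        by_contra hki
        exact hn (hk.trans_le (ha (not_lt.1 hki)))
      have := Finset.card_le_card this
      rw [Fin.card_Iio] at this
      omega
  rw [hset]
  exact measurable_count t measurableSet_Ioi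

/-- symmetric polynomials are spanned by products of power sums -/
lemma sym_mem_span {p : MvPolynomial (Fin n) ℂ} (hp : p.IsSymmetric) :
    p ∈ Submodule.span ℂ (Set.range fun s : Multiset ℕ => (s.map fun q => MvPolynomial.psum (Fin n) ℂ q).prod) := by
  set S := Algebra.adjoin ℂ (Set.range fun q : ℕ => MvPolynomial.psum (Fin n) ℂ q) with hS
  have he : ∀ k, MvPolynomial.esymm (Fin n) ℂ k ∈ S := by
    intro k
    induction k using Nat.strong_induction_on with
    | _ k ih =>
    rcases Nat.eq_zero_or_pos k with rfl | hk
    · rw [MvPolynomial.esymm_zero]; exact S.one_mem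
    · have h := MvPolynomial.mul_esymm_eq_sum (Fin n) ℂ k
      have h2 : (k : MvPolynomial (Fin n) ℂ) * MvPolynomial.esymm (Fin n) ℂ k ∈ S := by
        rw [h]
        refine S.mul_mem (S.pow_mem (S.neg_mem S.one_mem) _) (S.sum_mem fun a ha => ?_)
        rw [Finset.mem_filter] at ha
        exact S.mul_mem (S.mul_mem (S.pow_mem (S.neg_mem S.one_mem) _) (ih _ ha.2)) (Algebra.subset_adjoin ⟨a.2, rfl⟩)
      have h3 := S.smul_mem h2 ((k:ℂ)⁻¹)
      have hk' : (k:ℂ) ≠ 0 := by exact_mod_cast hk.ne'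
      have : ((k:ℂ)⁻¹) • ((k : MvPolynomial (Fin n) ℂ) * MvPolynomial.esymm (Fin n) ℂ k) = MvPolynomial.esymm (Fin n) ℂ k := by
        rw [← nsmul_eq_mul, ← Nat.cast_smul_eq_nsmul ℂ, smul_smul, inv_mul_cancel₀ hk', one_smul]
      rwa [this] at h3
  have hpS : p ∈ S := by
    obtain ⟨q, hq⟩ := MvPolynomial.esymmAlgHom_surjective (σ := Fin n) (n := n) ℂ (by simp) ⟨p, hp⟩
    have := congrArg Subtype.val hq
    rw [MvPolynomial.esymmAlgHom_apply] at this
    simp only at this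
    rw [← this]
    have hr : (MvPolynomial.aeval (fun i : Fin n => MvPolynomial.esymm (Fin n) ℂ (i + 1))) q ∈ (MvPolynomial.aeval (R := ℂ) (fun i : Fin n => MvPolynomial.esymm (Fin n) ℂ (i + 1))).range := ⟨q, rfl⟩
    rw [MvPolynomial.aeval_range] at hr
    exact (Algebra.adjoin_le (by rintro _ ⟨i, rfl⟩; exact he _)) hr
  have h4 : p ∈ Subalgebra.toSubmodule S := hpS
  rw [hS, Algebra.adjoin_eq_span] at h4
  refine Submodule.span_mono ?_ h4
  intro y hy
  obtain ⟨l, hl, rfl⟩ := Submonoid.exists_multiset_of_mem_closure hy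
  choose! f hf using hl
  refine ⟨l.map f, ?_⟩
  simp only [Multiset.map_map, Function.comp_def]
  conv_rhs => rw [← Multiset.map_id l]
  exact congrArg Multiset.prod (Multiset.map_congr rfl fun x hx => hf x hx)

end eigv
end GM

namespace GM

lemma ext_of_moments {n : ℕ} {μ μ' : Measure (Fin n → ℝ)} [IsFiniteMeasure μ] [IsFiniteMeasure μ']
    (h : ∀ c : ℝ, Integrable (fun x => Real.exp (c * ‖x‖)) μ) (h' : ∀ c : ℝ, Integrable (fun x => Real.exp (c * ‖x‖)) μ')
    (hm : ∀ (t : Fin n → ℝ) (k : ℕ), ∫ x, ((∑ i, (t i : ℂ) * x i))^k ∂μ = ∫ x, ((∑ i, (t i : ℂ) * x i))^k ∂μ') : μ = μ' := by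
  refine Measure.ext_of_charFunDual (funext fun L => ?_)
  rw [charFunDual_apply, charFunDual_apply]
  have hL : ∀ x : Fin n → ℝ, ((L x : ℝ) : ℂ) = ∑ i, ((L (Pi.single i 1) : ℝ) : ℂ) * x i := by
    intro x
    have : x = ∑ i, x i • (Pi.single i 1 : Fin n → ℝ) := by
      ext j; simp [Finset.sum_apply, Pi.single_apply]
    conv_lhs => rw [this, map_sum]
    push_cast
    refine Finset.sum_congr rfl fun i _ => ?_
    rw [map_smul, smul_eq_mul]; push_cast; ring
  have key : ∀ κ : Measure (Fin n → ℝ), IsFiniteMeasure κ → (∀ c : ℝ, Integrable (fun x => Real.exp (c * ‖x‖)) κ) →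
      HasSum (fun k : ℕ => ((Nat.factorial k : ℂ)⁻¹ * Complex.I^k) * ∫ x, ((L x : ℝ) : ℂ)^k ∂κ) (∫ x, Complex.exp (L x * Complex.I) ∂κ) := by
    intro κ _ hκ
    have hb : ∀ (k : ℕ) x, ‖((Nat.factorial k : ℂ)⁻¹ * Complex.I^k) * ((L x : ℝ) : ℂ)^k‖ = (‖L x‖)^k / Nat.factorial k := by
      intro k x
      simp only [norm_mul, norm_inv, norm_pow, Complex.norm_natCast, Complex.norm_I, one_pow, mul_one, Complex.norm_real]
      rw [div_eq_inv_mul]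
    have hexp : ∀ x, Real.exp ‖L x‖ ≤ Real.exp (‖L‖ * ‖x‖) := fun x => Real.exp_le_exp.2 (L.le_opNorm x)
    have hmx : Integrable (fun x => Real.exp ‖L x‖) κ := by
      refine (hκ ‖L‖).mono' (Continuous.aestronglyMeasurable (by fun_prop)) (Filter.Eventually.of_forall fun x => ?_)
      rw [Real.norm_of_nonneg (Real.exp_pos _).le]; exact hexp x
    have hintg : ∀ k : ℕ, Integrable (fun x => ((Nat.factorial k : ℂ)⁻¹ * Complex.I^k) * ((L x : ℝ) : ℂ)^k) κ := by
      intro k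
      refine hmx.mono' (Continuous.aestronglyMeasurable (by fun_prop)) (Filter.Eventually.of_forall fun x => ?_)
      rw [hb]
      exact Real.pow_div_factorial_le_exp _ (norm_nonneg _) k
    have hs : Summable fun k : ℕ => ∫ x, ‖((Nat.factorial k : ℂ)⁻¹ * Complex.I^k) * ((L x : ℝ) : ℂ)^k‖ ∂κ := by
      refine summable_of_sum_range_le (c := ∫ x, Real.exp ‖L x‖ ∂κ) (fun k => integral_nonneg fun x => norm_nonneg _) fun N => ?_
      rw [← integral_finsetSum _ fun k _ => (hintg k).norm]
      refine integral_mono (integrable_finsetSum _ fun k _ => (hintg k).norm) hmx fun x => ?_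
      simp only [hb]
      exact Real.sum_le_exp_of_nonneg (norm_nonneg _) N
    have := hasSum_integral_of_summable_integral_norm hintg hs
    simp only [integral_const_mul] at this
    have he : ∀ x : Fin n → ℝ, Complex.exp (L x * Complex.I) = ∑' i : ℕ, (Nat.factorial i : ℂ)⁻¹ * Complex.I ^ i * (L x : ℂ) ^ i := by
      intro x
      rw [Complex.exp_eq_exp_ℂ, NormedSpace.exp_eq_tsum_div]
      refine tsum_congr fun k => ?_
      rw [mul_pow]; field_simp
    simp only [he]
    exact this
  have h1 := key μ inferInstance h
  have h2 := key μ' inferInstance h'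
  have : ∀ k : ℕ, ∫ x, ((L x : ℝ) : ℂ)^k ∂μ = ∫ x, ((L x : ℝ) : ℂ)^k ∂μ' := by
    intro k
    have := hm (fun i => L (Pi.single i 1)) k
    have e : ∀ κ : Measure (Fin n → ℝ), ∫ x, ((L x : ℝ) : ℂ)^k ∂κ = ∫ x, ((∑ i, ((L (Pi.single i 1) : ℝ) : ℂ) * x i))^k ∂κ :=
      fun κ => integral_congr_ae (Filter.Eventually.of_forall fun x => congrArg (fun z => z^k) (hL x))
    rw [e, e]
    exact this
  simp only [this] at h1
  exact h1.unique h2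

section loc
attribute [local instance] Matrix.normedAddCommGroup Matrix.normedSpace
variable {n : ℕ}

lemma norm_eig_le (M : HM n) : ‖eig M‖ ≤ n * ‖M‖ := by
  have h1 : qE (eig M) = qM M := by
    have h := trp_eq M 2
    have h2 := congrArg Complex.re h
    rw [trp, pow_two] at h2
    rw [qM, h2, pps, Complex.re_sum, qE]
    refine Finset.sum_congr rfl fun i _ => ?_
    norm_cast
  have h2 := norm_sq_le_qE (eig M)
  rw [h1, qM_eq] at h2
  have h3 : ∑ i, ∑ j, ‖(M : Matrix (Fin n) (Fin n) ℂ) i j‖^2 ≤ (n * ‖M‖)^2 := by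
    calc _ ≤ ∑ i : Fin n, ∑ j : Fin n, ‖M‖^2 := by
          gcongr with i _ j _
          exact Matrix.norm_entry_le_entrywise_sup_norm (M : Matrix (Fin n) (Fin n) ℂ)
      _ = _ := by simp; ring
  exact (pow_le_pow_iff_left₀ (norm_nonneg _) (by positivity) two_ne_zero).1 (h2.trans h3)

lemma integrable_exp_eig (ν : Measure (HM n)) [ν.IsAddHaarMeasure] (c : ℝ) : Integrable (fun M => Real.exp (c * ‖eig M‖) * Real.exp (- qM M)) ν := by
  have h := integrable_gauss (μ := ν) continuous_qM norm_sq_le_qM (|c| * n)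
  refine h.mono' ?_ (Filter.Eventually.of_forall fun M => ?_)
  · refine (Measurable.mul ?_ ?_).aestronglyMeasurable
    · exact Real.measurable_exp.comp ((measurable_eig.norm).const_mul c)
    · exact (Real.continuous_exp.comp continuous_qM.neg).measurable
  · rw [Real.norm_of_nonneg (by positivity)]
    refine mul_le_mul_of_nonneg_right (Real.exp_le_exp.2 ?_) (Real.exp_pos _).le
    calc _ ≤ |c| * ‖eig M‖ := by gcongr; exact le_abs_self c
      _ ≤ |c| * (n * ‖M‖) := by gcongr; exact norm_eig_le M
      _ = _ := by ring

end loc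

section main
variable {n : ℕ}

/-- the hypothesis on P -/
def IsGUE (P : Measure (HM n)) : Prop := ∃ ν : Measure (HM n), ν.IsAddHaarMeasure ∧ ∃ c : ℝ≥0∞, P = c • ν.withDensity (fun M => ENNReal.ofReal (Real.exp (-qM M)))

lemma meas_dens : Measurable (fun M : HM n => ENNReal.ofReal (Real.exp (-qM M))) := by
  have : Continuous (qM (n := n)) := continuous_qM
  exact (Real.continuous_exp.comp this.neg).measurable.ennreal_ofReal

lemma int_GUE {ν : Measure (HM n)} {c : ℝ≥0∞} {P : Measure (HM n)} (hP : P = c • ν.withDensity (fun M => ENNReal.ofReal (Real.exp (-qM M)))) (f : HM n → ℂ) :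
    ∫ M, f M ∂P = c.toReal * ∫ M, f M * (Real.exp (-qM M) : ℂ) ∂ν := by
  rw [hP, integral_smul_measure, integral_withDensity_eq_integral_toReal_smul meas_dens (by simp)]
  simp only [ENNReal.toReal_ofReal (Real.exp_pos _).le, Complex.real_smul]
  simp only [mul_comm]

lemma Loop.smul {E : Multiset ℕ → ℂ} (h : Loop n E) (c : ℂ) : Loop n (fun s => c * E s) := by
  constructor
  · intro s; simp only [h.1]; ring
  · intro k s
    have := h.2 k s
    simp only [← Finset.mul_sum]
    rw [mul_left_comm, this, mul_add, ← Multiset.sum_map_mul_left]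
    congr 3
    ext q; ring

lemma rho_meas : Measurable (fun x : Fin n → ℝ => ENNReal.ofReal (rho n x / n.factorial)) := by
  exact ((continuous_rho n).measurable.div_const _).ennreal_ofReal

lemma int_Pn : ∃ c : ℝ, ∀ f : (Fin n → ℝ) → ℂ, ∫ x, f x ∂(Pn n) = c * ∫ x, f x * (WC x * (Real.exp (-qE x) : ℂ)) := by
  obtain ⟨c, hc⟩ := rho_top n
  refine ⟨c / n.factorial, fun f => ?_⟩
  rw [Pn, integral_withDensity_eq_integral_toReal_smul rho_meas (by simp), ← integral_const_mul]
  refine integral_congr_ae (Filter.Eventually.of_forall fun x => ?_)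
  simp only [ENNReal.toReal_ofReal (div_nonneg (rho_nonneg n x) (Nat.cast_nonneg _)), Complex.real_smul]
  simp only [WC_eq, hc, qE]
  push_cast; ring

lemma moments_eq {P : Measure (HM n)} [IsProbabilityMeasure P] (hP : IsGUE P) (s : Multiset ℕ) :
    ∫ M, Pps s (eig M) ∂P = ∫ x, Pps s x ∂(Pn n) := by
  obtain ⟨ν, hν, c, hc⟩ := hP
  obtain ⟨d, hd⟩ := int_Pn (n := n)
  have h1 : Loop n (fun s => ∫ M, Pps s (eig M) ∂P) := by
    simp only [int_GUE hc, ← Ptr_eq]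
    exact (loop_matrix (ν := ν)).smul _
  have h2 : Loop n (fun s => ∫ x, Pps s x ∂(Pn n)) := by
    simp only [hd]
    exact loop_eig.smul _
  exact congrFun (h1.unique h2 (by simp [Pps])) s

lemma exp_P {P : Measure (HM n)} [IsProbabilityMeasure P] (hP : IsGUE P) (c : ℝ) : Integrable (fun M => Real.exp (c * ‖eig M‖)) P := by
  obtain ⟨ν, hν, d, hd⟩ := hP
  have h1 := int_GUE hd (fun _ => 1)
  have hd' : d ≠ ∞ := by
    rintro rfl
    simp at h1
  rw [hd]
  refine Integrable.smul_measure ?_ hd'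
  rw [integrable_withDensity_iff_integrable_smul' meas_dens (by simp)]
  simp only [ENNReal.toReal_ofReal (Real.exp_pos _).le, smul_eq_mul]
  simpa only [mul_comm] using integrable_exp_eig ν c

lemma exp_Pn (c : ℝ) : Integrable (fun x => Real.exp (c * ‖x‖)) (Pn n) := by
  obtain ⟨d, hd⟩ := rho_top n
  rw [Pn, integrable_withDensity_iff_integrable_smul' rho_meas (by simp)]
  have hE : EB (fun x : Fin n → ℝ => ((Real.exp (c * ‖x‖) : ℝ) : ℂ)) := by
    refine ⟨by fun_prop, 1, |c|, by norm_num, abs_nonneg _, fun x => ?_⟩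
    rw [Complex.norm_real, Real.norm_of_nonneg (Real.exp_pos _).le, one_mul]
    gcongr; exact le_abs_self c
  have h := (int_e (hE.mul EB_WC)).const_mul ((d / n.factorial : ℝ) : ℂ)
  have h2 := h.re
  refine h2.congr (Filter.Eventually.of_forall fun x => ?_)
  simp only [ENNReal.toReal_ofReal (div_nonneg (rho_nonneg n x) (Nat.cast_nonneg _)), smul_eq_mul]
  simp only [WC_eq, hd, qE]
  rw [RCLike.re_eq_complex_re]
  norm_cast
  ring

/-- symmetrisation -/
noncomputable def symm (μ : Measure (Fin n → ℝ)) : Measure (Fin n → ℝ) := ∑ σ : Equiv.Perm (Fin n), μ.map (fun x => x ∘ σ)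

lemma meas_comp (σ : Equiv.Perm (Fin n)) : Measurable (fun x : Fin n → ℝ => x ∘ σ) := measurable_pi_iff.2 fun i => measurable_pi_apply (σ i)

lemma lintegral_symm (μ : Measure (Fin n → ℝ)) {f : (Fin n → ℝ) → ℝ≥0∞} (hf : Measurable f) (hs : ∀ (σ : Equiv.Perm (Fin n)) x, f (x ∘ σ) = f x) :
    ∫⁻ x, f x ∂(symm μ) = n.factorial * ∫⁻ x, f x ∂μ := by
  rw [symm, lintegral_finsetSum_measure]
  simp only [lintegral_map hf (meas_comp _), hs]
  simp [Fintype.card_perm]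

instance (μ : Measure (Fin n → ℝ)) [IsFiniteMeasure μ] : IsFiniteMeasure (symm μ) := by
  unfold symm; infer_instance

lemma exp_symm {μ : Measure (Fin n → ℝ)} (h : ∀ c : ℝ, Integrable (fun x => Real.exp (c * ‖x‖)) μ) (c : ℝ) : Integrable (fun x => Real.exp (c * ‖x‖)) (symm μ) := by
  rw [symm, integrable_finsetSum_measure]
  intro σ _
  rw [integrable_map_measure (Continuous.aestronglyMeasurable (by fun_prop)) (meas_comp σ).aemeasurable]
  refine (h c).congr (Filter.Eventually.of_forall fun x => ?_)
  have : ‖x ∘ σ‖ = ‖x‖ := by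
    refine le_antisymm ((pi_norm_le_iff_of_nonneg (norm_nonneg _)).2 fun i => norm_le_pi_norm x (σ i)) ((pi_norm_le_iff_of_nonneg (norm_nonneg _)).2 fun i => ?_)
    have := norm_le_pi_norm (x ∘ σ) (σ.symm i)
    simpa using this
  show Real.exp (c * ‖x‖) = Real.exp (c * ‖x ∘ σ‖)
  rw [this]


lemma EB.le_exp {f : (Fin n → ℝ) → ℂ} (hf : EB f) {α : Type*} [MeasurableSpace α] {μ : Measure α} {g : α → Fin n → ℝ} (hg : Measurable g)
    (h : ∀ c : ℝ, Integrable (fun x => Real.exp (c * ‖g x‖)) μ) : Integrable (fun x => f (g x)) μ := by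
  obtain ⟨hc, C, c, hC, hc0, hb⟩ := hf
  exact ((h c).const_mul C).mono' (hc.measurable.comp hg).aestronglyMeasurable (Filter.Eventually.of_forall fun x => hb _)

lemma EB_eval (p : MvPolynomial (Fin n) ℂ) : EB (fun x : Fin n → ℝ => MvPolynomial.eval (fun i => (x i : ℂ)) p) := by
  induction p using MvPolynomial.induction_on with
  | C a => simpa using EB.const a
  | add p q hp hq => simpa using hp.add hq
  | mul_X p i hp => simpa using hp.mul (EB_coord i)

lemma sym_moments {P : Measure (HM n)} [IsProbabilityMeasure P] (hP : IsGUE P) {p : MvPolynomial (Fin n) ℂ} (hp : p.IsSymmetric) :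
    ∫ M, MvPolynomial.eval (fun i => (eig M i : ℂ)) p ∂P = ∫ x, MvPolynomial.eval (fun i => (x i : ℂ)) p ∂(Pn n) := by
  have i1 : ∀ p : MvPolynomial (Fin n) ℂ, Integrable (fun M : HM n => MvPolynomial.eval (fun i => (eig M i : ℂ)) p) P :=
    fun p => (EB_eval p).le_exp measurable_eig (exp_P hP)
  have i2 : ∀ p : MvPolynomial (Fin n) ℂ, Integrable (fun x : Fin n → ℝ => MvPolynomial.eval (fun i => (x i : ℂ)) p) (Pn n) :=
    fun p => (EB_eval p).le_exp measurable_id exp_Pn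
  have h := sym_mem_span hp
  clear hp
  induction h using Submodule.span_induction with
  | mem p h =>
    obtain ⟨s, rfl⟩ := h
    have e : ∀ x : Fin n → ℝ, MvPolynomial.eval (fun i => (x i : ℂ)) ((s.map fun q => MvPolynomial.psum (Fin n) ℂ q).prod) = Pps s x := by
      intro x
      rw [map_multiset_prod, Multiset.map_map, Pps]
      congr 1
      refine Multiset.map_congr rfl fun q _ => ?_
      simp [MvPolynomial.psum, pps]
    simp only [e]
    exact moments_eq hP s
  | zero => simp
  | add p q _ _ h1 h2 =>
    simp only [map_add]
    rw [integral_add (i1 p) (i1 q), integral_add (i2 p) (i2 q), h1, h2]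
  | smul a p _ h1 =>
    simp only [MvPolynomial.smul_eval]
    rw [integral_const_mul, integral_const_mul, h1]

lemma symm_eq {P : Measure (HM n)} [IsProbabilityMeasure P] (hP : IsGUE P) : symm (P.map eig) = symm (Pn n) := by
  have hE : ∀ c : ℝ, Integrable (fun x => Real.exp (c * ‖x‖)) (P.map eig) := by
    intro c
    rw [integrable_map_measure (Continuous.aestronglyMeasurable (by fun_prop)) measurable_eig.aemeasurable]
    exact exp_P hP c
  refine ext_of_moments (exp_symm hE) (exp_symm exp_Pn) fun t k => ?_
  set p : MvPolynomial (Fin n) ℂ := ∑ σ : Equiv.Perm (Fin n), (∑ i, MvPolynomial.C (t i : ℂ) * MvPolynomial.X (σ i))^k with hp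
  have hps : p.IsSymmetric := by
    intro τ
    rw [hp, map_sum]
    simp only [map_pow, map_sum, map_mul, MvPolynomial.rename_C, MvPolynomial.rename_X]
    exact Fintype.sum_equiv (Equiv.mulLeft τ) _ _ fun σ => rfl
  have key : ∀ μ : Measure (Fin n → ℝ), (∀ c : ℝ, Integrable (fun x => Real.exp (c * ‖x‖)) μ) →
      ∫ x, ((∑ i, (t i : ℂ) * x i))^k ∂(symm μ) = ∫ x, MvPolynomial.eval (fun i => (x i : ℂ)) p ∂μ := by
    intro μ hμ
    have hEB : EB (fun x : Fin n → ℝ => (∑ i, (t i : ℂ) * x i)^k) := (EB.sum _ fun i _ => (EB.const _).mul (EB_coord i)).pow k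
    rw [symm, integral_finsetSum_measure]
    · have : ∀ x : Fin n → ℝ, MvPolynomial.eval (fun i => (x i : ℂ)) p = ∑ σ : Equiv.Perm (Fin n), (∑ i, (t i : ℂ) * (x ∘ σ) i)^k := by
        intro x
        simp [hp]
      simp only [this]
      rw [integral_finsetSum]
      · refine Finset.sum_congr rfl fun σ _ => ?_
        rw [integral_map (meas_comp σ).aemeasurable hEB.1.aestronglyMeasurable]
      · intro σ _
        have h2 : EB (fun x : Fin n → ℝ => (∑ i, (t i : ℂ) * (x ∘ σ) i)^k) := (EB.sum _ fun i _ => (EB.const _).mul (EB_coord (σ i))).pow k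
        exact h2.le_exp measurable_id hμ
    · intro σ _
      rw [integrable_map_measure hEB.1.aestronglyMeasurable (meas_comp σ).aemeasurable]
      have h2 : EB (fun x : Fin n → ℝ => (∑ i, (t i : ℂ) * (x ∘ σ) i)^k) := (EB.sum _ fun i _ => (EB.const _).mul (EB_coord (σ i))).pow k
      exact h2.le_exp measurable_id hμ
  rw [key _ hE, key _ exp_Pn, integral_map measurable_eig.aemeasurable (EB_eval p).1.aestronglyMeasurable]
  exact sym_moments hP hps

/-- law of symmetric functions of eigenvalues -/
theorem eig_law {P : Measure (HM n)} [IsProbabilityMeasure P] (hP : IsGUE P) {f : (Fin n → ℝ) → ℝ≥0∞} (hf : Measurable f)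
    (hs : ∀ (σ : Equiv.Perm (Fin n)) x, f (x ∘ σ) = f x) : ∫⁻ M, f (eig M) ∂P = ∫⁻ x, f x ∂(Pn n) := by
  have h1 := lintegral_symm (P.map eig) hf hs
  have h2 := lintegral_symm (Pn n) hf hs
  rw [symm_eq hP, h2, lintegral_map hf measurable_eig] at h1
  exact ((ENNReal.mul_right_inj (by exact_mod_cast n.factorial_ne_zero) (ENNReal.natCast_ne_top _)).1 h1).symm

end main
end GM

namespace GM

lemma pow_eq_stirling (x k : ℕ) : x^k = ∑ j ∈ Finset.range (k+1), Nat.stirlingSecond k j * x.descFactorial j := by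
  induction k with
  | zero => simp
  | succ k ih =>
    have h1 : ∀ j, x * x.descFactorial j = x.descFactorial (j+1) + j * x.descFactorial j := by
      intro j
      rw [Nat.descFactorial_succ, ← add_mul]
      by_cases h : j ≤ x
      · rw [Nat.sub_add_cancel h]
      · rw [Nat.descFactorial_eq_zero_iff_lt.2 (not_le.1 h)]; simp
    rw [pow_succ, ih, mul_comm, Finset.mul_sum, Finset.sum_range_succ' _ (k+1)]
    have h3 : ∀ j, Nat.stirlingSecond (k+1) (j+1) * x.descFactorial (j+1) = (j+1) * Nat.stirlingSecond k (j+1) * x.descFactorial (j+1) + Nat.stirlingSecond k j * x.descFactorial (j+1) := fun j => by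
      rw [Nat.stirlingSecond_succ_succ]; ring
    simp only [Nat.stirlingSecond_succ_zero, zero_mul, add_zero, h3]
    rw [Finset.sum_add_distrib]
    have h2 : ∑ j ∈ Finset.range (k+1), (j+1) * Nat.stirlingSecond k (j+1) * x.descFactorial (j+1) = ∑ j ∈ Finset.range (k+1), j * Nat.stirlingSecond k j * x.descFactorial j := by
      have := Finset.sum_range_succ' (fun j => j * Nat.stirlingSecond k j * x.descFactorial j) (k+1)
      rw [Finset.sum_range_succ, Nat.stirlingSecond_eq_zero_of_lt (Nat.lt_succ_self k)] at this
      simpa using this.symm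
    rw [h2, ← Finset.sum_add_distrib]
    refine Finset.sum_congr rfl fun j _ => ?_
    rw [mul_left_comm, h1]; ring

lemma hasSum_poisson_desc (μ : ℝ) (j : ℕ) : HasSum (fun m : ℕ => (m.descFactorial j : ℝ) * Real.exp (-μ) * μ^m / (m.factorial : ℝ)) (μ^j) := by
  have h : HasSum (fun m : ℕ => Real.exp (-μ) * μ^j * (μ^m / (m.factorial : ℝ))) (Real.exp (-μ) * μ^j * Real.exp μ) := by
    have := (NormedSpace.expSeries_div_hasSum_exp μ)
    rw [← Real.exp_eq_exp_ℝ] at this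
    exact this.mul_left _
  have e : Real.exp (-μ) * μ^j * Real.exp μ = μ^j := by
    rw [mul_right_comm, ← Real.exp_add]; simp
  rw [e] at h
  rw [← hasSum_nat_add_iff' j]
  have hz : ∑ i ∈ Finset.range j, ((i.descFactorial j : ℕ) : ℝ) * Real.exp (-μ) * μ^i / (i.factorial : ℝ) = 0 := by
    refine Finset.sum_eq_zero fun i hi => ?_
    rw [Nat.descFactorial_eq_zero_iff_lt.2 (Finset.mem_range.1 hi)]; simp
  rw [hz, sub_zero]
  refine Eq.mp (congrArg (fun f : ℕ → ℝ => HasSum f (μ^j)) (funext fun m => ?_)) h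
  have h1 : (m + j).factorial = m.factorial * (m+j).descFactorial j := by
    have := Nat.factorial_mul_descFactorial (Nat.le_add_left j m)
    rw [← this, Nat.add_sub_cancel]
  have h2 : ((m+j).factorial : ℝ) = m.factorial * (m+j).descFactorial j := by exact_mod_cast h1
  have h3 : ((m+j).descFactorial j : ℝ) ≠ 0 := by
    have := Nat.factorial_ne_zero (m+j)
    rw [h1] at this
    exact_mod_cast right_ne_zero_of_mul this
  rw [h2]
  field_simp
  ring

lemma poisson_moment (μ : ℝ) (k : ℕ) : ∑' m : ℕ, (m : ℝ) ^ k * Real.exp (-μ) * μ ^ m / (m.factorial : ℝ) =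
    ∑ j ∈ Finset.range (k+1), (Nat.stirlingSecond k j : ℝ) * μ^j := by
  have h := hasSum_sum (s := Finset.range (k+1)) (f := fun j (m : ℕ) => (Nat.stirlingSecond k j : ℝ) * ((m.descFactorial j : ℝ) * Real.exp (-μ) * μ^m / (m.factorial : ℝ)))
    fun j _ => (hasSum_poisson_desc μ j).mul_left _
  rw [← h.tsum_eq]
  refine tsum_congr fun m => ?_
  have := pow_eq_stirling m k
  have h2 : (m:ℝ)^k = ∑ j ∈ Finset.range (k+1), (Nat.stirlingSecond k j : ℝ) * (m.descFactorial j : ℝ) := by exact_mod_cast this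
  rw [h2, Finset.sum_mul, Finset.sum_mul, Finset.sum_div]
  refine Finset.sum_congr rfl fun j _ => by ring

section comb
variable {V : Type*} [Fintype V]

/-- edges of a relation -/
abbrev Ed (R : V → V → Prop) := {p : V × V // R p.1 p.2}

/-- disjoint j-tuples of edges -/
abbrev DT (R : V → V → Prop) (j : ℕ) := {e : Fin 2 × Fin j ↪ V // ∀ i, R (e (0,i)) (e (1,i))}

/-- cherries -/
abbrev Ch (R : V → V → Prop) := {e : Fin 3 ↪ V // (R (e 0) (e 1) ∨ R (e 1) (e 0)) ∧ (R (e 0) (e 2) ∨ R (e 2) (e 0))}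

/-- two edges share a vertex -/
def Sh (f g : V × V) : Prop := f.1 = g.1 ∨ f.2 = g.2 ∨ f.1 = g.2 ∨ f.2 = g.1

abbrev TT (R : V → V → Prop) := {f : Ed R × Ed R // f.1 ≠ f.2 ∧ Sh f.1.1 f.2.1}

variable {R : V → V → Prop}

lemma TT_le (hR : ∀ p q, R p q → ¬ R q p) : Nat.card (TT R) ≤ 4 * Nat.card (Ch R) := by
  classical
  have hirr : ∀ p, ¬ R p p := fun p h => hR p p h h
  let dec : Fin 4 × Ch R → (V × V) × (V × V) := fun z => match z.1 with
    | 0 => ((z.2.1 0, z.2.1 1), (z.2.1 0, z.2.1 2))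
    | 1 => ((z.2.1 1, z.2.1 0), (z.2.1 2, z.2.1 0))
    | 2 => ((z.2.1 0, z.2.1 1), (z.2.1 2, z.2.1 0))
    | 3 => ((z.2.1 1, z.2.1 0), (z.2.1 0, z.2.1 2))
  have mk : ∀ p q r : V, p ≠ q → p ≠ r → q ≠ r → (R p q ∨ R q p) → (R p r ∨ R r p) → ∃ e : Ch R, e.1 0 = p ∧ e.1 1 = q ∧ e.1 2 = r := by
    intro p q r h1 h2 h3 h4 h5
    refine ⟨⟨⟨![p,q,r], ?_⟩, ?_⟩, ?_⟩
    · intro i j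
      fin_cases i <;> fin_cases j <;> simp [h1, h2, h3, h1.symm, h2.symm, h3.symm]
    · exact ⟨h4, h5⟩
    · exact ⟨rfl, rfl, rfl⟩
  have hs : ∀ f : TT R, ∃ z, dec z = (f.1.1.1, f.1.2.1) := by
    rintro ⟨⟨⟨⟨p,q⟩,h1⟩,⟨⟨p',q'⟩,h2⟩⟩, hne, hsh⟩
    simp only [ne_eq, Subtype.mk.injEq, Prod.mk.injEq, not_and] at hne
    simp only at h1 h2
    have hpq : p ≠ q := fun h => hirr p (by rw [← h] at h1; exact h1)
    have hpq' : p' ≠ q' := fun h => hirr p' (by rw [← h] at h2; exact h2)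
    simp only [Sh] at hsh
    rcases hsh with h | h | h | h
    · subst h
      obtain ⟨e, e0, e1, e2⟩ := mk p q q' hpq hpq' (hne rfl) (Or.inl h1) (Or.inl h2)
      exact ⟨(0, e), by simp [dec, e0, e1, e2]⟩
    · subst h
      obtain ⟨e, e0, e1, e2⟩ := mk q p p' hpq.symm hpq'.symm (fun h => hne h rfl) (Or.inr h1) (Or.inr h2)
      exact ⟨(1, e), by simp [dec, e0, e1, e2]⟩
    · subst h
      obtain ⟨e, e0, e1, e2⟩ := mk p q p' hpq hpq'.symm (fun h => by subst h; exact hR _ _ h1 h2) (Or.inl h1) (Or.inr h2)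
      exact ⟨(2, e), by simp [dec, e0, e1, e2]⟩
    · subst h
      obtain ⟨e, e0, e1, e2⟩ := mk q p q' hpq.symm hpq' (fun h => by subst h; exact hR _ _ h1 h2) (Or.inr h1) (Or.inl h2)
      exact ⟨(3, e), by simp [dec, e0, e1, e2]⟩
  choose z hz using hs
  have hinj : Function.Injective z := by
    intro f g h
    have := hz f
    rw [h, hz g] at this
    simp only [Prod.mk.injEq] at this
    exact Subtype.ext (Prod.ext (Subtype.ext this.1.symm) (Subtype.ext this.2.symm))
  have := Nat.card_le_card_of_injective z hinj
  rwa [Nat.card_prod, Nat.card_eq_fintype_card (α := Fin 4), Fintype.card_fin] at this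

lemma desc_eq (j : ℕ) : (Nat.card (Ed R)).descFactorial j = Nat.card (Fin j ↪ Ed R) := by
  classical
  rw [Nat.card_eq_fintype_card, Nat.card_eq_fintype_card, Fintype.card_embedding_eq, Fintype.card_fin]

lemma desc_lower (j : ℕ) : Nat.card (DT R j) ≤ (Nat.card (Ed R)).descFactorial j := by
  classical
  rw [desc_eq]
  let F : DT R j → (Fin j ↪ Ed R) := fun e => ⟨fun i => ⟨(e.1 (0,i), e.1 (1,i)), e.2 i⟩, fun i k h => by
    simp only [Subtype.mk.injEq, Prod.mk.injEq] at h
    have := e.1.injective h.1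
    simpa using this⟩
  refine Nat.card_le_card_of_injective F fun e e' h => ?_
  refine Subtype.ext (DFunLike.ext _ _ ?_)
  rintro ⟨c, i⟩
  have := congrArg (fun f : Fin j ↪ Ed R => (f i).1) h
  have h1 := congrArg Prod.fst this
  have h2 := congrArg Prod.snd this
  fin_cases c
  · exact h1
  · exact h2

lemma pair_count {E : Type*} [Finite E] (j : ℕ) (i l : Fin j) (hil : i ≠ l) (Q : E × E → Prop) :
    Nat.card {f : Fin j → E // Q (f i, f l)} ≤ Nat.card {p : E × E // Q p} * Nat.card E ^ (j-2) := by
  classical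
  have h : Nat.card {m : Fin j // m ≠ i ∧ m ≠ l} = j - 2 := by
    rw [Nat.card_eq_fintype_card, Fintype.card_subtype]
    have : (Finset.univ.filter fun m : Fin j => m ≠ i ∧ m ≠ l) = Finset.univ \ {i, l} := by
      ext m; simp
    rw [this, Finset.card_sdiff_of_subset (Finset.subset_univ _), Finset.card_pair hil, Finset.card_univ, Fintype.card_fin]
  rw [← h, ← Nat.card_fun, ← Nat.card_prod]
  refine Nat.card_le_card_of_injective (fun f => (⟨(f.1 i, f.1 l), f.2⟩, fun m => f.1 m.1)) fun f g hfg => ?_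
  simp only [Prod.mk.injEq, Subtype.mk.injEq] at hfg
  refine Subtype.ext (funext fun m => ?_)
  by_cases h1 : m = i
  · rw [h1]; exact hfg.1.1
  by_cases h2 : m = l
  · rw [h2]; exact hfg.1.2
  exact congrFun hfg.2 ⟨m, h1, h2⟩

lemma desc_upper (hirr : ∀ p, ¬ R p p) (j : ℕ) : (Nat.card (Ed R)).descFactorial j ≤ Nat.card (DT R j) + j * j * (Nat.card (TT R) * Nat.card (Ed R) ^ (j-2)) := by
  classical
  rw [desc_eq]
  let Y := {p : Fin j × Fin j // p.1 ≠ p.2}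
  let Z := Σ p : Y, {f : Fin j → Ed R // (f p.1.1 ≠ f p.1.2 ∧ Sh (f p.1.1).1 (f p.1.2).1)}
  have hF : ∀ f : Fin j ↪ Ed R, ∃ z : DT R j ⊕ Z, (∀ e, z = Sum.inl e → ∀ i, e.1 (0,i) = (f i).1.1 ∧ e.1 (1,i) = (f i).1.2) ∧ (∀ w, z = Sum.inr w → w.2.1 = f) := by
    intro f
    by_cases h : ∃ p : Y, Sh (f p.1.1).1 (f p.1.2).1
    · obtain ⟨p, hp⟩ := h
      refine ⟨Sum.inr ⟨p, ⟨f, fun h => p.2 (f.injective h), hp⟩⟩, by simp, ?_⟩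
      rintro w hw
      rw [← Sum.inr_injective hw]
    · push Not at h
      have hd : ∀ i, (f i).1.1 ≠ (f i).1.2 := fun i hi => hirr (f i).1.1 (by have := (f i).2; rwa [← hi] at this)
      refine ⟨Sum.inl ⟨⟨fun p => if p.1 = 0 then (f p.2).1.1 else (f p.2).1.2, ?_⟩, ?_⟩, ?_, by simp⟩
      · rintro ⟨c, i⟩ ⟨d, k⟩ hh
        by_cases hik : i = k
        · subst hik
          simp only [Prod.mk.injEq, and_true]
          fin_cases c <;> fin_cases d <;> simp [hd, (hd _).symm] at hh ⊢
        · exfalso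
          have := h ⟨(i,k), hik⟩
          simp only [Sh, not_or] at this
          fin_cases c <;> fin_cases d <;> simp [this] at hh
      · intro i; exact (f i).2
      · rintro e he
        rw [← Sum.inl_injective he]
        intro i; exact ⟨rfl, rfl⟩
  choose z hz1 hz2 using hF
  have hinj : Function.Injective z := by
    intro f g h
    cases hzf : z f with
    | inl e =>
      have h1 := hz1 f e hzf
      have h2 := hz1 g e (h ▸ hzf)
      ext i : 1
      refine Subtype.ext (Prod.ext ((h1 i).1.symm.trans (h2 i).1) ((h1 i).2.symm.trans (h2 i).2))
    | inr w =>
      have h1 := hz2 f w hzf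
      have h2 := hz2 g w (h ▸ hzf)
      exact DFunLike.coe_injective (h1.symm.trans h2)
  have h1 := Nat.card_le_card_of_injective z hinj
  rw [Nat.card_sum] at h1
  refine h1.trans (Nat.add_le_add_left ?_ _)
  rw [Nat.card_sigma]
  calc _ ≤ ∑ p : Y, Nat.card (TT R) * Nat.card (Ed R) ^ (j-2) := Finset.sum_le_sum fun p _ => pair_count j p.1.1 p.1.2 p.2 (fun f : Ed R × Ed R => f.1 ≠ f.2 ∧ Sh f.1.1 f.2.1)
    _ = Fintype.card Y * (Nat.card (TT R) * Nat.card (Ed R) ^ (j-2)) := by simp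
    _ ≤ _ := by
      refine Nat.mul_le_mul_right _ ?_
      have := Fintype.card_subtype_le (fun p : Fin j × Fin j => p.1 ≠ p.2)
      rwa [Fintype.card_prod, Fintype.card_fin] at this

end comb
end GM

namespace GM

def Bp (γ a b s t : ℝ) : Prop := 0 < s - t ∧ s - t ≤ γ ∧ (s + t)/2 ∈ Set.Icc a b
def Ap (γ a b s t : ℝ) : Prop := |s - t| ≤ γ ∧ (s + t)/2 ∈ Set.Icc a b

open Classical in
noncomputable def ind (p : Prop) : ℝ≥0∞ := if p then 1 else 0

lemma ind_le_one (p : Prop) : ind p ≤ 1 := by unfold ind; split_ifs <;> simp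
lemma ind_mono {p q : Prop} (h : p → q) : ind p ≤ ind q := by
  unfold ind; split_ifs with h1 h2
  · exact le_rfl
  · exact absurd (h h1) h2
  · simp
  · simp
lemma ind_false {p : Prop} (h : ¬ p) : ind p = 0 := by simp [ind, h]
lemma ind_true {p : Prop} (h : p) : ind p = 1 := by simp [ind, h]
lemma ind_or {p q : Prop} : ind (p ∨ q) ≤ ind p + ind q := by
  unfold ind; split_ifs <;> simp_all
lemma ind_and {p q : Prop} : ind (p ∧ q) = ind p * ind q := by
  unfold ind; split_ifs <;> simp_all
lemma measurable_ind {α : Type*} [MeasurableSpace α] {p : α → Prop} (h : MeasurableSet {x | p x}) : Measurable (fun x => ind (p x)) := by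
  unfold ind
  exact Measurable.ite h measurable_const measurable_const

lemma Bp_Ap {γ a b s t : ℝ} (h : Bp γ a b s t) : Ap γ a b s t := by
  obtain ⟨h1, h2, h3⟩ := h
  exact ⟨by rw [abs_of_pos h1]; exact h2, h3⟩
lemma Ap_symm {γ a b s t : ℝ} (h : Ap γ a b s t) : Ap γ a b t s := by
  unfold Ap at *
  rw [abs_sub_comm, add_comm]; exact h

section meas
variable {α : Type*} [MeasurableSpace α] {f g : α → ℝ} (γ a b : ℝ)
lemma measurableSet_Bp (hf : Measurable f) (hg : Measurable g) : MeasurableSet {x | Bp γ a b (f x) (g x)} := by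
  unfold Bp
  refine (measurableSet_lt measurable_const (hf.sub hg)).inter ((measurableSet_le (hf.sub hg) measurable_const).inter ?_)
  exact ((hf.add hg).div_const 2) measurableSet_Icc
lemma measurableSet_Ap (hf : Measurable f) (hg : Measurable g) : MeasurableSet {x | Ap γ a b (f x) (g x)} := by
  unfold Ap
  refine (measurableSet_le (hf.sub hg).abs measurable_const).inter ?_
  exact ((hf.add hg).div_const 2) measurableSet_Icc
end meas

/-- number of close pairs -/
noncomputable def GG (γ a b : ℝ) {n : ℕ} (x : Fin n → ℝ) : ℕ := Nat.card (Ed (fun p q : Fin n => Bp γ a b (x p) (x q)))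

lemma card_ind {α : Type*} [Fintype α] (p : α → Prop) : ((Nat.card {x // p x} : ℕ) : ℝ≥0∞) = ∑ x, ind (p x) := by
  classical
  rw [Nat.card_eq_fintype_card, Fintype.card_subtype, Finset.card_filter]
  push_cast
  refine Finset.sum_congr rfl fun x _ => ?_
  unfold ind
  congr

lemma GG_eq (γ a b : ℝ) {n : ℕ} (x : Fin n → ℝ) : (GG γ a b x : ℝ≥0∞) = ∑ p, ∑ q, ind (Bp γ a b (x p) (x q)) := by
  rw [GG, card_ind, Fintype.sum_prod_type]

lemma measurable_GG (γ a b : ℝ) {n : ℕ} : Measurable (fun x : Fin n → ℝ => (GG γ a b x : ℝ≥0∞)) := by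
  simp only [GG_eq]
  refine Finset.measurable_sum _ fun p _ => Finset.measurable_sum _ fun q _ => measurable_ind ?_
  exact measurableSet_Bp γ a b (measurable_pi_apply p) (measurable_pi_apply q)

lemma SS_card {ι : Type*} [Fintype ι] [DecidableEq ι] {n : ℕ} (Q : (ι → ℝ) → Prop) (x : Fin n → ℝ) :
    ((Nat.card {e : ι ↪ Fin n // Q (x ∘ e)} : ℕ) : ℝ≥0∞) = SS n (fun y => ind (Q y)) x := by
  rw [card_ind, SS]

open Classical in
lemma SS_succ {n m : ℕ} (H : (Fin (m+1) → ℝ) → ℝ≥0∞) (x : Fin n → ℝ) :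
    SS n H x = ∑ e : Fin m ↪ Fin n, ∑ p : {p : Fin n // p ∉ Set.range e}, H (Fin.cons (x p) (x ∘ e)) := by
  rw [SS, ← (Equiv.embeddingFinSucc m (Fin n)).symm.sum_comp, ← Finset.univ_sigma_univ, Finset.sum_sigma]
  refine Finset.sum_congr rfl fun e _ => Finset.sum_congr rfl fun p _ => ?_
  rw [Equiv.coe_embeddingFinSucc_symm]
  congr 1
  funext i
  refine Fin.cases ?_ (fun i => ?_) i
  · simp
  · simp

open Classical in
lemma sum_split {n m : ℕ} (e : Fin m ↪ Fin n) (f : Fin n → ℝ≥0∞) :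
    ∑ p, f p = ∑ l, f (e l) + ∑ p : {p : Fin n // p ∉ Set.range e}, f p := by
  rw [← Fintype.sum_subtype_add_sum_subtype (fun p => p ∈ Set.range e) f]
  congr 1
  rw [Subsingleton.elim (Subtype.fintype fun p => p ∈ Set.range e) (Set.fintypeRange e)]
  exact (Fintype.sum_equiv (Equiv.ofInjective e e.injective) (fun l => f (e l)) (fun p : {p // p ∈ Set.range e} => f p) fun l => rfl).symm

/-- `F` times a new pair -/
noncomputable def F2 (γ a b : ℝ) {m : ℕ} (F : (Fin m → ℝ) → ℝ≥0∞) (z : Fin (m+2) → ℝ) : ℝ≥0∞ :=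
  F (Fin.tail (Fin.tail z)) * ind (Bp γ a b (z 1) (z 0))
/-- `F` times a new point attached to the l-th -/
noncomputable def F1 (γ a b : ℝ) {m : ℕ} (F : (Fin m → ℝ) → ℝ≥0∞) (l : Fin m) (z : Fin (m+1) → ℝ) : ℝ≥0∞ :=
  F (Fin.tail z) * ind (Ap γ a b (z 0) (Fin.tail z l))

lemma measurable_tail {m : ℕ} : Measurable (fun z : Fin (m+1) → ℝ => (Fin.tail z : Fin m → ℝ)) :=
  measurable_pi_lambda _ fun i => measurable_pi_apply _

lemma measurable_F2 (γ a b : ℝ) {m : ℕ} {F : (Fin m → ℝ) → ℝ≥0∞} (hF : Measurable F) : Measurable (F2 γ a b F) := by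
  unfold F2
  exact (hF.comp (measurable_tail.comp measurable_tail)).mul (measurable_ind (measurableSet_Bp _ _ _ (measurable_pi_apply _) (measurable_pi_apply _)))

lemma measurable_F1 (γ a b : ℝ) {m : ℕ} {F : (Fin m → ℝ) → ℝ≥0∞} (hF : Measurable F) (l : Fin m) : Measurable (F1 γ a b F l) := by
  unfold F1
  exact (hF.comp measurable_tail).mul (measurable_ind (measurableSet_Ap _ _ _ (measurable_pi_apply _) ((measurable_pi_apply l).comp measurable_tail)))

open Classical in
lemma SS_step (γ a b : ℝ) {n m : ℕ} (F : (Fin m → ℝ) → ℝ≥0∞) (x : Fin n → ℝ) :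
    SS n F x * GG γ a b x ≤ SS n (F2 γ a b F) x + 2 * ∑ l, SS n (F1 γ a b F l) x + m^2 * SS n F x := by
  have h2 : SS n (F2 γ a b F) x = ∑ e : Fin m ↪ Fin n, F (x ∘ e) * ∑ p : {p : Fin n // p ∉ Set.range e}, ∑ q : {q : Fin n // q ∉ Set.range e}, ind (Bp γ a b (x p) (x q)) := by
    rw [SS_succ, ← (Equiv.embeddingFinSucc m (Fin n)).symm.sum_comp, ← Finset.univ_sigma_univ, Finset.sum_sigma]
    refine Finset.sum_congr rfl fun e _ => ?_
    rw [Finset.mul_sum]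
    refine Finset.sum_congr rfl fun p _ => ?_
    set e' := (Equiv.embeddingFinSucc m (Fin n)).symm ⟨e, p⟩ with he'
    have e'c : (e' : Fin (m+1) → Fin n) = Fin.cons p.1 e := by rw [he', Equiv.coe_embeddingFinSucc_symm]
    have hc : x ∘ e' = Fin.cons (x p) (x ∘ e) := by
      rw [e'c]; funext i; refine Fin.cases ?_ (fun i => ?_) i <;> simp
    have h3 : ∀ q : Fin n, F2 γ a b F (Fin.cons (x q) (x ∘ e')) = F (x ∘ e) * ind (Bp γ a b (x p) (x q)) := by
      intro q
      rw [F2, Fin.tail_cons, hc, Fin.tail_cons]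
      rfl
    simp only [h3]
    rw [← Finset.mul_sum]
    congr 1
    have s1 := sum_split e (fun q => if q ∈ Set.range e then 0 else ind (Bp γ a b (x p) (x q)))
    have s2 := sum_split e' (fun q => if q ∈ Set.range e then 0 else ind (Bp γ a b (x p) (x q)))
    rw [s1] at s2
    have z1 : ∑ l, (if e l ∈ Set.range e then 0 else ind (Bp γ a b (x p) (x (e l)))) = 0 := Finset.sum_eq_zero fun l _ => by simp
    have z2 : ∑ l, (if e' l ∈ Set.range e then 0 else ind (Bp γ a b (x p) (x (e' l)))) = 0 := Finset.sum_eq_zero fun l _ => by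
      rw [e'c]
      refine Fin.cases ?_ (fun i => ?_) l
      · simp [ind, Bp]
      · simp
    rw [z1, z2, zero_add, zero_add] at s2
    have y1 : ∀ q : {q : Fin n // q ∉ Set.range e}, (if q.1 ∈ Set.range e then 0 else ind (Bp γ a b (x p) (x q))) = ind (Bp γ a b (x p) (x q)) := fun q => if_neg q.2
    have y2 : ∀ q : {q : Fin n // q ∉ Set.range e'}, (if q.1 ∈ Set.range e then 0 else ind (Bp γ a b (x p) (x q))) = ind (Bp γ a b (x p) (x q)) := fun q => if_neg (by
      rintro ⟨l, hl⟩
      exact q.2 ⟨l.succ, (congrFun e'c l.succ).trans (by rw [Fin.cons_succ, hl])⟩)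
    simp only [y1, y2] at s2
    exact s2.symm
  have h1 : ∀ l, SS n (F1 γ a b F l) x = ∑ e : Fin m ↪ Fin n, F (x ∘ e) * ∑ p : {p : Fin n // p ∉ Set.range e}, ind (Ap γ a b (x p) (x (e l))) := by
    intro l
    rw [SS_succ]
    refine Finset.sum_congr rfl fun e _ => ?_
    rw [Finset.mul_sum]
    refine Finset.sum_congr rfl fun p _ => ?_
    rw [F1, Fin.tail_cons]; rfl
  rw [h2]
  simp only [h1]
  rw [Finset.sum_comm, SS, Finset.sum_mul, Finset.mul_sum, Finset.mul_sum, ← Finset.sum_add_distrib, ← Finset.sum_add_distrib]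
  refine Finset.sum_le_sum fun e _ => ?_
  rw [← Finset.mul_sum]
  have : (GG γ a b x : ℝ≥0∞) ≤ (∑ p : {p : Fin n // p ∉ Set.range e}, ∑ q : {q : Fin n // q ∉ Set.range e}, ind (Bp γ a b (x p) (x q)))
     + 2 * ∑ l, ∑ p : {p : Fin n // p ∉ Set.range e}, ind (Ap γ a b (x p) (x (e l))) + m^2 := by
    rw [GG_eq, sum_split e]
    have t1 : ∑ l, ∑ q, ind (Bp γ a b (x (e l)) (x q)) ≤ m^2 + ∑ l, ∑ p : {p : Fin n // p ∉ Set.range e}, ind (Ap γ a b (x p) (x (e l))) := by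
      calc _ ≤ ∑ l : Fin m, (m + ∑ p : {p : Fin n // p ∉ Set.range e}, ind (Ap γ a b (x p) (x (e l)))) := by
            refine Finset.sum_le_sum fun l _ => ?_
            rw [sum_split e]
            refine add_le_add ?_ (Finset.sum_le_sum fun p _ => ind_mono fun h => Ap_symm (Bp_Ap h))
            calc _ ≤ ∑ l' : Fin m, (1:ℝ≥0∞) := Finset.sum_le_sum fun _ _ => ind_le_one _
              _ = m := by simp
        _ = _ := by rw [Finset.sum_add_distrib]; simp [pow_two]
    have t2 : ∑ p : {p : Fin n // p ∉ Set.range e}, ∑ q, ind (Bp γ a b (x p) (x q)) ≤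
        (∑ l, ∑ p : {p : Fin n // p ∉ Set.range e}, ind (Ap γ a b (x p) (x (e l)))) + ∑ p : {p : Fin n // p ∉ Set.range e}, ∑ q : {q : Fin n // q ∉ Set.range e}, ind (Bp γ a b (x p) (x q)) := by
      rw [Finset.sum_comm (s := Finset.univ (α := Fin m)), ← Finset.sum_add_distrib]
      refine Finset.sum_le_sum fun p _ => ?_
      rw [sum_split e]
      exact add_le_add (Finset.sum_le_sum fun l _ => ind_mono Bp_Ap) le_rfl
    calc _ ≤ _ := add_le_add t1 t2
      _ = _ := by ring
  calc _ ≤ F (x ∘ e) * _ := mul_le_mul_right this _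
    _ = _ := by ring

end GM

namespace GM

lemma phi_lip : ∃ C : ℝ, 0 < C ∧ ∀ n : ℕ, 1 ≤ n → ∀ s t, ‖phi 0 n t - phi 0 n s‖^2 ≤ C * (n * √n) * (t - s)^2 := by
  obtain ⟨C, hC, h⟩ := norm_phi_le 1
  refine ⟨C^2, by positivity, fun n hn s t => ?_⟩
  have h1 := mvt (f := phi 0 n) (hasDerivAt_phi 0 n) (a := s) (b := t) (fun x _ => h n hn x)
  have e1 : √(n:ℝ)^2 = n := Real.sq_sqrt (Nat.cast_nonneg n)
  have e2 : √√(n:ℝ)^2 = √n := Real.sq_sqrt (Real.sqrt_nonneg _)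
  calc _ ≤ (C * √n ^ 1 * √√n * |t - s|)^2 := pow_le_pow_left₀ (norm_nonneg _) h1 2
    _ = C^2 * (√(n:ℝ)^2 * √√(n:ℝ)^2) * |t-s|^2 := by ring
    _ = _ := by rw [e1, e2, sq_abs]

lemma rho_cons_eq (n : ℕ) {m : ℕ} (t : ℝ) (y : Fin m → ℝ) :
    rho n (Fin.cons t y : Fin (m+1) → ℝ) = (gm (Fin.cons (phi 0 n t) (fun i => phi 0 n (y i)) : Fin (m+1) → EuclideanSpace ℝ (Fin n))).det := by
  unfold rho
  congr 2
  funext i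
  refine Fin.cases ?_ (fun i => ?_) i <;> simp

lemma rho_cons_le (n : ℕ) {m : ℕ} (t : ℝ) (y : Fin m → ℝ) : rho n (Fin.cons t y : Fin (m+1) → ℝ) ≤ rho n y * (2 * √n) := by
  rw [rho_cons_eq]
  refine (gram_step _ _).trans (mul_le_mul_of_nonneg_left ?_ (rho_nonneg n y))
  rw [norm_phi_sq]; exact Q_le' n t

lemma rho_cons_sub_le : ∃ C : ℝ, 0 < C ∧ ∀ n : ℕ, 1 ≤ n → ∀ (m : ℕ) (t : ℝ) (y : Fin m → ℝ) (l : Fin m),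
    rho n (Fin.cons t y : Fin (m+1) → ℝ) ≤ rho n y * (C * (n * √n) * (t - y l)^2) := by
  obtain ⟨C, hC, h⟩ := phi_lip
  refine ⟨C, hC, fun n hn m t y l => ?_⟩
  rw [rho_cons_eq]
  exact (gram_step_sub _ _ l).trans (mul_le_mul_of_nonneg_left (h n hn _ _) (rho_nonneg n y))

lemma lint_shear (f : ℝ → ℝ → ℝ≥0∞) (hf : Measurable (fun p : ℝ × ℝ => f p.1 p.2)) :
    ∫⁻ s, ∫⁻ t, f s t = ∫⁻ u, ∫⁻ m, f (m + u/2) (m - u/2) := by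
  have h1 : ∀ s, ∫⁻ t, f s t = ∫⁻ u, f s (s - u) := fun s => (lintegral_sub_left_eq_self (fun t => f s t) s).symm
  simp only [h1]
  rw [lintegral_lintegral_swap]
  · refine lintegral_congr fun u => ?_
    rw [← lintegral_add_right_eq_self (fun s => f s (s - u)) (u/2)]
    refine lintegral_congr fun m => ?_
    congr 1; ring
  · exact (hf.comp (by fun_prop : Measurable (fun p : ℝ × ℝ => (p.1, p.1 - p.2)))).aemeasurable

lemma int_Ap (γ a b : ℝ) (s : ℝ) : ∫⁻ t, ind (Ap γ a b t s) ≤ ENNReal.ofReal (2 * min γ (b-a)) := by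
  have h1 : ∫⁻ t, ind (Ap γ a b t s) = volume {t | Ap γ a b t s} := by
    have hm : MeasurableSet {t | Ap γ a b t s} := measurableSet_Ap γ a b measurable_id measurable_const
    rw [← lintegral_indicator_one hm]
    refine lintegral_congr fun t => ?_
    by_cases h : Ap γ a b t s <;> simp [ind, h]
  rw [h1, mul_min_of_nonneg _ _ (by norm_num : (0:ℝ) ≤ 2), ENNReal.ofReal_min]
  refine le_min ?_ ?_
  · calc _ ≤ volume (Set.Icc (s - γ) (s + γ)) := measure_mono fun t ht => by
          have := abs_le.1 ht.1
          exact ⟨by linarith, by linarith⟩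
      _ = _ := by rw [Real.volume_Icc]; congr 1; ring
  · calc _ ≤ volume (Set.Icc (2 * a - s) (2 * b - s)) := measure_mono fun t ht => by
          have := ht.2
          exact ⟨by linarith [this.1], by linarith [this.2]⟩
      _ = _ := by rw [Real.volume_Icc]; congr 1; ring

lemma Bp_shear {γ a b : ℝ} (m u : ℝ) : Bp γ a b (m + u/2) (m - u/2) ↔ u ∈ Set.Ioc 0 γ ∧ m ∈ Set.Icc a b := by
  unfold Bp
  have e1 : m + u/2 - (m - u/2) = u := by ring
  have e2 : (m + u/2 + (m - u/2))/2 = m := by ring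
  rw [e1, e2, Set.mem_Ioc, and_assoc]

lemma lint_ind (s : Set ℝ) (hs : MeasurableSet s) : ∫⁻ t, ind (t ∈ s) = volume s := by
  rw [← lintegral_indicator_one hs]
  refine lintegral_congr fun t => ?_
  by_cases h : t ∈ s <;> simp [ind, h]

lemma int_Bp (γ a b : ℝ) : ∫⁻ s, ∫⁻ t, ind (Bp γ a b s t) = ENNReal.ofReal γ * ENNReal.ofReal (b - a) := by
  rw [lint_shear _ (measurable_ind (measurableSet_Bp γ a b measurable_fst measurable_snd))]
  simp only [Bp_shear, ind_and]
  have hI : Measurable (fun m : ℝ => ind (m ∈ Set.Icc a b)) := measurable_ind measurableSet_Icc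
  have hI' : Measurable (fun u : ℝ => ind (u ∈ Set.Ioc 0 γ)) := measurable_ind measurableSet_Ioc
  have : ∀ u : ℝ, ∫⁻ m, ind (u ∈ Set.Ioc 0 γ) * ind (m ∈ Set.Icc a b) = ind (u ∈ Set.Ioc 0 γ) * ENNReal.ofReal (b - a) := by
    intro u
    rw [lintegral_const_mul _ hI, lint_ind _ measurableSet_Icc, Real.volume_Icc]
  simp only [this]
  rw [lintegral_mul_const _ hI', lint_ind _ measurableSet_Ioc, Real.volume_Ioc, sub_zero]

noncomputable def th (n : ℕ) (γ a b : ℝ) : ℝ := n^2 * γ^3 * (b - a)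

lemma th_nonneg {n : ℕ} {γ a b : ℝ} (hγ : 0 < γ) (hab : a ≤ b) : 0 ≤ th n γ a b := by
  have := sub_nonneg.2 hab
  unfold th; positivity

lemma sqrt_min_le {n : ℕ} {γ a b : ℝ} (hγ : 0 < γ) (hab : a ≤ b) : √n * min γ (b-a) ≤ 1 + th n γ a b := by
  set s := min γ (b - a) with hs
  have h0 : 0 ≤ s := le_min hγ.le (sub_nonneg.2 hab)
  have h1 : s ≤ γ := min_le_left _ _
  have h2 : s ≤ b - a := min_le_right _ _
  have h4 : s^4 ≤ γ^3 * (b - a) := by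
    calc s^4 = s^3 * s := by ring
      _ ≤ γ^3 * (b-a) := by gcongr
  have h5 : (√n * s)^4 ≤ th n γ a b := by
    have : (√(n:ℝ))^4 = n^2 := by
      rw [show (4:ℕ) = 2 * 2 from rfl, pow_mul, Real.sq_sqrt (Nat.cast_nonneg n)]
    rw [mul_pow, this, th, mul_assoc]; gcongr
  have h6 : 0 ≤ √n * s := by positivity
  have h7 : √n * s ≤ 1 + (√n * s)^4 := by
    set z := √n * s
    nlinarith [sq_nonneg (z^2 - 1/2), sq_nonneg (z - 1/2), sq_nonneg (z-1)]
  linarith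

lemma meas_cons {m : ℕ} : Measurable (fun p : (Fin m → ℝ) × ℝ => (Fin.cons p.2 p.1 : Fin (m+1) → ℝ)) := by
  refine measurable_pi_iff.2 fun i => ?_
  refine Fin.cases ?_ (fun i => ?_) i
  · simp only [Fin.cons_zero]; exact measurable_snd
  · simp only [Fin.cons_succ]; exact (measurable_pi_apply i).comp measurable_fst

lemma J1 {n m : ℕ} {γ a b : ℝ} (hγ : 0 < γ) (hab : a ≤ b) {F : (Fin m → ℝ) → ℝ≥0∞} (hF : Measurable F) (l : Fin m) :
    ∫⁻ z, F1 γ a b F l z * ENNReal.ofReal (rho n z) ≤ ENNReal.ofReal (4 * (1 + th n γ a b)) * ∫⁻ y, F y * ENNReal.ofReal (rho n y) := by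
  have hm : Measurable (fun z => F1 γ a b F l z * ENNReal.ofReal (rho n z)) := (measurable_F1 γ a b hF l).mul (measurable_rho n)
  have hm' : Measurable (fun z => F z * ENNReal.ofReal (rho n z)) := hF.mul (measurable_rho n)
  rw [lintegral_fin_cons _ hm, ← lintegral_const_mul _ hm']
  refine lintegral_mono fun y => ?_
  calc _ ≤ ∫⁻ t, (F y * ENNReal.ofReal (rho n y) * ENNReal.ofReal (2 * √n)) * ind (Ap γ a b t (y l)) := by
        refine lintegral_mono fun t => ?_
        simp only [F1, Fin.tail_cons, Fin.cons_zero]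
        calc _ ≤ F y * ind (Ap γ a b t (y l)) * ENNReal.ofReal (rho n y * (2 * √n)) :=
              mul_le_mul_right (ENNReal.ofReal_le_ofReal (rho_cons_le n t y)) _
          _ = _ := by rw [ENNReal.ofReal_mul (rho_nonneg n y)]; ring
    _ = (F y * ENNReal.ofReal (rho n y) * ENNReal.ofReal (2 * √n)) * ∫⁻ t, ind (Ap γ a b t (y l)) :=
        lintegral_const_mul _ (measurable_ind (measurableSet_Ap γ a b measurable_id measurable_const))
    _ ≤ (F y * ENNReal.ofReal (rho n y) * ENNReal.ofReal (2 * √n)) * ENNReal.ofReal (2 * min γ (b-a)) := mul_le_mul_right (int_Ap _ _ _ _) _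
    _ = ENNReal.ofReal (4 * (√n * min γ (b-a))) * (F y * ENNReal.ofReal (rho n y)) := by
        rw [mul_assoc _ (ENNReal.ofReal (2 * √n)), ← ENNReal.ofReal_mul (by positivity), mul_comm]
        congr 2; ring
    _ ≤ _ := mul_le_mul_left (ENNReal.ofReal_le_ofReal (mul_le_mul_of_nonneg_left (sqrt_min_le hγ hab) (by norm_num))) _

lemma J2 : ∃ C : ℝ, 0 < C ∧ ∀ (n : ℕ), 1 ≤ n → ∀ (m : ℕ) (γ a b : ℝ), 0 < γ → a ≤ b → ∀ (F : (Fin m → ℝ) → ℝ≥0∞), Measurable F →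
    ∫⁻ z, F2 γ a b F z * ENNReal.ofReal (rho n z) ≤ ENNReal.ofReal (C * th n γ a b) * ∫⁻ y, F y * ENNReal.ofReal (rho n y) := by
  obtain ⟨C, hC, h⟩ := rho_cons_sub_le
  refine ⟨2 * C, by positivity, fun n hn m γ a b hγ hab F hF => ?_⟩
  have hm : Measurable (fun z => F2 γ a b F z * ENNReal.ofReal (rho n z)) := (measurable_F2 γ a b hF).mul (measurable_rho (ι := Fin (m+2)) n)
  have hm' : Measurable (fun z => F z * ENNReal.ofReal (rho n z)) := hF.mul (measurable_rho n)
  rw [lintegral_fin_cons _ hm, lintegral_fin_cons, ← lintegral_const_mul _ hm']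
  · refine lintegral_mono fun y => ?_
    calc _ ≤ ∫⁻ s, ∫⁻ t, (F y * ENNReal.ofReal (rho n y) * ENNReal.ofReal (2 * C * n^2 * γ^2)) * ind (Bp γ a b s t) := by
          refine lintegral_mono fun s => lintegral_mono fun t => ?_
          simp only [F2, Fin.tail_cons, Fin.cons_zero]
          have e : (Fin.cons t (Fin.cons s y : Fin (m+1) → ℝ) : Fin (m+2) → ℝ) 1 = s := rfl
          rw [e]
          by_cases hB : Bp γ a b s t
          · have hr : rho n (Fin.cons t (Fin.cons s y : Fin (m+1) → ℝ) : Fin (m+2) → ℝ) ≤ rho n y * (2 * C * n^2 * γ^2) := by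
              have h1 := h n hn (m+1) t (Fin.cons s y) 0
              rw [Fin.cons_zero] at h1
              refine h1.trans ?_
              have h3 : (t - s)^2 ≤ γ^2 := by
                have := hB.1; have := hB.2.1
                nlinarith
              have e1 : √(n:ℝ) * √n = n := Real.mul_self_sqrt (Nat.cast_nonneg n)
              calc _ ≤ (rho n y * (2 * √n)) * (C * (n * √n) * γ^2) :=
                    mul_le_mul (rho_cons_le n s y) (by gcongr) (by positivity) (mul_nonneg (rho_nonneg n y) (by positivity))
                _ = rho n y * (2 * C * n * (√(n:ℝ) * √n) * γ^2) := by ring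
                _ = _ := by rw [e1]; ring
            rw [ind_true hB, mul_one, mul_one]
            calc _ ≤ F y * ENNReal.ofReal (rho n y * (2 * C * n^2 * γ^2)) := mul_le_mul_right (ENNReal.ofReal_le_ofReal hr) _
              _ = _ := by rw [ENNReal.ofReal_mul (rho_nonneg n y)]; ring
          · rw [ind_false hB]; simp
      _ = (F y * ENNReal.ofReal (rho n y) * ENNReal.ofReal (2 * C * n^2 * γ^2)) * ∫⁻ s, ∫⁻ t, ind (Bp γ a b s t) := by
          have hmb : Measurable (fun p : ℝ × ℝ => ind (Bp γ a b p.1 p.2)) := measurable_ind (measurableSet_Bp γ a b measurable_fst measurable_snd)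
          rw [← lintegral_const_mul _ hmb.lintegral_prod_right']
          refine lintegral_congr fun s => ?_
          exact lintegral_const_mul _ (measurable_ind (measurableSet_Bp γ a b measurable_const measurable_id))
      _ = _ := by
          rw [int_Bp, ← ENNReal.ofReal_mul hγ.le, mul_assoc _ (ENNReal.ofReal (2 * C * n^2 * γ^2)), ← ENNReal.ofReal_mul (by positivity), mul_comm, th]
          congr 2; ring
  · exact (hm.comp meas_cons).lintegral_prod_right'

/-- Lemma A -/
theorem lemmaA (j : ℕ) : ∀ m : ℕ, ∃ C : ℝ, 0 < C ∧ ∀ (n : ℕ), 1 ≤ n → ∀ (γ a b : ℝ), 0 < γ → a ≤ b → ∀ (F : (Fin m → ℝ) → ℝ≥0∞), Measurable F →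
    ∫⁻ x, SS n F x * (GG γ a b x : ℝ≥0∞)^j ∂(Pn n) ≤ ENNReal.ofReal (C * (1 + th n γ a b)^j) * ∫⁻ y, F y * ENNReal.ofReal (rho n y) := by
  induction j with
  | zero =>
    intro m
    refine ⟨1, one_pos, fun n hn γ a b hγ hab F hF => ?_⟩
    simp [corr n F hF]
  | succ j ih =>
    intro m
    obtain ⟨C0, hC0, h0⟩ := ih m
    obtain ⟨C1, hC1, h1⟩ := ih (m+1)
    obtain ⟨C2, hC2, h2⟩ := ih (m+2)
    obtain ⟨D, hD, hJ⟩ := J2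
    refine ⟨C2 * D + 8 * m * C1 + m^2 * C0, by positivity, fun n hn γ a b hγ hab F hF => ?_⟩
    have ht := th_nonneg (n := n) hγ hab
    set θ := th n γ a b with hθ
    set Z := ∫⁻ y, F y * ENNReal.ofReal (rho n y) with hZ
    have hG : Measurable (fun x : Fin n → ℝ => (GG γ a b x : ℝ≥0∞)^j) := (measurable_GG γ a b).pow_const j
    have m2 : Measurable (fun x => SS n (F2 γ a b F) x * (GG γ a b x : ℝ≥0∞)^j) := (measurable_SS n _ (measurable_F2 γ a b hF)).mul hG
    have m1 : ∀ l, Measurable (fun x => SS n (F1 γ a b F l) x * (GG γ a b x : ℝ≥0∞)^j) := fun l => (measurable_SS n _ (measurable_F1 γ a b hF l)).mul hG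
    have m0 : Measurable (fun x => SS n F x * (GG γ a b x : ℝ≥0∞)^j) := (measurable_SS n _ hF).mul hG
    calc _ ≤ ∫⁻ x, (SS n (F2 γ a b F) x * (GG γ a b x : ℝ≥0∞)^j + 2 * ∑ l, SS n (F1 γ a b F l) x * (GG γ a b x : ℝ≥0∞)^j) + m^2 * (SS n F x * (GG γ a b x : ℝ≥0∞)^j) ∂(Pn n) := by
          refine lintegral_mono fun x => ?_
          calc _ = SS n F x * (GG γ a b x : ℝ≥0∞) * (GG γ a b x : ℝ≥0∞)^j := by rw [pow_succ]; ring
            _ ≤ _ := mul_le_mul_left (SS_step γ a b F x) _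
            _ = _ := by rw [← Finset.sum_mul]; ring
      _ = ∫⁻ x, SS n (F2 γ a b F) x * (GG γ a b x : ℝ≥0∞)^j ∂(Pn n) + 2 * ∑ l, ∫⁻ x, SS n (F1 γ a b F l) x * (GG γ a b x : ℝ≥0∞)^j ∂(Pn n) +
            m^2 * ∫⁻ x, SS n F x * (GG γ a b x : ℝ≥0∞)^j ∂(Pn n) := by
          rw [lintegral_add_right _ (m0.const_mul _), lintegral_add_left m2, lintegral_const_mul _ m0,
            lintegral_const_mul _ (Finset.measurable_sum _ fun l _ => m1 l), lintegral_finsetSum _ fun l _ => m1 l]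
      _ ≤ ENNReal.ofReal (C2 * (1+θ)^j) * (ENNReal.ofReal (D * θ) * Z) + 2 * ∑ l : Fin m, ENNReal.ofReal (C1 * (1+θ)^j) * (ENNReal.ofReal (4 * (1 + θ)) * Z)
            + m^2 * (ENNReal.ofReal (C0 * (1+θ)^j) * Z) := by
          gcongr with l _
          · exact (h2 n hn γ a b hγ hab _ (measurable_F2 γ a b hF)).trans (mul_le_mul_right (hJ n hn m γ a b hγ hab F hF) _)
          · exact (h1 n hn γ a b hγ hab _ (measurable_F1 γ a b hF l)).trans (mul_le_mul_right (J1 hγ hab hF l) _)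
          · exact h0 n hn γ a b hγ hab F hF
      _ = ENNReal.ofReal (C2 * (1+θ)^j * (D * θ) + 2 * (m * (C1 * (1+θ)^j * (4 * (1 + θ)))) + m^2 * (C0 * (1+θ)^j)) * Z := by
          rw [Finset.sum_const, Finset.card_univ, Fintype.card_fin, nsmul_eq_mul, ENNReal.ofReal_add (by positivity) (by positivity), ENNReal.ofReal_add (by positivity) (by positivity),
            ENNReal.ofReal_mul (by positivity : 0 ≤ C2 * (1+θ)^j), ENNReal.ofReal_mul (by norm_num : (0:ℝ) ≤ 2), ENNReal.ofReal_mul (Nat.cast_nonneg m), ENNReal.ofReal_mul (by positivity : 0 ≤ C1 * (1+θ)^j),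
            ENNReal.ofReal_mul (by positivity : (0:ℝ) ≤ m^2), ENNReal.ofReal_pow (Nat.cast_nonneg m), ENNReal.ofReal_natCast, ENNReal.ofReal_ofNat]
          ring
      _ ≤ _ := by
          refine mul_le_mul_left (ENNReal.ofReal_le_ofReal ?_) _
          have hp : 0 ≤ (1+θ)^j := by positivity
          rw [pow_succ (1+θ) j]
          have q1 : C2 * (1+θ)^j * (D * θ) ≤ C2 * D * ((1+θ)^j * (1+θ)) := by
            have : C2 * D * ((1+θ)^j * (1+θ)) - C2 * (1+θ)^j * (D * θ) = C2 * D * (1+θ)^j := by ring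
            have : 0 ≤ C2 * D * (1+θ)^j := by positivity
            linarith
          have q2 : (m:ℝ)^2 * (C0 * (1+θ)^j) ≤ m^2 * C0 * ((1+θ)^j * (1+θ)) := by
            have : (m:ℝ)^2 * C0 * ((1+θ)^j * (1+θ)) - m^2 * (C0 * (1+θ)^j) = m^2 * C0 * ((1+θ)^j * θ) := by ring
            have : 0 ≤ (m:ℝ)^2 * C0 * ((1+θ)^j * θ) := by positivity
            linarith
          linarith

end GM

namespace GM

lemma lint_fin0 (f : (Fin 0 → ℝ) → ℝ≥0∞) : ∫⁻ y, f y = f Fin.elim0 := by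
  have : ∀ y, f y = f Fin.elim0 := fun y => by congr 1; exact Subsingleton.elim _ _
  simp only [this, lintegral_const]
  simp [volume_pi]

lemma rho_fin0 (n : ℕ) (y : Fin 0 → ℝ) : rho n y = 1 := by simp [rho]

lemma GG_le (γ a b : ℝ) {n : ℕ} (x : Fin n → ℝ) : (GG γ a b x : ℝ≥0∞) ≤ SS n (F2 γ a b (fun _ : Fin 0 → ℝ => 1)) x := by
  have h := SS_step γ a b (fun _ : Fin 0 → ℝ => 1) x
  simpa [SS] using h

theorem momG (j : ℕ) : ∃ C : ℝ, 0 < C ∧ ∀ (n : ℕ), 1 ≤ n → ∀ (γ a b : ℝ), 0 < γ → a ≤ b →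
    ∫⁻ x, (GG γ a b x : ℝ≥0∞)^(j+1) ∂(Pn n) ≤ ENNReal.ofReal (C * (th n γ a b * (1 + th n γ a b)^j)) := by
  obtain ⟨C, hC, h⟩ := lemmaA j 2
  obtain ⟨D, hD, hJ⟩ := J2
  refine ⟨C * D, by positivity, fun n hn γ a b hγ hab => ?_⟩
  have ht := th_nonneg (n := n) hγ hab
  have h1 : Measurable (fun _ : Fin 0 → ℝ => (1 : ℝ≥0∞)) := measurable_const
  have h2 := h n hn γ a b hγ hab _ (measurable_F2 γ a b h1)
  have h3 := hJ n hn 0 γ a b hγ hab _ h1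
  rw [lint_fin0 (fun y => (1:ℝ≥0∞) * ENNReal.ofReal (rho n y)), rho_fin0, ENNReal.ofReal_one, mul_one, mul_one] at h3
  calc _ ≤ ∫⁻ x, SS n (F2 γ a b (fun _ : Fin 0 → ℝ => 1)) x * (GG γ a b x : ℝ≥0∞)^j ∂(Pn n) := by
        refine lintegral_mono fun x => ?_
        simp only []
        rw [pow_succ, mul_comm]
        exact mul_le_mul_left (GG_le γ a b x) _
    _ ≤ _ := h2
    _ ≤ _ := mul_le_mul_right h3 _
    _ = _ := by
        rw [← ENNReal.ofReal_mul (by positivity)]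
        congr 1; ring

noncomputable def F3 (γ a b : ℝ) (z : Fin 3 → ℝ) : ℝ≥0∞ := ind (Ap γ a b (z 0) (z 1) ∧ Ap γ a b (z 0) (z 2))

lemma measurable_F3 (γ a b : ℝ) : Measurable (F3 γ a b) := by
  unfold F3
  exact measurable_ind ((measurableSet_Ap γ a b (measurable_pi_apply _) (measurable_pi_apply _)).inter
    (measurableSet_Ap γ a b (measurable_pi_apply _) (measurable_pi_apply _)))

lemma int_Ap' (γ a b : ℝ) (s : ℝ) : ∫⁻ t, ind (Ap γ a b s t) ≤ ENNReal.ofReal (2 * γ) := by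
  have : ∀ t, ind (Ap γ a b s t) = ind (Ap γ a b t s) := fun t => le_antisymm (ind_mono Ap_symm) (ind_mono Ap_symm)
  simp only [this]
  exact (int_Ap γ a b s).trans (ENNReal.ofReal_le_ofReal (by linarith [min_le_left γ (b-a)]))

lemma Ap_shear {γ a b : ℝ} (m u : ℝ) : Ap γ a b (m + u/2) (m - u/2) ↔ u ∈ Set.Icc (-γ) γ ∧ m ∈ Set.Icc a b := by
  unfold Ap
  have e1 : m + u/2 - (m - u/2) = u := by ring
  have e2 : (m + u/2 + (m - u/2))/2 = m := by ring
  rw [e1, e2, abs_le]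
  rfl

lemma int_Ap2 (γ a b : ℝ) : ∫⁻ s, ∫⁻ t, ind (Ap γ a b s t) = ENNReal.ofReal (2 * γ) * ENNReal.ofReal (b - a) := by
  rw [lint_shear _ (measurable_ind (measurableSet_Ap γ a b measurable_fst measurable_snd))]
  simp only [Ap_shear, ind_and]
  have hI : Measurable (fun m : ℝ => ind (m ∈ Set.Icc a b)) := measurable_ind measurableSet_Icc
  have hI' : Measurable (fun u : ℝ => ind (u ∈ Set.Icc (-γ) γ)) := measurable_ind measurableSet_Icc
  have : ∀ u : ℝ, ∫⁻ m, ind (u ∈ Set.Icc (-γ) γ) * ind (m ∈ Set.Icc a b) = ind (u ∈ Set.Icc (-γ) γ) * ENNReal.ofReal (b - a) := by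
    intro u
    rw [lintegral_const_mul _ hI, lint_ind _ measurableSet_Icc, Real.volume_Icc]
  simp only [this]
  rw [lintegral_mul_const _ hI', lint_ind _ measurableSet_Icc, Real.volume_Icc]
  congr 2; ring

lemma int_F3 {γ a b : ℝ} (hγ : 0 < γ) : ∫⁻ z, F3 γ a b z ≤ ENNReal.ofReal (4 * γ^2 * (b - a)) := by
  rw [← lintegral_reindex (Fin.revPerm : Fin 3 ≃ Fin 3)]
  have hc : Measurable (fun x : Fin 3 → ℝ => F3 γ a b (x ∘ (Fin.revPerm : Fin 3 ≃ Fin 3))) :=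
    (measurable_F3 γ a b).comp (measurable_pi_lambda _ fun i => measurable_pi_apply _)
  rw [lintegral_fin_cons _ hc]
  have hA : Measurable (fun y : Fin 2 → ℝ => ind (Ap γ a b (y 1) (y 0))) :=
    measurable_ind (measurableSet_Ap γ a b (measurable_pi_apply _) (measurable_pi_apply _))
  have hA' : Measurable (fun p : ℝ × ℝ => ind (Ap γ a b p.1 p.2)) :=
    measurable_ind (measurableSet_Ap γ a b measurable_fst measurable_snd)
  calc _ ≤ ∫⁻ y : Fin 2 → ℝ, ind (Ap γ a b (y 1) (y 0)) * ENNReal.ofReal (2 * γ) := by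
        refine lintegral_mono fun y => ?_
        have e : ∀ t, F3 γ a b ((Fin.cons t y : Fin 3 → ℝ) ∘ (Fin.revPerm : Fin 3 ≃ Fin 3)) = ind (Ap γ a b (y 1) (y 0)) * ind (Ap γ a b (y 1) t) := by
          intro t
          rw [← ind_and]; rfl
        simp only [e]
        have hm : Measurable (fun t => ind (Ap γ a b (y 1) t)) := measurable_ind (measurableSet_Ap γ a b measurable_const measurable_id)
        rw [lintegral_const_mul _ hm]
        exact mul_le_mul_right (int_Ap' γ a b _) _
    _ = (∫⁻ s, ∫⁻ t, ind (Ap γ a b s t)) * ENNReal.ofReal (2 * γ) := by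
        rw [lintegral_mul_const _ hA, lintegral_fin_cons _ hA]
        congr 1
        rw [lintegral_fin_cons, lint_fin0]
        · rfl
        · exact (hA.comp meas_cons).lintegral_prod_right'
    _ = _ := by
        rw [int_Ap2, mul_right_comm, ← ENNReal.ofReal_mul (by positivity), ← ENNReal.ofReal_mul (by positivity)]
        congr 1; ring

lemma rho3_le : ∃ C : ℝ, 0 < C ∧ ∀ (n : ℕ), 1 ≤ n → ∀ (γ a b : ℝ), 0 < γ → ∀ z : Fin 3 → ℝ,
    Ap γ a b (z 0) (z 1) ∧ Ap γ a b (z 0) (z 2) → rho n z ≤ C * (n^3 * √n * γ^4) := by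
  obtain ⟨C, hC, h⟩ := rho_cons_sub_le
  refine ⟨8 * C^2, by positivity, fun n hn γ a b hγ z hz => ?_⟩
  have hs : ∀ {m : ℕ} (z : Fin (m+1) → ℝ), z = Fin.cons (z 0) (Fin.tail z) := fun z => (Fin.cons_self_tail z).symm
  have h1 := h n hn 2 (z 0) (Fin.tail z) 0
  rw [Fin.cons_self_tail] at h1
  have h2 := h n hn 1 (z 1) (Fin.tail (Fin.tail z)) 0
  rw [show z 1 = (Fin.tail z) 0 from rfl, Fin.cons_self_tail] at h2
  have h3 := rho_cons_le n (z 2) (Fin.tail (Fin.tail (Fin.tail z)))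
  rw [show z 2 = (Fin.tail (Fin.tail z)) 0 from rfl, Fin.cons_self_tail, rho_fin0, one_mul] at h3
  have a1 := abs_le.1 hz.1.1
  have a2 := abs_le.1 hz.2.1
  have e1 : (z 0 - Fin.tail z 0)^2 ≤ γ^2 := by
    have : Fin.tail z 0 = z 1 := rfl
    rw [this]; nlinarith
  have e2 : (Fin.tail z 0 - Fin.tail (Fin.tail z) 0)^2 ≤ 4 * γ^2 := by
    have : Fin.tail z 0 = z 1 := rfl
    have h' : Fin.tail (Fin.tail z) 0 = z 2 := rfl
    rw [this, h']; nlinarith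
  have q : √(n:ℝ) * √n = n := Real.mul_self_sqrt (Nat.cast_nonneg n)
  calc rho n z ≤ rho n (Fin.tail z) * (C * (n * √n) * γ^2) := h1.trans (mul_le_mul_of_nonneg_left (by gcongr) (rho_nonneg _ _))
    _ ≤ ((2 * √n) * (C * (n * √n) * (4 * γ^2))) * (C * (n * √n) * γ^2) := by
        refine mul_le_mul_of_nonneg_right (h2.trans ?_) (by positivity)
        exact mul_le_mul h3 (by gcongr) (by positivity) (by positivity)
    _ = 8 * C^2 * (n^2 * (√(n:ℝ) * √n) * √n * γ^4) := by ring
    _ = _ := by rw [q]; ring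

theorem momCh (j : ℕ) : ∃ C : ℝ, 0 < C ∧ ∀ (n : ℕ), 1 ≤ n → ∀ (γ a b : ℝ), 0 < γ → a ≤ b →
    ∫⁻ x, (Nat.card (Ch (fun p q : Fin n => Bp γ a b (x p) (x q))) : ℝ≥0∞) * (GG γ a b x : ℝ≥0∞)^j ∂(Pn n) ≤
      ENNReal.ofReal (C * (th n γ a b * (n * √n * γ^3) * (1 + th n γ a b)^j)) := by
  obtain ⟨C, hC, h⟩ := lemmaA j 3
  obtain ⟨D, hD, hJ⟩ := rho3_le
  refine ⟨C * (4 * D), by positivity, fun n hn γ a b hγ hab => ?_⟩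
  have ht := th_nonneg (n := n) hγ hab
  have h2 := h n hn γ a b hγ hab _ (measurable_F3 γ a b)
  have h3 : ∫⁻ z, F3 γ a b z * ENNReal.ofReal (rho n z) ≤ ENNReal.ofReal (4 * D * (th n γ a b * (n * √n * γ^3))) := by
    calc _ ≤ ∫⁻ z, F3 γ a b z * ENNReal.ofReal (D * (n^3 * √n * γ^4)) := by
          refine lintegral_mono fun z => ?_
          by_cases hz : Ap γ a b (z 0) (z 1) ∧ Ap γ a b (z 0) (z 2)
          · exact mul_le_mul_right (ENNReal.ofReal_le_ofReal (hJ n hn γ a b hγ z hz)) _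
          · simp [F3, ind_false hz]
      _ ≤ _ := by
          rw [lintegral_mul_const _ (measurable_F3 γ a b)]
          refine (mul_le_mul_left (int_F3 hγ) _).trans (le_of_eq ?_)
          have := sub_nonneg.2 hab
          rw [← ENNReal.ofReal_mul (by positivity), th]
          congr 1; ring
  calc _ ≤ ∫⁻ x, SS n (F3 γ a b) x * (GG γ a b x : ℝ≥0∞)^j ∂(Pn n) := by
        refine lintegral_mono fun x => mul_le_mul_left ?_ _
        unfold Ch
        rw [card_ind, SS]
        refine Finset.sum_le_sum fun e _ => ind_mono fun he => ?_
        exact ⟨he.1.elim (fun h => Bp_Ap h) (fun h => Ap_symm (Bp_Ap h)), he.2.elim (fun h => Bp_Ap h) (fun h => Ap_symm (Bp_Ap h))⟩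
    _ ≤ _ := h2
    _ ≤ _ := mul_le_mul_right h3 _
    _ = _ := by
        rw [← ENNReal.ofReal_mul (by positivity)]
        congr 1; ring

/-- indicator of j disjoint pairs -/
noncomputable def FD (γ a b : ℝ) (j : ℕ) (z : Fin 2 × Fin j → ℝ) : ℝ≥0∞ := ind (∀ i, Bp γ a b (z (0,i)) (z (1,i)))

lemma measurable_FD (γ a b : ℝ) (j : ℕ) : Measurable (FD γ a b j) := by
  unfold FD
  refine measurable_ind ?_
  have := MeasurableSet.iInter (fun i : Fin j => measurableSet_Bp γ a b (measurable_pi_apply (X := fun _ => ℝ) ((0 : Fin 2), i)) (measurable_pi_apply ((1 : Fin 2), i)))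
  simpa only [Set.ofPred_forall] using this

theorem descG (j : ℕ) : ∃ C : ℝ, 0 < C ∧ ∀ (n : ℕ), 1 ≤ n → ∀ (γ a b : ℝ), 0 < γ → a ≤ b →
    (∫⁻ y, FD γ a b j y * ENNReal.ofReal (rho n y) ≤ ∫⁻ x, ((GG γ a b x).descFactorial j : ℝ≥0∞) ∂(Pn n)) ∧
    ∫⁻ x, ((GG γ a b x).descFactorial j : ℝ≥0∞) ∂(Pn n) ≤ (∫⁻ y, FD γ a b j y * ENNReal.ofReal (rho n y)) +
      ENNReal.ofReal (C * (th n γ a b * (n * √n * γ^3) * (1 + th n γ a b)^(j-2))) := by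
  obtain ⟨C, hC, h⟩ := momCh (j-2)
  refine ⟨(j * j * 4 + 1) * C, by positivity, fun n hn γ a b hγ hab => ?_⟩
  have ht := th_nonneg (n := n) hγ hab
  rw [← corr n _ (measurable_FD γ a b j)]
  have hD : ∀ x : Fin n → ℝ, SS n (FD γ a b j) x = (Nat.card (DT (fun p q : Fin n => Bp γ a b (x p) (x q)) j) : ℝ≥0∞) := by
    intro x
    unfold DT
    rw [card_ind, SS]
    rfl
  constructor
  · refine lintegral_mono fun x => ?_
    rw [hD]
    have := desc_lower (R := fun p q : Fin n => Bp γ a b (x p) (x q)) j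
    exact Nat.cast_le.2 this
  · have hR : ∀ x : Fin n → ℝ, ∀ p q, Bp γ a b (x p) (x q) → ¬ Bp γ a b (x q) (x p) := fun x p q h1 h2 => by
      have := h1.1; have := h2.1; linarith
    calc _ ≤ ∫⁻ x, (SS n (FD γ a b j) x + ((j * j * 4 : ℕ) : ℝ≥0∞) * ((Nat.card (Ch (fun p q : Fin n => Bp γ a b (x p) (x q))) : ℝ≥0∞) * (GG γ a b x : ℝ≥0∞)^(j-2))) ∂(Pn n) := by
          refine lintegral_mono fun x => ?_
          rw [hD]
          have h1 := desc_upper (R := fun p q : Fin n => Bp γ a b (x p) (x q)) (fun p h => hR x p p h h) j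
          have h2 := TT_le (R := fun p q : Fin n => Bp γ a b (x p) (x q)) (hR x)
          have h3 : (GG γ a b x).descFactorial j ≤ Nat.card (DT (fun p q : Fin n => Bp γ a b (x p) (x q)) j) + (j * j * 4) * (Nat.card (Ch (fun p q : Fin n => Bp γ a b (x p) (x q))) * (GG γ a b x)^(j-2)) := by
            refine h1.trans ?_
            rw [mul_assoc (j*j) 4]
            refine Nat.add_le_add_left (Nat.mul_le_mul_left _ ?_) _
            rw [← mul_assoc]
            exact Nat.mul_le_mul_right _ h2
          have h4 := Nat.cast_le (α := ℝ≥0∞).2 h3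
          simpa only [Nat.cast_add, Nat.cast_mul, Nat.cast_pow] using h4
      _ ≤ _ := by
          rw [lintegral_add_left (measurable_SS n _ (measurable_FD γ a b j)), lintegral_const_mul' _ _ (ENNReal.natCast_ne_top _)]
          refine add_le_add le_rfl ?_
          refine (mul_le_mul_right (h n hn γ a b hγ hab) _).trans ?_
          rw [← ENNReal.ofReal_natCast, ← ENNReal.ofReal_mul (Nat.cast_nonneg _)]
          refine ENNReal.ofReal_le_ofReal ?_
          push_cast
          rw [mul_assoc ((j:ℝ) * j * 4 + 1)]
          refine mul_le_mul_of_nonneg_right (by linarith) (by positivity)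

end GM

namespace GM

/-- normalised pair vectors -/
noncomputable def vv (n : ℕ) (s m u : ℝ) : Fin 2 → EuclideanSpace ℝ (Fin n) :=
  ![phi 0 n (m + u/2), (u * s)⁻¹ • (phi 0 n (m + u/2) - phi 0 n (m - u/2))]

lemma vv_bound {n : ℕ} {s m u B : ℝ} (hs : 0 < s) (hu : 0 < u) (p : EuclideanSpace ℝ (Fin n)) (r : Fin 2)
    (h : ∀ ξ, |ξ - m| ≤ u/2 → |inner ℝ (phi r n ξ) p| ≤ B * s^(r:ℕ)) : |inner ℝ (vv n s m u r) p| ≤ B := by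
  fin_cases r
  · have := h (m + u/2) (by rw [add_sub_cancel_left, abs_of_pos (by positivity)])
    simpa [vv] using this
  · have hd : ∀ x, HasDerivAt (fun x => inner ℝ (phi 0 n x) p) (inner ℝ (phi 1 n x) p) x := fun x => by
      have := (hasDerivAt_phi 0 n x).inner ℝ (hasDerivAt_const x p)
      simpa using this
    have h1 := mvt hd (a := m - u/2) (b := m + u/2) (C := B * s) (fun x hx => by
      rw [Set.uIcc_of_le (by linarith)] at hx
      have := h x (abs_le.2 ⟨by linarith [hx.1], by linarith [hx.2]⟩)
      simpa using this)
    rw [show m + u/2 - (m - u/2) = u by ring, abs_of_pos hu, Real.norm_eq_abs] at h1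
    simp only [vv]
    change |inner ℝ ((u * s)⁻¹ • (phi 0 n (m + u/2) - phi 0 n (m - u/2))) p| ≤ B
    rw [real_inner_smul_left, inner_sub_left, abs_mul, abs_of_pos (by positivity), inv_mul_le_iff₀ (by positivity)]
    linarith

lemma vv_bound2 {n : ℕ} {s m u m' u' B : ℝ} (hs : 0 < s) (hu : 0 < u) (hu' : 0 < u') (r t : Fin 2)
    (h : ∀ ξ ζ, |ξ - m| ≤ u/2 → |ζ - m'| ≤ u'/2 → |dK r t n ξ ζ| ≤ B * s^((r:ℕ) + t)) : |inner ℝ (vv n s m u r) (vv n s m' u' t)| ≤ B := by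
  refine vv_bound hs hu _ r fun ξ hξ => ?_
  rw [real_inner_comm]
  refine vv_bound hs hu' _ t fun ζ hζ => ?_
  rw [real_inner_comm, inner_phi]
  refine (h ξ ζ hξ hζ).trans (le_of_eq ?_)
  rw [pow_add]; ring

/-- the points of j pairs -/
noncomputable def pts {j : ℕ} (w : Fin j → ℝ × ℝ) (p : Fin 2 × Fin j) : ℝ := ![(w p.2).1 + (w p.2).2/2, (w p.2).1 - (w p.2).2/2] p.1

noncomputable def T2 (c : ℝ) : Matrix (Fin 2) (Fin 2) ℝ := !![1, 0; c, -c]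

lemma T2_det (c : ℝ) : (T2 c).det = -c := by simp [T2, Matrix.det_fin_two]

lemma vv_eq (n : ℕ) (s m u : ℝ) (r : Fin 2) : vv n s m u r = ∑ k, T2 ((u*s)⁻¹) r k • phi 0 n (![m + u/2, m - u/2] k) := by
  fin_cases r
  · simp [vv, T2]
  · simp [vv, T2, sub_eq_add_neg]

lemma block_det (n : ℕ) (s m u : ℝ) : (gm (vv n s m u)).det = ((u*s)⁻¹)^2 * rho2 n (m + u/2) (m - u/2) := by
  have h : vv n s m u = fun r => ∑ k, T2 ((u*s)⁻¹) r k • phi 0 n (![m + u/2, m - u/2] k) := funext fun r => vv_eq n s m u r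
  rw [h, det_gm_T, T2_det, neg_sq]
  congr 1
  rw [Matrix.det_fin_two]
  simp only [gm_apply, inner_phi, rho2, Matrix.cons_val_zero, Matrix.cons_val_one]
  rw [dK_comm 0 0 n (m - u/2) (m + u/2)]; ring

lemma full_det (n : ℕ) (s : ℝ) {j : ℕ} (w : Fin j → ℝ × ℝ) :
    (gm (fun p : Fin 2 × Fin j => vv n s (w p.2).1 (w p.2).2 p.1)).det = (∏ i, (((w i).2*s)⁻¹)^2) * rho n (pts w) := by
  have h : (fun p : Fin 2 × Fin j => vv n s (w p.2).1 (w p.2).2 p.1) =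
      fun p => ∑ q, (Matrix.blockDiagonal fun k : Fin j => T2 (((w k).2*s)⁻¹)) p q • phi 0 n (pts w q) := by
    funext p
    rw [vv_eq, Fintype.sum_prod_type]
    refine Finset.sum_congr rfl fun k _ => ?_
    rw [Finset.sum_eq_single p.2]
    · rw [Matrix.blockDiagonal_apply, if_pos rfl]; rfl
    · intro l _ hl
      rw [Matrix.blockDiagonal_apply, if_neg (Ne.symm hl), zero_smul]
    · intro h; exact absurd (Finset.mem_univ _) h
  rw [h, det_gm_T, Matrix.det_blockDiagonal, ← Finset.prod_pow]
  simp only [T2_det, neg_sq]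
  rfl

theorem pointwise {δ : ℝ} (hδ : 0 < δ) (hδ2 : δ ≤ 2) (j : ℕ) : ∃ C : ℝ, 0 < C ∧ ∀ n : ℕ, 1 ≤ n → ∀ γ : ℝ, 0 < γ → √n * γ ≤ 1 →
    ∀ w : Fin j → ℝ × ℝ, (∀ i, 0 < (w i).2 ∧ (w i).2 ≤ γ) → (∀ i ξ, |ξ - (w i).1| ≤ γ → ξ^2 ≤ (2 - δ) * n) →
    |rho n (pts w) - ∏ i, rho2 n ((w i).1 + (w i).2/2) ((w i).1 - (w i).2/2)| ≤
      C * (n^2 * γ^2)^j * ∑ i, ∑ k, if i = k then 0 else (1 + n * ((w i).1 - (w k).1)^2)⁻¹ := by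
  obtain ⟨D, hD, hmul⟩ := mul_dK hδ hδ2
  obtain ⟨A0, hA0, h00⟩ := dK_abs_le 0 0
  obtain ⟨A1, hA1, h01⟩ := dK_abs_le 0 1
  obtain ⟨A2, hA2, h10⟩ := dK_abs_le 1 0
  obtain ⟨A3, hA3, h11⟩ := dK_abs_le 1 1
  set A := A0 + A1 + A2 + A3 with hA
  have hAp : 0 < A := by positivity
  have hK : ∀ n : ℕ, 1 ≤ n → ∀ (r t : Fin 2) x y, |dK r t n x y| ≤ A * √n * √n^((r:ℕ)+t) := by
    intro n hn r t x y
    have aux : ∀ {q X Y : ℝ}, q ≤ A → X ≤ q * Y * √n → 0 ≤ Y → X ≤ A * √n * Y := by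
      intro q X Y hq hX hY
      refine hX.trans ?_
      calc q * Y * √n ≤ A * Y * √n := by gcongr
        _ = _ := by ring
    fin_cases r <;> fin_cases t
    · exact aux (by linarith) (h00 n hn x y) (by positivity)
    · exact aux (by linarith) (h01 n hn x y) (by positivity)
    · exact aux (by linarith) (h10 n hn x y) (by positivity)
    · exact aux (by linarith) (h11 n hn x y) (by positivity)
  set B := 2 * A + 2 * D with hB
  have hBp : 0 < B := by positivity
  set N : ℝ := ((Fintype.card (Equiv.Perm (Fin 2 × Fin j)) : ℕ) : ℝ) with hN
  have hNp : 0 ≤ N := Nat.cast_nonneg _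
  refine ⟨N * (B^2)^j * 2 + 1, by positivity, fun n hn γ hγ hnγ w hw hbulk => ?_⟩
  have hn' : (1:ℝ) ≤ n := by exact_mod_cast hn
  set s := √(n:ℝ) with hs
  have hsp : 0 < s := Real.sqrt_pos.2 (by linarith)
  have hs2 : s^2 = n := Real.sq_sqrt (by linarith)
  set G := gm (fun p : Fin 2 × Fin j => vv n s (w p.2).1 (w p.2).2 p.1) with hG
  set η : Fin j → Fin j → ℝ := fun i k => (max 1 (s * |(w i).1 - (w k).1|))⁻¹ with hη
  have hmaxp : ∀ i k, 0 < max 1 (s * |(w i).1 - (w k).1|) := fun i k => lt_of_lt_of_le one_pos (le_max_left _ _)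
  have hGb : ∀ a b, |G a b| ≤ B * s := by
    intro a b
    rw [hG, gm_apply]
    refine vv_bound2 hsp (hw _).1 (hw _).1 _ _ fun ξ ζ _ _ => ?_
    refine (hK n hn _ _ ξ ζ).trans ?_
    gcongr
    linarith
  have hGb' : ∀ a b, a.2 ≠ b.2 → |G a b| ≤ B * s * η a.2 b.2 := by
    intro a b _
    rw [hG, gm_apply]
    refine vv_bound2 hsp (hw _).1 (hw _).1 _ _ fun ξ ζ hξ hζ => ?_
    have hξ' : |ξ - (w a.2).1| ≤ γ := hξ.trans (by linarith [(hw a.2).1, (hw a.2).2])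
    have hζ' : |ζ - (w b.2).1| ≤ γ := hζ.trans (by linarith [(hw b.2).1, (hw b.2).2])
    have hp : 0 < s ^ ((a.1:ℕ) + b.1) := by positivity
    set d := |(w a.2).1 - (w b.2).1| with hd
    have hd0 : 0 ≤ d := abs_nonneg _
    have hk := hK n hn a.1 b.1 ξ ζ
    simp only [hη]
    rw [mul_right_comm, ← div_eq_mul_inv, le_div_iff₀ (hmaxp _ _)]
    rcases le_or_gt (s * d) 2 with h2 | h2
    · calc |dK a.1 b.1 n ξ ζ| * max 1 (s * d) ≤ (A * s * s ^ ((a.1:ℕ) + b.1)) * 2 :=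
            mul_le_mul hk (max_le (by norm_num) h2) (hmaxp _ _).le (by positivity)
        _ = (2 * A) * s * s ^ ((a.1:ℕ) + b.1) := by ring
        _ ≤ B * s * s ^ ((a.1:ℕ) + b.1) := by gcongr; linarith
    · have hdg : d ≤ 2 * |ξ - ζ| := by
        have h3 : 2 * γ * s < d * s := by nlinarith
        have h4 : 2 * γ < d := lt_of_mul_lt_mul_right h3 hsp.le
        have hz1 : |ξ - (w a.2).1| ≤ γ/2 := hξ.trans (by linarith [(hw a.2).2])
        have hz2 : |ζ - (w b.2).1| ≤ γ/2 := hζ.trans (by linarith [(hw b.2).2])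
        have h5 : d ≤ |ξ - (w a.2).1| + |ξ - ζ| + |ζ - (w b.2).1| := by
          rw [hd]
          have e : (w a.2).1 - (w b.2).1 = -(ξ - (w a.2).1) + (ξ - ζ) + (ζ - (w b.2).1) := by ring
          rw [e]
          refine (abs_add_le _ _).trans (add_le_add (((abs_add_le _ _)).trans (le_of_eq ?_)) le_rfl)
          rw [abs_neg]
        linarith
      have hm := hmul n hn ξ ζ (hbulk _ ξ hξ') (hbulk _ ζ hζ') a.1 b.1 (by omega) (by omega)
      have hmax : max 1 (s * d) = s * d := max_eq_right (by linarith)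
      rw [hmax]
      calc |dK a.1 b.1 n ξ ζ| * (s * d) ≤ |dK a.1 b.1 n ξ ζ| * (s * (2 * |ξ - ζ|)) := by gcongr
        _ = 2 * s * (|ξ - ζ| * |dK a.1 b.1 n ξ ζ|) := by ring
        _ ≤ 2 * s * (D * s ^ ((a.1:ℕ) + b.1)) := by gcongr
        _ = (2 * D) * s * s ^ ((a.1:ℕ) + b.1) := by ring
        _ ≤ B * s * s ^ ((a.1:ℕ) + b.1) := by gcongr; linarith
  have hbc := block_compare G (B * s) (by positivity) η (fun i k => inv_nonneg.2 (hmaxp i k).le)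
    (fun i k => inv_le_one_of_one_le₀ (le_max_left _ _)) hGb hGb'
  have e1 : ∀ k, (Matrix.of fun i l => G (i,k) (l,k)).det = (((w k).2*s)⁻¹)^2 * rho2 n ((w k).1 + (w k).2/2) ((w k).1 - (w k).2/2) := by
    intro k
    rw [← block_det]; rfl
  have e2 : Fintype.card (Fin 2 × Fin j) = 2 * j := by simp
  simp only [e1] at hbc
  rw [hG, full_det, Finset.prod_mul_distrib, ← mul_sub, abs_mul, e2, ← hN] at hbc
  set P := ∏ i, (((w i).2*s)⁻¹)^2 with hP
  have hPp : 0 < P := Finset.prod_pos fun i _ => by have := (hw i).1; positivity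
  rw [abs_of_pos hPp, ← le_div_iff₀' hPp] at hbc
  refine hbc.trans ?_
  have hPinv : P⁻¹ ≤ (n * γ^2)^j := by
    rw [hP, ← Finset.prod_inv_distrib]
    calc _ ≤ ∏ i : Fin j, (n * γ^2 : ℝ) := by
          refine Finset.prod_le_prod (fun i _ => by positivity) fun i _ => ?_
          rw [inv_pow, inv_inv, mul_pow, hs2, mul_comm]
          have := (hw i).1; have := (hw i).2
          gcongr
      _ = _ := by simp
  have hsum : (∑ i, ∑ k, if i = k then 0 else η i k ^2) ≤ 2 * ∑ i, ∑ k, if i = k then 0 else (1 + n * ((w i).1 - (w k).1)^2)⁻¹ := by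
    rw [Finset.mul_sum]
    refine Finset.sum_le_sum fun i _ => ?_
    rw [Finset.mul_sum]
    refine Finset.sum_le_sum fun k _ => ?_
    split_ifs
    · simp
    · simp only [hη]
      rw [inv_pow, ← div_eq_mul_inv, le_div_iff₀ (by positivity), inv_mul_le_iff₀ (pow_pos (hmaxp i k) 2)]
      have h1 : 1 ≤ max 1 (s * |(w i).1 - (w k).1|)^2 := one_le_pow₀ (le_max_left _ _)
      have h2 : (s * |(w i).1 - (w k).1|)^2 ≤ max 1 (s * |(w i).1 - (w k).1|)^2 :=
        pow_le_pow_left₀ (by positivity) (le_max_right _ _) 2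
      rw [mul_pow, hs2, sq_abs] at h2
      linarith
  set S := ∑ i, ∑ k, if i = k then 0 else (1 + n * ((w i).1 - (w k).1)^2)⁻¹ with hS
  have hS0 : 0 ≤ S := Finset.sum_nonneg fun i _ => Finset.sum_nonneg fun k _ => by split_ifs <;> positivity
  calc _ = N * ((B * s)^(2*j) * (∑ i, ∑ k, if i = k then 0 else η i k ^2)) * P⁻¹ := by rw [div_eq_mul_inv]
    _ ≤ N * ((B * s)^(2*j) * (2 * S)) * (n * γ^2)^j := by
        refine mul_le_mul (by gcongr) hPinv (by positivity) (by positivity)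
    _ = N * (B^2)^j * 2 * (n^2 * γ^2)^j * S := by
        rw [pow_mul, mul_pow B s 2, hs2, mul_pow (B^2) (n:ℝ) j, mul_pow (n:ℝ), mul_pow ((n:ℝ)^2)]; ring
    _ ≤ _ := by gcongr; linarith

end GM

namespace GM

noncomputable def shear (p : ℝ × ℝ) : ℝ × ℝ := (p.1 + p.2/2, p.1 - p.2/2)

lemma measurable_shear : Measurable shear := by unfold shear; fun_prop

lemma mp_shear : MeasurePreserving shear volume volume := by
  refine ⟨measurable_shear, ?_⟩
  ext s hs
  rw [Measure.map_apply measurable_shear hs, ← lintegral_indicator_one hs, ← lintegral_indicator_one (measurable_shear hs)]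
  have hm : Measurable (fun p : ℝ × ℝ => s.indicator (1 : ℝ × ℝ → ℝ≥0∞) p) := measurable_one.indicator hs
  have hm' : Measurable (fun p : ℝ × ℝ => (shear ⁻¹' s).indicator (1 : ℝ × ℝ → ℝ≥0∞) p) := measurable_one.indicator (measurable_shear hs)
  rw [Measure.volume_eq_prod, lintegral_prod_symm _ hm'.aemeasurable, lintegral_prod _ hm.aemeasurable,
    lint_shear (fun x y => s.indicator 1 (x, y)) hm]
  rfl

lemma mp_uncurry (j : ℕ) : MeasurePreserving (fun (w : Fin j → Fin 2 → ℝ) (p : Fin 2 × Fin j) => w p.2 p.1) volume volume := by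
  have hm : Measurable (fun (w : Fin j → Fin 2 → ℝ) (p : Fin 2 × Fin j) => w p.2 p.1) :=
    measurable_pi_lambda _ fun p => (measurable_pi_apply p.1).comp (measurable_pi_apply p.2)
  refine ⟨hm, ?_⟩
  refine (Measure.pi_eq fun s hs => ?_).symm
  rw [Measure.map_apply hm (MeasurableSet.univ_pi hs)]
  have e : (fun (w : Fin j → Fin 2 → ℝ) (p : Fin 2 × Fin j) => w p.2 p.1) ⁻¹' (Set.univ.pi s) = Set.univ.pi (fun i => Set.univ.pi fun r => s (r,i)) := by
    ext w
    simp only [Set.mem_preimage, Set.mem_pi, Set.mem_univ, forall_true_left]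
    exact ⟨fun h i r => h (r,i), fun h p => h p.2 p.1⟩
  rw [e, volume_pi_pi]
  simp only [volume_pi_pi]
  rw [Fintype.prod_prod_type, Finset.prod_comm]

lemma mp_pts (j : ℕ) : MeasurePreserving (fun w : Fin j → ℝ × ℝ => pts w) volume volume := by
  have h1 : MeasurePreserving (fun p : ℝ × ℝ => ![p.1 + p.2/2, p.1 - p.2/2]) volume volume :=
    ((volume_preserving_finTwoArrow ℝ).symm _).comp mp_shear
  have h2 : MeasurePreserving (fun (w : Fin j → ℝ × ℝ) i => ![(w i).1 + (w i).2/2, (w i).1 - (w i).2/2]) volume volume :=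
    volume_preserving_pi (fun _ => h1)
  exact (mp_uncurry j).comp h2

noncomputable def kap (γ a b : ℝ) : Measure (ℝ × ℝ) := (volume.restrict (Set.Icc a b)).prod (volume.restrict (Set.Ioc 0 γ))

lemma kap_eq (γ a b : ℝ) : kap γ a b = volume.restrict (Set.Icc a b ×ˢ Set.Ioc 0 γ) := by
  rw [kap, Measure.prod_restrict, Measure.volume_eq_prod]

instance kap_fin (γ a b : ℝ) : IsFiniteMeasure (kap γ a b) := by
  unfold kap; infer_instance

lemma kap_univ {γ a b : ℝ} : kap γ a b Set.univ = ENNReal.ofReal (b - a) * ENNReal.ofReal γ := by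
  rw [kap, ← Set.univ_prod_univ, Measure.prod_prod]
  simp

noncomputable abbrev kapj (γ a b : ℝ) (j : ℕ) : Measure (Fin j → ℝ × ℝ) := Measure.pi (fun _ => kap γ a b)

lemma kapj_eq (γ a b : ℝ) (j : ℕ) : kapj γ a b j = volume.restrict (Set.univ.pi fun _ => Set.Icc a b ×ˢ Set.Ioc 0 γ) := by
  unfold kapj
  simp only [kap_eq]
  rw [← Measure.restrict_pi_pi]; rfl

lemma kapj_ae (γ a b : ℝ) (j : ℕ) : ∀ᵐ w ∂(kapj γ a b j), ∀ i, (w i).1 ∈ Set.Icc a b ∧ (w i).2 ∈ Set.Ioc 0 γ := by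
  rw [kapj_eq]
  filter_upwards [ae_restrict_mem (MeasurableSet.univ_pi fun _ => measurableSet_Icc.prod measurableSet_Ioc)] with w hw i
  exact hw i (Set.mem_univ i)

lemma FD_pts (γ a b : ℝ) {j : ℕ} (w : Fin j → ℝ × ℝ) : FD γ a b j (pts w) = (Set.univ.pi fun _ : Fin j => Set.Icc a b ×ˢ Set.Ioc 0 γ).indicator 1 w := by
  unfold FD
  have e : (∀ i, Bp γ a b (pts w (0,i)) (pts w (1,i))) ↔ w ∈ (Set.univ.pi fun _ : Fin j => Set.Icc a b ×ˢ Set.Ioc 0 γ) := by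
    simp only [Set.mem_pi, Set.mem_univ, forall_true_left]
    refine forall_congr' fun i => ?_
    refine (Bp_shear (w i).1 (w i).2).trans ?_
    rw [and_comm]; rfl
  by_cases h : w ∈ (Set.univ.pi fun _ : Fin j => Set.Icc a b ×ˢ Set.Ioc 0 γ)
  · rw [ind_true (e.2 h), Set.indicator_of_mem h]; rfl
  · rw [ind_false (mt e.1 h), Set.indicator_of_notMem h]

lemma measurable_pts (j : ℕ) : Measurable (fun w : Fin j → ℝ × ℝ => pts w) := (mp_pts j).measurable

lemma FD_int (γ a b : ℝ) (n j : ℕ) : ∫⁻ y, FD γ a b j y * ENNReal.ofReal (rho n y) = ∫⁻ w, ENNReal.ofReal (rho n (pts w)) ∂(kapj γ a b j) := by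
  have hm : Measurable (fun y => FD γ a b j y * ENNReal.ofReal (rho n y)) := (measurable_FD γ a b j).mul (measurable_rho n)
  rw [← (mp_pts j).lintegral_comp hm, kapj_eq, ← lintegral_indicator (MeasurableSet.univ_pi fun _ => measurableSet_Icc.prod measurableSet_Ioc)]
  refine lintegral_congr fun w => ?_
  rw [FD_pts]
  by_cases h : w ∈ (Set.univ.pi fun _ : Fin j => Set.Icc a b ×ˢ Set.Ioc 0 γ)
  · rw [Set.indicator_of_mem h, Set.indicator_of_mem h]; simp
  · rw [Set.indicator_of_notMem h, Set.indicator_of_notMem h]; simp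

/-- bounded by a power -/
lemma rho_le_fin (n : ℕ) {m : ℕ} (y : Fin m → ℝ) : rho n y ≤ (2 * √n)^m := by
  induction m with
  | zero => simp [rho_fin0]
  | succ m ih =>
    have := rho_cons_le n (y 0) (Fin.tail y)
    rw [Fin.cons_self_tail] at this
    rw [pow_succ]
    exact this.trans (mul_le_mul_of_nonneg_right (ih _) (by positivity))

lemma rho_le (n : ℕ) {ι : Type*} [Fintype ι] [DecidableEq ι] (y : ι → ℝ) : rho n y ≤ (2 * √n)^(Fintype.card ι) := by
  rw [← rho_comp n (Fintype.equivFin ι).symm y]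
  exact rho_le_fin n _

lemma integrable_rho_pts (γ a b : ℝ) (n j : ℕ) : Integrable (fun w => rho n (pts w)) (kapj γ a b j) := by
  refine Integrable.of_bound ((continuous_rho n).measurable.comp (measurable_pts j)).aestronglyMeasurable ((2 * √n)^(Fintype.card (Fin 2 × Fin j))) ?_
  refine Filter.Eventually.of_forall fun w => ?_
  rw [Real.norm_eq_abs, abs_of_nonneg (rho_nonneg _ _)]
  exact rho_le n _

/-- the one-pair intensity -/
noncomputable def m1 (n : ℕ) (γ a b : ℝ) : ℝ := ∫ p, rho2 n (p.1 + p.2/2) (p.1 - p.2/2) ∂(kap γ a b)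

noncomputable def Dj (n : ℕ) (γ a b : ℝ) (j : ℕ) : ℝ := ∫ w, rho n (pts w) ∂(kapj γ a b j)

lemma Dj_nonneg (n : ℕ) (γ a b : ℝ) (j : ℕ) : 0 ≤ Dj n γ a b j := integral_nonneg fun w => rho_nonneg _ _

lemma FD_int' (γ a b : ℝ) (n j : ℕ) : ∫⁻ y, FD γ a b j y * ENNReal.ofReal (rho n y) = ENNReal.ofReal (Dj n γ a b j) := by
  rw [FD_int, Dj, ofReal_integral_eq_lintegral_ofReal (integrable_rho_pts γ a b n j) (Filter.Eventually.of_forall fun w => rho_nonneg _ _)]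

lemma continuous_rho2 (n : ℕ) : Continuous (fun p : ℝ × ℝ => rho2 n p.1 p.2) := by
  unfold rho2
  have h := continuous_dK 0 0 n
  exact ((h.comp (f := fun p : ℝ × ℝ => (p.1, p.1)) (by fun_prop)).mul (h.comp (f := fun p : ℝ × ℝ => (p.2, p.2)) (by fun_prop))).sub (h.pow 2)

lemma continuous_rho2s (n : ℕ) : Continuous (fun p : ℝ × ℝ => rho2 n (p.1 + p.2/2) (p.1 - p.2/2)) :=
  (continuous_rho2 n).comp (f := fun p : ℝ × ℝ => (p.1 + p.2/2, p.1 - p.2/2)) (by fun_prop)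

/-- continuous functions are integrable -/
lemma kap_integrable (γ a b : ℝ) {f : ℝ × ℝ → ℝ} (hf : Continuous f) : Integrable f (kap γ a b) := by
  rw [kap_eq]
  have h : IntegrableOn f (Set.Icc a b ×ˢ Set.Icc 0 γ) := hf.continuousOn.integrableOn_compact (isCompact_Icc.prod isCompact_Icc)
  exact h.mono_set (Set.prod_mono le_rfl Set.Ioc_subset_Icc_self)

lemma kapj_integrable (γ a b : ℝ) (j : ℕ) {f : (Fin j → ℝ × ℝ) → ℝ} (hf : Continuous f) : Integrable f (kapj γ a b j) := by
  rw [kapj_eq]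
  have h : IntegrableOn f (Set.univ.pi fun _ : Fin j => Set.Icc a b ×ˢ Set.Icc 0 γ) :=
    hf.continuousOn.integrableOn_compact (isCompact_univ_pi fun _ => isCompact_Icc.prod isCompact_Icc)
  exact h.mono_set (Set.pi_mono fun _ _ => Set.prod_mono le_rfl Set.Ioc_subset_Icc_self)

lemma prod_int (n : ℕ) (γ a b : ℝ) (j : ℕ) : ∫ w, ∏ i, rho2 n ((w i).1 + (w i).2/2) ((w i).1 - (w i).2/2) ∂(kapj γ a b j) = m1 n γ a b ^ j := by
  have := integral_fintype_prod_eq_pow (ι := Fin j) (μ := kap γ a b) (fun p : ℝ × ℝ => rho2 n (p.1 + p.2/2) (p.1 - p.2/2))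
  rw [Fintype.card_fin] at this
  exact this

lemma int_lorentz {n : ℕ} (hn : 1 ≤ n) {γ : ℝ} (hγ : 0 < γ) (a b c : ℝ) : ∫⁻ p, ENNReal.ofReal ((1 + n * (c - p.1)^2)⁻¹) ∂(kap γ a b) ≤ ENNReal.ofReal (4 * γ / √n) := by
  have hn' : (1:ℝ) ≤ n := by exact_mod_cast hn
  have hsp : 0 < √(n:ℝ) := Real.sqrt_pos.2 (by linarith)
  have hm : Measurable (fun x : ℝ => ENNReal.ofReal ((1 + n * (c - x)^2)⁻¹)) := by fun_prop
  have hb : ∫⁻ x, ENNReal.ofReal ((1 + n * (c - x)^2)⁻¹) ≤ ENNReal.ofReal (4 / √n) := by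
    have e : ∀ x : ℝ, (1 + n * (c - x)^2)⁻¹ = (1 + (√n * (c - x))^2)⁻¹ := fun x => by
      rw [mul_pow, Real.sq_sqrt (by linarith)]
    simp only [e]
    have hi : Integrable (fun x : ℝ => (1 + (√n * x)^2)⁻¹) := integrable_inv_one_add_sq.comp_mul_left' hsp.ne'
    rw [lintegral_sub_left_eq_self (fun x => ENNReal.ofReal ((1 + (√n * x)^2)⁻¹)) c,
      ← ofReal_integral_eq_lintegral_ofReal hi (Filter.Eventually.of_forall fun x => by positivity)]
    refine ENNReal.ofReal_le_ofReal ?_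
    rw [Measure.integral_comp_mul_left (fun x : ℝ => (1 + x^2)⁻¹), integral_univ_inv_one_add_sq, abs_of_pos (by positivity), smul_eq_mul, div_eq_inv_mul]
    gcongr
    exact Real.pi_le_four
  calc _ = ∫⁻ p, ENNReal.ofReal ((1 + n * (c - p.1)^2)⁻¹) * (1 : ℝ≥0∞) ∂(kap γ a b) := by simp
    _ = (∫⁻ x in Set.Icc a b, ENNReal.ofReal ((1 + n * (c - x)^2)⁻¹)) * ENNReal.ofReal γ := by
        rw [kap, lintegral_prod_mul (f := fun x : ℝ => ENNReal.ofReal ((1 + n * (c - x)^2)⁻¹)) (g := fun _ => 1) hm.aemeasurable measurable_const.aemeasurable]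
        simp
    _ ≤ ENNReal.ofReal (4 / √n) * ENNReal.ofReal γ := mul_le_mul_left ((setLIntegral_le_lintegral _ _).trans hb) _
    _ = _ := by rw [← ENNReal.ofReal_mul (by positivity)]; congr 1; ring

lemma int_pair {n : ℕ} (hn : 1 ≤ n) {γ a b : ℝ} (hγ : 0 < γ) (hab : a ≤ b) {j : ℕ} (i k : Fin (j+1)) (hik : i ≠ k) :
    ∫⁻ w, ENNReal.ofReal ((1 + n * ((w i).1 - (w k).1)^2)⁻¹) ∂(kapj γ a b (j+1)) ≤ ENNReal.ofReal (4 * γ / √n * ((b - a) * γ)^j) := by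
  obtain ⟨l, hl⟩ := Fin.exists_succAbove_eq hik
  have h := (measurePreserving_piFinSuccAbove (fun _ : Fin (j+1) => kap γ a b) k).symm
  unfold kapj
  rw [← h.lintegral_comp_emb (MeasurableEquiv.measurableEmbedding _), lintegral_prod_symm]
  · calc _ = ∫⁻ y : Fin j → ℝ × ℝ, ∫⁻ p, ENNReal.ofReal ((1 + n * ((y l).1 - p.1)^2)⁻¹) ∂(kap γ a b) ∂(Measure.pi fun _ => kap γ a b) := by
          refine lintegral_congr fun y => lintegral_congr fun p => ?_
          have e1 : (MeasurableEquiv.piFinSuccAbove (fun _ : Fin (j+1) => ℝ × ℝ) k).symm (p, y) i = y l := by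
            rw [← hl]
            change Fin.insertNth (α := fun _ => ℝ × ℝ) k p y _ = _
            simp
          have e2 : (MeasurableEquiv.piFinSuccAbove (fun _ : Fin (j+1) => ℝ × ℝ) k).symm (p, y) k = p := by
            change Fin.insertNth (α := fun _ => ℝ × ℝ) k p y _ = _
            simp
          rw [e1, e2]
      _ ≤ ∫⁻ y : Fin j → ℝ × ℝ, ENNReal.ofReal (4 * γ / √n) ∂(Measure.pi fun _ => kap γ a b) := lintegral_mono fun y => int_lorentz hn hγ a b _
      _ = _ := by
          have := sub_nonneg.2 hab
          rw [lintegral_const, Measure.pi_univ, Finset.prod_const, Finset.card_univ, Fintype.card_fin, kap_univ, ← ENNReal.ofReal_mul this,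
            ← ENNReal.ofReal_pow (by positivity), ← ENNReal.ofReal_mul (by positivity)]
  · refine Measurable.aemeasurable ?_
    have h1 : Measurable (fun w : Fin (j+1) → ℝ × ℝ => ENNReal.ofReal ((1 + n * ((w i).1 - (w k).1)^2)⁻¹)) := by fun_prop
    exact h1.comp (MeasurableEquiv.measurable _)

end GM

namespace GM

lemma int_pair_real {n : ℕ} (hn : 1 ≤ n) {γ a b : ℝ} (hγ : 0 < γ) (hab : a ≤ b) {j : ℕ} (i k : Fin (j+1)) (hik : i ≠ k) :
    ∫ w, (1 + n * ((w i).1 - (w k).1)^2)⁻¹ ∂(kapj γ a b (j+1)) ≤ 4 * γ / √n * ((b - a) * γ)^j := by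
  have hm : Measurable (fun w : Fin (j+1) → ℝ × ℝ => (1 + n * ((w i).1 - (w k).1)^2)⁻¹) := by fun_prop
  have hba := sub_nonneg.2 hab
  rw [integral_eq_lintegral_of_nonneg_ae (Filter.Eventually.of_forall fun w => by positivity) hm.aestronglyMeasurable]
  exact ENNReal.toReal_le_of_le_ofReal (by positivity) (int_pair hn hγ hab i k hik)

def Bulk (δ : ℝ) (n : ℕ) (γ a b : ℝ) : Prop := ∀ x ∈ Set.Icc a b, ∀ ξ, |ξ - x| ≤ γ → ξ^2 ≤ (2-δ)*n

lemma continuous_lor (n : ℕ) {j : ℕ} (i k : Fin j) : Continuous (fun w : Fin j → ℝ × ℝ => if i = k then (0:ℝ) else (1 + n * ((w i).1 - (w k).1)^2)⁻¹) := by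
  split_ifs
  · exact continuous_const
  · exact Continuous.inv₀ (by fun_prop) fun w => by positivity

lemma Dj_m1 {δ : ℝ} (hδ : 0 < δ) (hδ2 : δ ≤ 2) (j : ℕ) : ∃ C > 0, ∀ n : ℕ, 1 ≤ n → ∀ γ a b : ℝ, 0 < γ → √n * γ ≤ 1 → a ≤ b → Bulk δ n γ a b →
    |Dj n γ a b j - m1 n γ a b ^ j| * (√n * (b - a)) ≤ C * th n γ a b ^ j := by
  obtain ⟨C, hC, h⟩ := pointwise hδ hδ2 j
  refine ⟨C * (4 * (j * j : ℕ) + 1), by positivity, fun n hn γ a b hγ hg hab hB => ?_⟩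
  have hn' : (1:ℝ) ≤ n := by exact_mod_cast hn
  have hsp : 0 < √(n:ℝ) := Real.sqrt_pos.2 (by linarith)
  have hba := sub_nonneg.2 hab
  have hcp : Continuous (fun w : Fin j → ℝ × ℝ => ∏ i, rho2 n ((w i).1 + (w i).2/2) ((w i).1 - (w i).2/2)) := by
    refine continuous_finsetProd _ fun i _ => ?_
    exact (continuous_rho2s n).comp (continuous_apply i)
  have hcs : Continuous (fun w : Fin j → ℝ × ℝ => ∑ i, ∑ k, if i = k then (0:ℝ) else (1 + n * ((w i).1 - (w k).1)^2)⁻¹) :=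
    continuous_finsetSum _ fun i _ => continuous_finsetSum _ fun k _ => continuous_lor n i k
  have h1 : |Dj n γ a b j - m1 n γ a b ^ j| ≤ C * (n^2*γ^2)^j * ∑ i : Fin j, ∑ k : Fin j, ∫ w, (if i = k then (0:ℝ) else (1 + n * ((w i).1 - (w k).1)^2)⁻¹) ∂(kapj γ a b j) := by
    rw [← prod_int, Dj, ← integral_sub (integrable_rho_pts γ a b n j) (kapj_integrable γ a b j hcp)]
    refine (abs_integral_le_integral_abs).trans ?_
    have e : ∑ i : Fin j, ∑ k : Fin j, ∫ w, (if i = k then (0:ℝ) else (1 + n * ((w i).1 - (w k).1)^2)⁻¹) ∂(kapj γ a b j)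
       = ∫ w, (∑ i, ∑ k, if i = k then (0:ℝ) else (1 + n * ((w i).1 - (w k).1)^2)⁻¹) ∂(kapj γ a b j) := by
      rw [integral_finsetSum _ fun i _ => kapj_integrable γ a b j (continuous_finsetSum _ fun k _ => continuous_lor n i k)]
      refine Finset.sum_congr rfl fun i _ => ?_
      rw [integral_finsetSum _ fun k _ => kapj_integrable γ a b j (continuous_lor n i k)]
    rw [e, ← integral_const_mul]
    refine integral_mono_ae ((integrable_rho_pts γ a b n j).sub (kapj_integrable γ a b j hcp)).abs ((kapj_integrable γ a b j hcs).const_mul _) ?_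
    filter_upwards [kapj_ae γ a b j] with w hw
    exact h n hn γ hγ hg w (fun i => (hw i).2) (fun i ξ hξ => hB _ (hw i).1 ξ hξ)
  rcases j with _ | j
  · simp at h1 ⊢
    rw [h1]; simp; positivity
  have h2 : ∑ i : Fin (j+1), ∑ k : Fin (j+1), ∫ w, (if i = k then (0:ℝ) else (1 + n * ((w i).1 - (w k).1)^2)⁻¹) ∂(kapj γ a b (j+1)) ≤ ((j+1)*(j+1) : ℕ) * (4 * γ / √n * ((b - a) * γ)^j) := by
    calc _ ≤ ∑ i : Fin (j+1), ∑ k : Fin (j+1), 4 * γ / √n * ((b - a) * γ)^j := by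
          refine Finset.sum_le_sum fun i _ => Finset.sum_le_sum fun k _ => ?_
          by_cases hik : i = k
          · simp only [hik, if_true, integral_zero]; positivity
          · simp only [hik, if_false]; exact int_pair_real hn hγ hab i k hik
      _ = _ := by simp [mul_assoc]
  have h3 := h1.trans (mul_le_mul_of_nonneg_left h2 (by positivity))
  calc _ ≤ C * (n^2*γ^2)^(j+1) * (((j+1)*(j+1) : ℕ) * (4 * γ / √n * ((b - a) * γ)^j)) * (√n * (b-a)) :=
        mul_le_mul_of_nonneg_right h3 (by positivity)
    _ = C * (4 * ((j+1)*(j+1) : ℕ)) * th n γ a b ^ (j+1) := by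
        unfold th
        generalize b - a = L
        field_simp
        try ring
    _ ≤ _ := by
        have := pow_nonneg (th_nonneg (n := n) hγ hab) (j+1)
        gcongr; linarith

noncomputable def mu (n : ℕ) (γ a b : ℝ) : ℝ := π^2 * γ^3 / 9 * ∫ x in Set.Icc a b, dK 0 0 n x x ^ 4

lemma continuous_dKd (r s n : ℕ) : Continuous (fun x : ℝ => dK r s n x x) := (continuous_dK r s n).comp (f := fun x : ℝ => (x, x)) (by fun_prop)

lemma mu_eq (n : ℕ) {γ : ℝ} (hγ : 0 < γ) (a b : ℝ) : ∫ p, (π^2/3 * dK 0 0 n p.1 p.1 ^ 4) * p.2^2 ∂(kap γ a b) = mu n γ a b := by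
  rw [kap, integral_prod_mul (fun x : ℝ => π^2/3 * dK 0 0 n x x ^ 4) (fun u : ℝ => u^2), ← intervalIntegral.integral_of_le hγ.le, integral_pow, integral_const_mul, mu]
  norm_num
  ring

lemma kap_ae (γ a b : ℝ) : ∀ᵐ p ∂(kap γ a b), p.1 ∈ Set.Icc a b ∧ p.2 ∈ Set.Ioc 0 γ := by
  rw [kap_eq]
  filter_upwards [ae_restrict_mem (measurableSet_Icc.prod measurableSet_Ioc)] with w hw
  exact hw

lemma m1_mu {δ : ℝ} (hδ : 0 < δ) (hδ2 : δ ≤ 2) : ∃ C > 0, ∀ n : ℕ, 1 ≤ n → ∀ γ a b : ℝ, 0 < γ → a ≤ b → Bulk δ n γ a b →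
    |m1 n γ a b - mu n γ a b| ≤ C * (th n γ a b * ((n:ℝ)⁻¹ + n * γ^2)) := by
  obtain ⟨C1, hC1, h1⟩ := rho2_expand
  obtain ⟨C2, hC2, h2⟩ := W_bound hδ hδ2
  refine ⟨C1 + C2, by positivity, fun n hn γ a b hγ hab hB => ?_⟩
  have hn' : (1:ℝ) ≤ n := by exact_mod_cast hn
  have hba := sub_nonneg.2 hab
  have hc : Continuous (fun p : ℝ × ℝ => (π^2/3 * dK 0 0 n p.1 p.1 ^ 4) * p.2^2) := by
    have := (continuous_dKd 0 0 n).comp (continuous_fst (X := ℝ) (Y := ℝ))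
    exact (continuous_const.mul (this.pow 4)).mul (continuous_snd.pow 2)
  have hi1 := kap_integrable γ a b (continuous_rho2s n)
  have hi2 := kap_integrable γ a b hc
  have hθ := th_nonneg (n := n) hγ hab
  calc _ ≤ ∫ p, |rho2 n (p.1 + p.2/2) (p.1 - p.2/2) - (π^2/3 * dK 0 0 n p.1 p.1 ^ 4) * p.2^2| ∂(kap γ a b) := by
        rw [← mu_eq n hγ, m1, ← integral_sub hi1 hi2]
        exact abs_integral_le_integral_abs
    _ ≤ ∫ p, (C1 * n^3 * γ^4 + C2 * n * γ^2) ∂(kap γ a b) := by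
        refine integral_mono_ae (hi1.sub hi2).abs (integrable_const _) ?_
        filter_upwards [kap_ae γ a b] with p hp
        have g1 := h1 n hn p.1 p.2
        have g2 := h2 n hn p.1 (hB p.1 hp.1 p.1 (by simpa using hγ.le))
        have hu : p.2^2 ≤ γ^2 := pow_le_pow_left₀ hp.2.1.le hp.2.2 2
        have hu4 : p.2^4 ≤ γ^4 := pow_le_pow_left₀ hp.2.1.le hp.2.2 4
        set W := dK 0 0 n p.1 p.1 * dK 1 1 n p.1 p.1 - dK 1 0 n p.1 p.1 ^2
        have e : rho2 n (p.1 + p.2/2) (p.1 - p.2/2) - (π^2/3 * dK 0 0 n p.1 p.1 ^ 4) * p.2^2 =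
          (rho2 n (p.1 + p.2/2) (p.1 - p.2/2) - p.2^2 * W) + p.2^2 * (W - π^2/3 * dK 0 0 n p.1 p.1 ^ 4) := by ring
        have g3 : |p.2^2 * (W - π^2/3 * dK 0 0 n p.1 p.1 ^ 4)| ≤ γ^2 * (C2 * n) := by
          rw [abs_mul, abs_of_nonneg (sq_nonneg p.2)]
          exact mul_le_mul hu g2 (abs_nonneg _) (sq_nonneg _)
        have g4 : C1 * n^3 * p.2^4 ≤ C1 * n^3 * γ^4 := mul_le_mul_of_nonneg_left hu4 (by positivity)
        change |_| ≤ _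
        rw [e]
        refine (abs_add_le _ _).trans ?_
        linarith
    _ = (C1 * n^3 * γ^4 + C2 * n * γ^2) * ((b - a) * γ) := by
        rw [integral_const, smul_eq_mul, Measure.real, kap_univ, ENNReal.toReal_mul, ENNReal.toReal_ofReal hba, ENNReal.toReal_ofReal hγ.le]; ring
    _ = C1 * (th n γ a b * (n * γ^2)) + C2 * (th n γ a b * (n:ℝ)⁻¹) := by
        unfold th; field_simp
    _ ≤ _ := by
        have e1 : 0 ≤ C1 * (th n γ a b * (n:ℝ)⁻¹) := by positivity
        have e2 : 0 ≤ C2 * (th n γ a b * (n * γ^2)) := by positivity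
        nlinarith

lemma mu_le {n : ℕ} {γ a b : ℝ} (hγ : 0 < γ) (hab : a ≤ b) : mu n γ a b ≤ 16 * π^2 * th n γ a b := by
  have hba := sub_nonneg.2 hab
  have h : ∫ x in Set.Icc a b, dK 0 0 n x x ^ 4 ≤ ∫ x in Set.Icc a b, (16 * n^2 : ℝ) := by
    refine setIntegral_mono (((continuous_dKd 0 0 n).pow 4).integrableOn_Icc) (integrableOn_const (by simp)) fun x => ?_
    have h1 := pow_le_pow_left₀ (dK_self_nonneg 0 n x) (Q_le' n x) 4
    have e : (2 * √(n:ℝ))^4 = 16 * n^2 := by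
      rw [mul_pow, show √(n:ℝ)^4 = (√(n:ℝ)^2)^2 by ring, Real.sq_sqrt (Nat.cast_nonneg n)]; norm_num
    rwa [e] at h1
  rw [setIntegral_const, smul_eq_mul, Measure.real, Real.volume_Icc, ENNReal.toReal_ofReal hba] at h
  unfold mu th
  calc _ ≤ π^2 * γ^3 / 9 * ((b-a) * (16 * n^2)) := mul_le_mul_of_nonneg_left h (by positivity)
    _ ≤ _ := by
      have : 0 ≤ π^2 * (n^2 * γ^3 * (b-a)) := by positivity
      nlinarith

lemma mu_ge {δ : ℝ} (hδ : 0 < δ) (hδ2 : δ ≤ 2) : ∃ c > 0, ∀ n : ℕ, 1 ≤ n → ∀ γ a b : ℝ, 0 < γ → a ≤ b → (∀ x ∈ Set.Icc a b, x^2 ≤ (2-δ)*n) →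
    c * th n γ a b ≤ mu n γ a b := by
  obtain ⟨c, hc, h⟩ := Q_lower hδ hδ2
  refine ⟨π^2 / 9 * c^4, by positivity, fun n hn γ a b hγ hab hB => ?_⟩
  have hba := sub_nonneg.2 hab
  have h : ∫ x in Set.Icc a b, (c^4 * n^2 : ℝ) ≤ ∫ x in Set.Icc a b, dK 0 0 n x x ^ 4 := by
    refine setIntegral_mono_on (integrableOn_const (by simp)) (((continuous_dKd 0 0 n).pow 4).integrableOn_Icc) measurableSet_Icc fun x hx => ?_
    have h1 := pow_le_pow_left₀ (by positivity) (h n hn x (hB x hx)) 4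
    have e : (c * √(n:ℝ))^4 = c^4 * n^2 := by
      rw [mul_pow, show √(n:ℝ)^4 = (√(n:ℝ)^2)^2 by ring, Real.sq_sqrt (Nat.cast_nonneg n)]
    rwa [e] at h1
  rw [setIntegral_const, smul_eq_mul, Measure.real, Real.volume_Icc, ENNReal.toReal_ofReal hba] at h
  unfold mu th
  calc _ = π^2 * γ^3 / 9 * ((b-a) * (c^4 * n^2)) := by ring
    _ ≤ _ := mul_le_mul_of_nonneg_left h (by positivity)

end GM

namespace GM

lemma pow_le_add {t : ℝ} (ht : 0 ≤ t) {j k : ℕ} (hj : 1 ≤ j) (hjk : j ≤ k) : t^j ≤ t + t^k := by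
  rcases le_total t 1 with h | h
  · have := pow_le_pow_of_le_one ht h hj
    have := pow_nonneg ht k
    simp at *; linarith
  · have := pow_le_pow_right₀ h hjk
    linarith

lemma pow_le_add' {t : ℝ} (ht : 0 ≤ t) {k : ℕ} (hk : 1 ≤ k) : t * (1+t)^(k-1) ≤ 2^k * (t + t^k) := by
  obtain ⟨k, rfl⟩ := Nat.exists_eq_add_of_le' hk
  simp only [Nat.add_sub_cancel]
  have h0 := pow_nonneg ht (k+1)
  have h2 : (2:ℝ)^k ≤ 2^(k+1) := pow_le_pow_right₀ (by norm_num) (by omega)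
  rcases le_total t 1 with h | h
  · have : (1+t)^k ≤ 2^k := pow_le_pow_left₀ (by linarith) (by linarith) k
    calc _ ≤ t * 2^(k+1) := by gcongr; exact this.trans h2
      _ ≤ _ := by nlinarith [pow_pos (two_pos (α := ℝ)) (k+1)]
  · have : (1+t)^k ≤ (2*t)^k := pow_le_pow_left₀ (by linarith) (by linarith) k
    calc _ ≤ t * (2*t)^k := by gcongr
      _ = 2^k * t^(k+1) := by ring
      _ ≤ _ := by gcongr; linarith

noncomputable def ej (n : ℕ) (γ a b : ℝ) (j : ℕ) : ℝ := (∫⁻ x, ((GG γ a b x).descFactorial j : ℝ≥0∞) ∂(Pn n)).toReal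

lemma ej_Dj (j : ℕ) : ∃ C > 0, ∀ n : ℕ, 1 ≤ n → ∀ γ a b : ℝ, 0 < γ → a ≤ b →
    (∫⁻ x, ((GG γ a b x).descFactorial j : ℝ≥0∞) ∂(Pn n)) ≠ ∞ ∧
    |ej n γ a b j - Dj n γ a b j| ≤ C * (th n γ a b * (n * √n * γ^3) * (1 + th n γ a b)^(j-2)) := by
  obtain ⟨C, hC, h⟩ := descG j
  refine ⟨C, hC, fun n hn γ a b hγ hab => ?_⟩
  obtain ⟨h1, h2⟩ := h n hn γ a b hγ hab
  have hθ := th_nonneg (n := n) hγ hab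
  have hR : 0 ≤ C * (th n γ a b * (n * √n * γ^3) * (1 + th n γ a b)^(j-2)) := by positivity
  rw [FD_int'] at h1 h2
  rw [← ENNReal.ofReal_add (Dj_nonneg _ _ _ _ _) hR] at h2
  have hfin : (∫⁻ x, ((GG γ a b x).descFactorial j : ℝ≥0∞) ∂(Pn n)) ≠ ∞ := (h2.trans_lt ENNReal.ofReal_lt_top).ne
  refine ⟨hfin, ?_⟩
  have h1' : Dj n γ a b j ≤ ej n γ a b j := (ENNReal.ofReal_le_iff_le_toReal hfin).1 h1
  have h2' : ej n γ a b j ≤ _ := ENNReal.toReal_le_of_le_ofReal (add_nonneg (Dj_nonneg _ _ _ _ _) hR) h2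
  rw [abs_of_nonneg (by linarith)]; linarith

/-- falling-factorial moments in the main regime -/
lemma ej_mu {δ : ℝ} (hδ : 0 < δ) (hδ2 : δ ≤ 2) {j k : ℕ} (hj : 1 ≤ j) (hjk : j ≤ k) : ∃ C > 0, ∀ n : ℕ, 1 ≤ n → ∀ γ a b : ℝ, 0 < γ → √n * γ ≤ 1 → 1 ≤ √n * (b - a) → Bulk δ n γ a b →
    |ej n γ a b j - mu n γ a b ^ j| ≤ C * ((th n γ a b + th n γ a b ^ k) * ((n:ℝ)⁻¹ + n * γ^2 + (√n * (b - a))⁻¹)) := by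
  obtain ⟨C1, hC1, h1⟩ := ej_Dj j
  obtain ⟨C2, hC2, h2⟩ := Dj_m1 hδ hδ2 j
  obtain ⟨C3, hC3, h3⟩ := m1_mu hδ hδ2
  set C4 := 16 * π^2 + 2 * C3 with hC4
  have hC4p : 0 < C4 := by positivity
  refine ⟨C1 * 2^k + C2 + j * C4^(j-1) * C3, by positivity, fun n hn γ a b hγ hg hL hB => ?_⟩
  have hn' : (1:ℝ) ≤ n := by exact_mod_cast hn
  have hsp : 0 < √(n:ℝ) := Real.sqrt_pos.2 (by linarith)
  have hba : 0 < b - a := by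
    by_contra hc
    have : √(n:ℝ) * (b-a) ≤ 0 := mul_nonpos_of_nonneg_of_nonpos hsp.le (not_lt.1 hc)
    linarith
  have hab : a ≤ b := by linarith
  have g1 := (h1 n hn γ a b hγ hab).2
  have g2 := h2 n hn γ a b hγ hg hab hB
  have g3 := h3 n hn γ a b hγ hab hB
  have g4 := mu_le (n := n) hγ hab
  have hθ := th_nonneg (n := n) hγ hab
  set θ := th n γ a b
  set L := √(n:ℝ) * (b-a)
  have hng : (n:ℝ) * γ^2 = (√n * γ)^2 := by rw [mul_pow, Real.sq_sqrt (by linarith)]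
  have hng1 : (n:ℝ) * γ^2 ≤ 1 := by rw [hng]; exact pow_le_one₀ (by positivity) hg
  have hni : (n:ℝ)⁻¹ ≤ 1 := inv_le_one_of_one_le₀ hn'
  have hni0 : 0 ≤ (n:ℝ)⁻¹ := by positivity
  have hng0 : 0 ≤ (n:ℝ) * γ^2 := by positivity
  have hLi : 0 ≤ L⁻¹ := by positivity
  have hS : 0 ≤ θ + θ^k := by positivity
  have hθj := pow_le_add hθ hj hjk
  have k1 : |ej n γ a b j - Dj n γ a b j| ≤ C1 * 2^k * ((θ + θ^k) * (n * γ^2)) := by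
    refine g1.trans ?_
    have e1 : n * √n * γ^3 ≤ n * γ^2 := by
      calc n * √n * γ^3 = n * γ^2 * (√n * γ) := by ring
        _ ≤ n * γ^2 * 1 := by gcongr
        _ = _ := by ring
    have e2 : (1 + θ)^(j-2) ≤ (1+θ)^(k-1) := pow_le_pow_right₀ (by linarith) (by omega)
    calc C1 * (θ * (n * √n * γ^3) * (1 + θ)^(j-2)) ≤ C1 * (θ * (n * γ^2) * (1 + θ)^(k-1)) := by gcongr
      _ = C1 * (θ * (1 + θ)^(k-1)) * (n * γ^2) := by ring
      _ ≤ C1 * (2^k * (θ + θ^k)) * (n * γ^2) :=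
          mul_le_mul_of_nonneg_right (mul_le_mul_of_nonneg_left (pow_le_add' hθ (hj.trans hjk)) hC1.le) hng0
      _ = _ := by ring
  have k2 : |Dj n γ a b j - m1 n γ a b ^ j| ≤ C2 * ((θ + θ^k) * L⁻¹) := by
    have hL0 : 0 < L := by linarith
    rw [← le_div_iff₀ hL0] at g2
    refine g2.trans ?_
    rw [div_eq_mul_inv, mul_assoc]
    gcongr
  have hmu0 : 0 ≤ mu n γ a b := by
    unfold mu
    have : 0 ≤ ∫ x in Set.Icc a b, dK 0 0 n x x ^ 4 := integral_nonneg fun x => by positivity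
    positivity
  have k3 : |m1 n γ a b ^ j - mu n γ a b ^ j| ≤ j * C4^(j-1) * C3 * ((θ + θ^k) * ((n:ℝ)⁻¹ + n * γ^2)) := by
    have m1b : |m1 n γ a b| ≤ C4 * θ := by
      have : |m1 n γ a b| ≤ |m1 n γ a b - mu n γ a b| + |mu n γ a b| := by
        have := abs_add_le (m1 n γ a b - mu n γ a b) (mu n γ a b); simpa using this
      rw [abs_of_nonneg hmu0] at this
      have e : C3 * (θ * ((n:ℝ)⁻¹ + n * γ^2)) ≤ C3 * (θ * 2) := by gcongr; linarith
      rw [hC4]; linarith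
    have mub : |mu n γ a b| ≤ C4 * θ := by
      rw [abs_of_nonneg hmu0, hC4]; nlinarith [mul_nonneg hC3.le hθ]
    refine (abs_pow_sub_pow_le _ _ _).trans ?_
    have e : θ^(j-1) * θ = θ^j := by rw [← pow_succ]; congr 1; omega
    calc |m1 n γ a b - mu n γ a b| * j * max |m1 n γ a b| |mu n γ a b| ^ (j-1)
        ≤ (C3 * (θ * ((n:ℝ)⁻¹ + n * γ^2))) * j * (C4 * θ)^(j-1) := by
          gcongr
          exact max_le m1b mub
      _ = j * C4^(j-1) * C3 * ((θ^(j-1) * θ) * ((n:ℝ)⁻¹ + n * γ^2)) := by ring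
      _ ≤ _ := by rw [e]; gcongr
  have tri : |ej n γ a b j - mu n γ a b ^ j| ≤ |ej n γ a b j - Dj n γ a b j| + |Dj n γ a b j - m1 n γ a b ^ j| + |m1 n γ a b ^ j - mu n γ a b ^ j| := by
    refine (abs_sub_le _ (m1 n γ a b ^ j) _).trans ?_
    gcongr
    exact abs_sub_le _ _ _
  refine tri.trans ?_
  have f1 : C1 * 2^k * ((θ + θ^k) * (n * γ^2)) ≤ C1 * 2^k * ((θ + θ^k) * ((n:ℝ)⁻¹ + n * γ^2 + L⁻¹)) := by gcongr; linarith
  have f2 : C2 * ((θ + θ^k) * L⁻¹) ≤ C2 * ((θ + θ^k) * ((n:ℝ)⁻¹ + n * γ^2 + L⁻¹)) := by gcongr; linarith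
  have f3 : j * C4^(j-1) * C3 * ((θ + θ^k) * ((n:ℝ)⁻¹ + n * γ^2)) ≤ j * C4^(j-1) * C3 * ((θ + θ^k) * ((n:ℝ)⁻¹ + n * γ^2 + L⁻¹)) :=
    mul_le_mul_of_nonneg_left (mul_le_mul_of_nonneg_left (by linarith) hS) (by positivity)
  calc _ ≤ _ := add_le_add (add_le_add (k1.trans f1) (k2.trans f2)) (k3.trans f3)
    _ = _ := by ring

end GM

namespace GM

noncomputable def Mom (k : ℕ) (μ : ℝ) : ℝ := ∑ j ∈ Finset.range (k+1), (Nat.stirlingSecond k j : ℝ) * μ^j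

lemma Mom_ge {k : ℕ} {μ : ℝ} (hμ : 0 ≤ μ) {j : ℕ} (hj : j ≤ k) (hs : Nat.stirlingSecond k j = 1) : μ^j ≤ Mom k μ := by
  have := Finset.single_le_sum (f := fun j => (Nat.stirlingSecond k j : ℝ) * μ^j) (s := Finset.range (k+1)) (fun i _ => by positivity) (Finset.mem_range.2 (Nat.lt_succ_of_le hj))
  simpa [hs, Mom] using this

lemma Mom_lower {k : ℕ} (hk : 1 ≤ k) {c t μ : ℝ} (hc : 0 < c) (hc1 : c ≤ 1) (ht : 0 ≤ t) (h : c * t ≤ μ) : c^k * (t + t^k) ≤ 2 * Mom k μ := by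
  have hμ : 0 ≤ μ := le_trans (by positivity) h
  have h1 := Mom_ge hμ hk (by obtain ⟨k, rfl⟩ := Nat.exists_eq_add_of_le' hk; exact Nat.stirlingSecond_one_right k)
  have h2 := Mom_ge hμ le_rfl (Nat.stirlingSecond_self k)
  have h3 : c^k * t ≤ μ^1 := by
    have : c^k ≤ c := by simpa using pow_le_pow_of_le_one hc.le hc1 hk
    rw [pow_one]; exact (mul_le_mul_of_nonneg_right this ht).trans h
  have h4 : c^k * t^k ≤ μ^k := by rw [← mul_pow]; exact pow_le_pow_left₀ (by positivity) h k
  linarith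

noncomputable def EG (n : ℕ) (γ a b : ℝ) (k : ℕ) : ℝ := (∫⁻ x, (GG γ a b x : ℝ≥0∞)^k ∂(Pn n)).toReal

lemma EG_eq (n : ℕ) (hn : 1 ≤ n) {γ a b : ℝ} (hγ : 0 < γ) (hab : a ≤ b) (k : ℕ) :
    EG n γ a b k = ∑ j ∈ Finset.range (k+1), (Nat.stirlingSecond k j : ℝ) * ej n γ a b j := by
  have hfin : ∀ j, (∫⁻ x, ((GG γ a b x).descFactorial j : ℝ≥0∞) ∂(Pn n)) ≠ ∞ := fun j => by
    obtain ⟨C, _, h⟩ := ej_Dj j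
    exact (h n hn γ a b hγ hab).1
  have hmG : Measurable (fun x : Fin n → ℝ => GG γ a b x) := by
    have h := measurable_GG γ a b (n := n)
    refine measurable_to_countable' fun m => ?_
    have e : (fun x : Fin n → ℝ => GG γ a b x) ⁻¹' {m} = (fun x : Fin n → ℝ => (GG γ a b x : ℝ≥0∞)) ⁻¹' {(m : ℝ≥0∞)} := by
      ext x; simp
    rw [e]; exact h (measurableSet_singleton _)
  have hm : ∀ j, Measurable (fun x : Fin n → ℝ => ((GG γ a b x).descFactorial j : ℝ≥0∞)) := fun j =>
    (Measurable.of_discrete (f := fun m : ℕ => ((m.descFactorial j : ℕ) : ℝ≥0∞))).comp hmG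
  have e : ∀ x : Fin n → ℝ, (GG γ a b x : ℝ≥0∞)^k = ∑ j ∈ Finset.range (k+1), (Nat.stirlingSecond k j : ℝ≥0∞) * ((GG γ a b x).descFactorial j : ℝ≥0∞) := fun x => by
    have := pow_eq_stirling (GG γ a b x) k
    exact_mod_cast congrArg (Nat.cast : ℕ → ℝ≥0∞) this
  unfold EG
  simp only [e]
  rw [lintegral_finsetSum _ fun j _ => (hm j).const_mul _, ENNReal.toReal_sum]
  · refine Finset.sum_congr rfl fun j _ => ?_
    rw [lintegral_const_mul _ (hm j), ENNReal.toReal_mul, ENNReal.toReal_natCast]; rfl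
  · intro j _
    rw [lintegral_const_mul _ (hm j)]
    exact ENNReal.mul_ne_top (ENNReal.natCast_ne_top _) (hfin j)

lemma EG_mu {δ : ℝ} (hδ : 0 < δ) (hδ2 : δ ≤ 2) {k : ℕ} (hk : 1 ≤ k) : ∃ C > 0, ∀ n : ℕ, 1 ≤ n → ∀ γ a b : ℝ, 0 < γ → √n * γ ≤ 1 → 1 ≤ √n * (b - a) → a ≤ b → Bulk δ n γ a b →
    |EG n γ a b k - Mom k (mu n γ a b)| ≤ C * ((th n γ a b + th n γ a b ^ k) * ((n:ℝ)⁻¹ + n * γ^2 + (√n * (b - a))⁻¹)) := by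
  have h : ∀ j, ∃ C > 0, (1 ≤ j ∧ j ≤ k) → ∀ n : ℕ, 1 ≤ n → ∀ γ a b : ℝ, 0 < γ → √n * γ ≤ 1 → 1 ≤ √n * (b - a) → Bulk δ n γ a b →
    |ej n γ a b j - mu n γ a b ^ j| ≤ C * ((th n γ a b + th n γ a b ^ k) * ((n:ℝ)⁻¹ + n * γ^2 + (√n * (b - a))⁻¹)) := by
    intro j
    by_cases hj : 1 ≤ j ∧ j ≤ k
    · obtain ⟨C, hC, h⟩ := ej_mu hδ hδ2 hj.1 hj.2
      exact ⟨C, hC, fun _ => h⟩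
    · exact ⟨1, one_pos, fun h => absurd h hj⟩
  choose C hC h using h
  have hC' : ∀ j ∈ Finset.range (k+1), 0 ≤ (Nat.stirlingSecond k j : ℝ) * C j := fun j _ => mul_nonneg (Nat.cast_nonneg _) (hC j).le
  refine ⟨∑ j ∈ Finset.range (k+1), (Nat.stirlingSecond k j : ℝ) * C j + 1, add_pos_of_nonneg_of_pos (Finset.sum_nonneg hC') one_pos, fun n hn γ a b hγ hg hL hab hB => ?_⟩
  have hθ := th_nonneg (n := n) hγ hab
  have hR : 0 ≤ ((th n γ a b + th n γ a b ^ k) * ((n:ℝ)⁻¹ + n * γ^2 + (√n * (b - a))⁻¹)) := by positivity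
  set R := ((th n γ a b + th n γ a b ^ k) * ((n:ℝ)⁻¹ + n * γ^2 + (√n * (b - a))⁻¹))
  rw [EG_eq n hn hγ hab, Mom, ← Finset.sum_sub_distrib]
  refine (Finset.abs_sum_le_sum_abs _ _).trans ?_
  rw [add_mul, Finset.sum_mul]
  refine le_trans (Finset.sum_le_sum fun j hj => ?_) (le_add_of_nonneg_right (by linarith))
  rw [← mul_sub, abs_mul, Nat.abs_cast, mul_assoc]
  rcases Nat.eq_zero_or_pos j with rfl | hj0
  · obtain ⟨k, rfl⟩ := Nat.exists_eq_add_of_le' hk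
    rw [show Nat.stirlingSecond (k+1) 0 = 0 from Nat.stirlingSecond_succ_zero k]; simp
  · exact mul_le_mul_of_nonneg_left (h j ⟨hj0, Nat.lt_succ_iff.1 (Finset.mem_range.1 hj)⟩ n hn γ a b hγ hg hL hB) (Nat.cast_nonneg _)

lemma EG_triv {k : ℕ} (hk : 1 ≤ k) : ∃ C > 0, ∀ n : ℕ, 1 ≤ n → ∀ γ a b : ℝ, 0 < γ → a ≤ b → EG n γ a b k ≤ C * (th n γ a b + th n γ a b ^ k) := by
  obtain ⟨k, rfl⟩ := Nat.exists_eq_add_of_le' hk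
  obtain ⟨C, hC, h⟩ := momG k
  refine ⟨C * 2^(k+1), by positivity, fun n hn γ a b hγ hab => ?_⟩
  have hθ := th_nonneg (n := n) hγ hab
  have h1 := ENNReal.toReal_le_of_le_ofReal (by positivity) (h n hn γ a b hγ hab)
  refine h1.trans ?_
  rw [mul_assoc]
  exact mul_le_mul_of_nonneg_left (pow_le_add' hθ hk) hC.le

theorem final_GG {ε : ℝ} (hε : 0 < ε) {k : ℕ} (hk : 1 ≤ k) : ∃ C : ℝ, ∀ n : ℕ, 1 ≤ n → ∀ γ : ℝ, 0 < γ → ∀ a b : ℝ,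
    -((√2 - ε) * √n) < a → a ≤ b → b < (√2 - ε) * √n →
    |EG n γ a b k - Mom k (mu n γ a b)| ≤ C * Mom k (mu n γ a b) * ((n : ℝ)⁻¹ + n * γ^2 + (√n * (b - a)) ^ (-(2 : ℝ) / 3)) := by
  by_cases hε2 : √2 ≤ ε
  · refine ⟨0, fun n hn γ hγ a b ha hab hb => ?_⟩
    have : (√2 - ε) * √n ≤ 0 := mul_nonpos_of_nonpos_of_nonneg (by linarith) (Real.sqrt_nonneg _)
    linarith
  rw [not_le] at hε2
  have hs2 : √2^2 = (2:ℝ) := Real.sq_sqrt (by norm_num)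
  have hs2' : √2 < (2:ℝ) := by nlinarith [Real.sqrt_nonneg 2]
  set δ : ℝ := 2 - (√2 - ε/2)^2 with hδdef
  have hδ : 0 < δ := by nlinarith
  have hδ2 : δ ≤ 2 := by nlinarith [sq_nonneg (√2 - ε/2)]
  obtain ⟨C1, hC1, h1⟩ := EG_mu hδ hδ2 hk
  obtain ⟨C2, hC2, h2⟩ := EG_triv hk
  obtain ⟨c0, hc0, h3⟩ := mu_ge hδ hδ2
  set c := min c0 1 with hcdef
  have hc : 0 < c := lt_min hc0 one_pos
  have hc1 : c ≤ 1 := min_le_right _ _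
  have hck : 0 < c^k := by positivity
  set A := 2 / c^k with hA
  have hAp : 0 < A := by positivity
  refine ⟨C1 * A + (C2 * A + 1) * (4/ε), fun n hn γ hγ a b ha hab hb => ?_⟩
  have hn' : (1:ℝ) ≤ n := by exact_mod_cast hn
  have hsp : 0 < √(n:ℝ) := Real.sqrt_pos.2 (by linarith)
  have hsn : √(n:ℝ)^2 = n := Real.sq_sqrt (by linarith)
  have hθ := th_nonneg (n := n) hγ hab
  have hba := sub_nonneg.2 hab
  have hx2 : ∀ x : ℝ, |x| ≤ (√2 - ε/2) * √n → x^2 ≤ (2-δ) * n := fun x hx => by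
    have := sq_le_sq.2 (hx.trans (le_abs_self _))
    rw [mul_pow, hsn] at this
    rw [hδdef]; linarith
  have hbulk : ∀ x ∈ Set.Icc a b, |x| ≤ (√2 - ε) * √n := fun x hx => by
    rw [abs_le]; constructor <;> linarith [hx.1, hx.2]
  have hmu := h3 n hn γ a b hγ hab fun x hx => hx2 x ((hbulk x hx).trans (mul_le_mul_of_nonneg_right (by linarith) hsp.le))
  have hmu' : c * th n γ a b ≤ mu n γ a b := (mul_le_mul_of_nonneg_right (min_le_left _ _) hθ).trans hmu
  have hM := Mom_lower hk hc hc1 hθ hmu'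
  have hM' : th n γ a b + th n γ a b ^ k ≤ A * Mom k (mu n γ a b) := by
    rw [hA, div_mul_eq_mul_div, le_div_iff₀ hck]; linarith
  have hM0 : 0 ≤ Mom k (mu n γ a b) := by
    have : 0 ≤ c^k * (th n γ a b + th n γ a b ^ k) := by positivity
    linarith
  have hE0 : 0 ≤ EG n γ a b k := ENNReal.toReal_nonneg
  have hE := h2 n hn γ a b hγ hab
  set M := Mom k (mu n γ a b) with hMd
  have hErp : 0 ≤ (√n * (b - a)) ^ (-(2 : ℝ) / 3) := by positivity
  set r := (√n * (b - a)) ^ (-(2 : ℝ) / 3) with hr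
  have hni : 0 ≤ (n:ℝ)⁻¹ := by positivity
  have hng : 0 ≤ (n:ℝ) * γ^2 := by positivity
  -- the trivial bound
  have triv : ε/4 ≤ (n : ℝ)⁻¹ + n * γ^2 + r → |EG n γ a b k - M| ≤ (C1 * A + (C2 * A + 1) * (4/ε)) * M * ((n : ℝ)⁻¹ + n * γ^2 + r) := by
    intro he
    have e1 : |EG n γ a b k - M| ≤ (C2 * A + 1) * M := by
      have : EG n γ a b k ≤ C2 * (A * M) := hE.trans (mul_le_mul_of_nonneg_left hM' hC2.le)
      have := mul_nonneg hC2.le (mul_nonneg hAp.le hM0)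
      have e0 : (C2 * A + 1) * M = C2 * (A * M) + M := by ring
      rw [abs_le, e0]; constructor <;> linarith
    have e2 : 1 ≤ (4/ε) * ((n : ℝ)⁻¹ + n * γ^2 + r) := by
      rw [div_mul_eq_mul_div, le_div_iff₀ hε]; linarith
    calc _ ≤ (C2 * A + 1) * M * 1 := by rw [mul_one]; exact e1
      _ ≤ (C2 * A + 1) * M * ((4/ε) * ((n : ℝ)⁻¹ + n * γ^2 + r)) := mul_le_mul_of_nonneg_left e2 (by positivity)
      _ ≤ _ := by
        have : 0 ≤ C1 * A * M * ((n : ℝ)⁻¹ + n * γ^2 + r) := by positivity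
        linarith
  rcases hab.eq_or_lt with rfl | hlt
  · have ht0 : th n γ a a = 0 := by simp [th]
    have hm0 : mu n γ a a = 0 := by simp [mu]
    have hk0 : k ≠ 0 := by omega
    have hEz : EG n γ a a k = 0 := by
      rw [ht0] at hE; simp [hk0] at hE; linarith
    have hMz : M = 0 := by
      rw [hMd, hm0, Mom]
      refine Finset.sum_eq_zero fun j _ => ?_
      rcases Nat.eq_zero_or_pos j with rfl | hj0
      · obtain ⟨k, rfl⟩ := Nat.exists_eq_add_of_le' hk
        rw [show Nat.stirlingSecond (k+1) 0 = 0 from Nat.stirlingSecond_succ_zero k]; simp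
      · simp [hj0.ne']
    rw [hEz, hMz]; simp
  have hLpos : 0 < √n * (b - a) := mul_pos hsp (by linarith)
  by_cases c1 : (n:ℝ) < 2/ε
  · refine triv ?_
    have : ε/2 ≤ (n:ℝ)⁻¹ := by
      rw [le_inv_comm₀ (by positivity) (by linarith), inv_div]; exact c1.le
    linarith
  by_cases c2 : √n * γ ≤ 1
  swap
  · refine triv ?_
    have : 1 ≤ (n:ℝ) * γ^2 := by
      rw [← hsn, ← mul_pow]; exact one_le_pow₀ (not_le.1 c2).le
    linarith
  by_cases c3 : 1 ≤ √n * (b - a)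
  swap
  · refine triv ?_
    have : 1 ≤ r := Real.one_le_rpow_of_pos_of_le_one_of_nonpos hLpos (not_le.1 c3).le (by norm_num)
    linarith
  have hB : Bulk δ n γ a b := by
    intro x hx ξ hξ
    refine hx2 ξ ?_
    have h4 : |ξ| ≤ |x| + |ξ - x| := by
      have := abs_add_le x (ξ - x); simpa using this
    have h5 : γ ≤ ε/2 * √n := by
      have : 1 ≤ ε/2 * √n * √n := by
        rw [not_lt, div_le_iff₀ hε] at c1
        nlinarith
      by_contra hcon
      rw [not_le] at hcon
      have : ε/2 * √n * √n < γ * √n := mul_lt_mul_of_pos_right hcon hsp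
      linarith
    have := hbulk x hx
    linarith
  have hmain := h1 n hn γ a b hγ c2 c3 hab hB
  have hLr : (√n * (b - a))⁻¹ ≤ r := by
    rw [hr, ← Real.rpow_neg_one]
    exact Real.rpow_le_rpow_of_exponent_le c3 (by norm_num)
  have hLi : 0 ≤ (√n * (b - a))⁻¹ := by positivity
  calc _ ≤ _ := hmain
    _ ≤ C1 * (A * M * ((n : ℝ)⁻¹ + n * γ^2 + r)) := by
        refine mul_le_mul_of_nonneg_left (mul_le_mul hM' (by linarith) (by positivity) (by positivity)) hC1.le
    _ ≤ _ := by
        have : 0 ≤ (C2 * A + 1) * (4/ε) * M * ((n : ℝ)⁻¹ + n * γ^2 + r) := by positivity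
        linarith

end GM

namespace GM

noncomputable def NN (γ a b : ℝ) {n : ℕ} (x : Fin n → ℝ) : ℝ≥0∞ := ∑ p, ∑ q, ind (p ≠ q ∧ Ap γ a b (x p) (x q))

lemma measurable_NN (γ a b : ℝ) {n : ℕ} : Measurable (fun x : Fin n → ℝ => NN γ a b x) := by
  unfold NN
  refine Finset.measurable_sum _ fun p _ => Finset.measurable_sum _ fun q _ => measurable_ind ?_
  by_cases h : p = q
  · simp [h]
  · simp only [ne_eq, h, not_false_eq_true, true_and]
    exact measurableSet_Ap γ a b (measurable_pi_apply p) (measurable_pi_apply q)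

lemma NN_symm (γ a b : ℝ) {n : ℕ} (σ : Equiv.Perm (Fin n)) (x : Fin n → ℝ) : NN γ a b (x ∘ σ) = NN γ a b x := by
  unfold NN
  rw [← Equiv.sum_comp σ (fun p => ∑ q, ind (p ≠ q ∧ Ap γ a b (x p) (x q)))]
  refine Finset.sum_congr rfl fun p _ => ?_
  rw [← Equiv.sum_comp σ (fun q => ind (σ p ≠ q ∧ Ap γ a b (x (σ p)) (x q)))]
  refine Finset.sum_congr rfl fun q _ => ?_
  simp

lemma ind_split {p q r : Prop} (h : p ↔ (q ∨ r)) (hd : q → ¬ r) : ind p = ind q + ind r := by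
  by_cases hq : q
  · rw [ind_true hq, ind_true (h.2 (Or.inl hq)), ind_false (hd hq), add_zero]
  · by_cases hr : r
    · rw [ind_true hr, ind_true (h.2 (Or.inr hr)), ind_false hq, zero_add]
    · rw [ind_false hq, ind_false hr, ind_false (by tauto), zero_add]

lemma NN_card (γ a b : ℝ) {n : ℕ} (x : Fin n → ℝ) : NN γ a b x =
    2 * ((Nat.card {p : Fin n × Fin n // p.1 < p.2 ∧ |x p.1 - x p.2| ≤ γ ∧ (x p.1 + x p.2) / 2 ∈ Set.Icc a b} : ℕ) : ℝ≥0∞) := by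
  rw [card_ind, Fintype.sum_prod_type, NN, two_mul]
  nth_rewrite 3 [Finset.sum_comm]
  simp only [← Finset.sum_add_distrib]
  refine Finset.sum_congr rfl fun p _ => Finset.sum_congr rfl fun q _ => ?_
  refine ind_split ?_ ?_
  · constructor
    · rintro ⟨h1, h2⟩
      rcases lt_or_gt_of_ne h1 with h | h
      · exact Or.inl ⟨h, h2⟩
      · exact Or.inr ⟨h, Ap_symm h2⟩
    · rintro (⟨h1, h2⟩ | ⟨h1, h2⟩)
      · exact ⟨h1.ne, h2⟩
      · exact ⟨h1.ne', Ap_symm h2⟩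
  · rintro ⟨h1, _⟩ ⟨h2, _⟩
    exact absurd h1 h2.not_gt

lemma NN_GG (γ a b : ℝ) {n : ℕ} (x : Fin n → ℝ) (hx : Function.Injective x) : NN γ a b x = 2 * (GG γ a b x : ℝ≥0∞) := by
  rw [GG_eq, NN, two_mul]
  nth_rewrite 3 [Finset.sum_comm]
  simp only [← Finset.sum_add_distrib]
  refine Finset.sum_congr rfl fun p _ => Finset.sum_congr rfl fun q _ => ?_
  refine ind_split ?_ ?_
  · constructor
    · rintro ⟨h1, h2, h3⟩
      rcases lt_or_gt_of_ne (fun h => h1 (hx h) : x p ≠ x q) with h | h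
      · refine Or.inr ⟨by linarith, ?_, by rwa [add_comm]⟩
        rw [abs_sub_comm] at h2; exact (le_abs_self _).trans h2
      · exact Or.inl ⟨by linarith, (le_abs_self _).trans h2, h3⟩
    · rintro (h | h)
      · refine ⟨?_, Bp_Ap h⟩
        rintro rfl; have := h.1; simp at this
      · refine ⟨?_, Ap_symm (Bp_Ap h)⟩
        rintro rfl; have := h.1; simp at this
  · rintro ⟨h1, _⟩ ⟨h2, _⟩
    linarith

lemma inj_ae (n : ℕ) : ∀ᵐ x ∂(Pn n), Function.Injective x := by
  rw [Pn, ae_withDensity_iff rho_meas]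
  refine Filter.Eventually.of_forall fun x hx p q hpq => ?_
  by_contra hne
  apply hx
  have : rho n x = 0 := by
    refine det_gm_eq_zero _ (Pi.single p 1 - Pi.single q 1) ?_ ?_
    · intro h
      have := congrFun h p
      simp [hne] at this
    · simp only [Pi.sub_apply, sub_smul, Finset.sum_sub_distrib, Pi.single_apply, ite_smul, one_smul, zero_smul]
      simp [hpq]
  rw [this]; simp

lemma matrix_moment {n : ℕ} {P : Measure (HM n)} [IsProbabilityMeasure P] (hP : IsGUE P) (γ a b : ℝ) (k : ℕ) (G : HM n → ℕ)
    (hG : ∀ M, G M = Nat.card {p : Fin n × Fin n // p.1 < p.2 ∧ |eig M p.1 - eig M p.2| ≤ γ ∧ (eig M p.1 + eig M p.2) / 2 ∈ Set.Icc a b}) :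
    ∫ M, ((G M : ℝ))^k ∂P = EG n γ a b k := by
  have h2 : (2:ℝ≥0∞) ≠ 0 := by norm_num
  have h2' : (2:ℝ≥0∞) ≠ ∞ := by norm_num
  have hm : Measurable (fun x : Fin n → ℝ => (2⁻¹ * NN γ a b x)^k) := ((measurable_NN γ a b).const_mul _).pow_const k
  have e1 : ∀ M, (2⁻¹ * NN γ a b (eig M))^k = (G M : ℝ≥0∞)^k := fun M => by
    rw [NN_card, ← hG M, ← mul_assoc, ENNReal.inv_mul_cancel h2 h2', one_mul]
  have e2 : ∀ M, ((G M : ℝ))^k = ((2⁻¹ * NN γ a b (eig M))^k).toReal := fun M => by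
    rw [e1]; simp
  have hl := eig_law hP hm fun σ x => by rw [NN_symm]
  simp only [e2]
  have hme : Measurable (fun M : HM n => (2⁻¹ * NN γ a b (eig M))^k) := hm.comp measurable_eig
  rw [integral_toReal hme.aemeasurable (Filter.Eventually.of_forall fun M => by
    rw [e1]; exact ENNReal.pow_lt_top (ENNReal.natCast_lt_top _)), hl, EG]
  congr 1
  refine lintegral_congr_ae ?_
  filter_upwards [inj_ae n] with x hx
  rw [NN_GG γ a b x hx, ← mul_assoc, ENNReal.inv_mul_cancel h2 h2', one_mul]

end GM

/-- **Moment Estimation Theorem, GUE version.**  Let `GUE n` be the probability measure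
on `n × n` complex Hermitian matrices with density proportional to `exp (-tr M²)` with
respect to an additive Haar measure.  For an interval `I = [a, b]` inside
`(-(√2-ε)√n, (√2-ε)√n)` and `γ > 0`, let `G M` count unordered pairs of eigenvalues of
`M` that are `γ`-close with midpoint in `I`.  With `μP = (π²γ³/9) ∫_I K n (x,x)⁴ dx`
(`K n (x,x)` the diagonal GUE kernel built from physicists' Hermite polynomials) and
`Mk` the `k`-th Poisson moment with mean `μP`, for every `ε > 0` and `k ≥ 1` there is a
constant `C` with `|E (G^k) - Mk| ≤ C Mk (n⁻¹ + nγ² + (√n |I|)^{-2/3})`. -/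
theorem moment_estimation_GUE
    (H : ℕ → ℝ → ℝ)
    (hH : ∀ m x, H m x = (2 : ℝ) ^ ((m : ℝ) / 2) *
      Polynomial.aeval (x * Real.sqrt 2) (Polynomial.hermite m))
    (ε : ℝ) (hε : 0 < ε) (k : ℕ) (hk : 1 ≤ k) :
    ∃ C : ℝ, ∀ n : ℕ, 1 ≤ n →
      ∀ ν P : Measure (selfAdjoint (Matrix (Fin n) (Fin n) ℂ)),
      ν.IsAddHaarMeasure → IsProbabilityMeasure P →
      -- `P` has density proportional to `exp (-tr M²)` w.r.t. the Haar measure `ν`: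
      (∃ c : ℝ≥0∞, P = c • ν.withDensity (fun M =>
        ENNReal.ofReal (Real.exp
          (-(Matrix.trace ((M : Matrix (Fin n) (Fin n) ℂ) *
              (M : Matrix (Fin n) (Fin n) ℂ))).re)))) →
      ∀ γ : ℝ, 0 < γ → ∀ a b : ℝ,
        -((Real.sqrt 2 - ε) * Real.sqrt n) < a → a ≤ b →
        b < (Real.sqrt 2 - ε) * Real.sqrt n →
      -- the eigenvalues of `M`, with multiplicity:
      ∀ lam : selfAdjoint (Matrix (Fin n) (Fin n) ℂ) → Fin n → ℝ,
      (∀ M, lam M = Matrix.IsHermitian.eigenvalues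
        (show Matrix.IsHermitian (M : Matrix (Fin n) (Fin n) ℂ) from M.prop)) →
      -- the number of `γ`-close eigenvalue pairs with midpoint in `I = [a, b]`:
      ∀ G : selfAdjoint (Matrix (Fin n) (Fin n) ℂ) → ℕ,
      (∀ M, G M = Nat.card {p : Fin n × Fin n // p.1 < p.2 ∧
          |lam M p.1 - lam M p.2| ≤ γ ∧
          (lam M p.1 + lam M p.2) / 2 ∈ Set.Icc a b}) →
      -- the diagonal GUE kernel:
      ∀ Kdiag : ℝ → ℝ,
      (∀ x, Kdiag x = Real.exp (-x ^ 2) /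
          (2 ^ n * ((n - 1).factorial : ℝ) * Real.sqrt π) *
          (deriv (H n) x * H (n - 1) x - deriv (H (n - 1)) x * H n x)) →
      -- the Poisson mean and `k`-th Poisson moment:
      ∀ μP Mk : ℝ,
      μP = π ^ 2 * γ ^ 3 / 9 * ∫ x in Set.Icc a b, (Kdiag x) ^ 4 →
      Mk = ∑' m : ℕ, (m : ℝ) ^ k * Real.exp (-μP) * μP ^ m / (m.factorial : ℝ) →
      |(∫ M, ((G M : ℝ)) ^ k ∂P) - Mk| ≤
        C * Mk * ((n : ℝ)⁻¹ + (n : ℝ) * γ ^ 2 +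
          (Real.sqrt n * (b - a)) ^ (-(2 : ℝ) / 3)) := by
  obtain ⟨C, hC⟩ := GM.final_GG hε hk
  refine ⟨C, ?_⟩
  intro n hn ν P hν hP hd γ hγ a b ha hab hb lam hlam G hG Kdiag hK μP Mk hμ hMk
  have hGUE : GM.IsGUE P := ⟨ν, hν, hd⟩
  have hl : lam = GM.eig := funext hlam
  subst hl
  have hintg := GM.matrix_moment hGUE γ a b k G hG
  have hKe : ∀ x, Kdiag x = GM.dK 0 0 n x x := fun x => by rw [hK x]; exact GM.Kdiag_eq H hH n hn x
  simp only [hKe] at hμ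
  have hμ' : μP = GM.mu n γ a b := hμ
  rw [hintg, hMk, GM.poisson_moment, hμ']
  exact hC n hn γ hγ a b ha hab hb
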